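/- Under P_n, the expectation vector of the partial endpoint satisfies, as n → ∞, (1/n)·μ^n(C_1) = μ(C_1) + O(n^{-1/(d+1)}); in particular lim_{n→∞} (1/n)·μ^n(C_1) = μ(C_1). -/

import Mathlib

open MeasureTheory ProbabilityTheory Real Filter Asymptotics Topology Matrix

noncomputable section

/-- Real values of the Riemann zeta function at integer arguments. -/
def zetaR (s : ℕ) : ℝ := ∑' k : ℕ+, (1 : ℝ) / (k : ℝ) ^ s

/-- A vector of `ℤ^d` is primitive if it is nonzero and the gcd of its coordinates is 1. -/
def IsPrimitiveVec {d : ℕ} (v : Fin d → ℤ) : Prop :=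
  v ≠ 0 ∧ Finset.univ.gcd v = 1

/-- The set of primitive vectors of `ℤ^d`, viewed inside `ℝ^d`. -/
def primSet (d : ℕ) : Set (EuclideanSpace ℝ (Fin d)) :=
  {y | ∃ v : Fin d → ℤ, IsPrimitiveVec v ∧ ∀ i, y i = (v i : ℝ)}

/-- Dot product on `ℝ^d`. -/
def dotR {d : ℕ} (a x : EuclideanSpace ℝ (Fin d)) : ℝ := ∑ i, a i * x i

/-- `β_n = (ζ(d+1) / (ζ(d) n))^{1/(d+1)}`. -/
def betaSeq (d : ℕ) (n : ℕ) : ℝ :=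
  (zetaR (d + 1) / (zetaR d * n)) ^ ((1 : ℝ) / (d + 1))

/-- A `d`-dimensional closed convex pointed (salient) cone containing `0`. -/
structure IsGoodCone {d : ℕ} (C : Set (EuclideanSpace ℝ (Fin d))) : Prop where
  closed : IsClosed C
  convex : Convex ℝ C
  smul_mem : ∀ (c : ℝ), 0 ≤ c → ∀ x ∈ C, c • x ∈ C
  salient : C ∩ (-C) ⊆ {0}
  fullDim : (interior C).Nonempty
  zero_mem : (0 : EuclideanSpace ℝ (Fin d)) ∈ C

/-- `μ^n(C_1) = Σ_{x ∈ P_d ∩ C_1} x e^{-β_n a·x} / (1 - e^{-β_n a·x})`. -/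
def muN {d : ℕ} (a : EuclideanSpace ℝ (Fin d)) (S : Set (EuclideanSpace ℝ (Fin d))) (n : ℕ) :
    EuclideanSpace ℝ (Fin d) :=
  ∑' x : ↥(primSet d ∩ S),
    (Real.exp (-(betaSeq d n * dotR a x)) / (1 - Real.exp (-(betaSeq d n * dotR a x)))) •
      (x : EuclideanSpace ℝ (Fin d))

/-- `μ(C_1) = (d+1)! ∫_{C(a ≤ 1) ∩ C_1} x dx`. -/
def muLim {d : ℕ} (a : EuclideanSpace ℝ (Fin d)) (C S : Set (EuclideanSpace ℝ (Fin d))) :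
    EuclideanSpace ℝ (Fin d) :=
  (Nat.factorial (d + 1) : ℝ) • ∫ x in ({x ∈ C | dotR a x ≤ 1} ∩ S), x

/-- `Γ^n(C_1) = Σ_{x ∈ P_d ∩ C_1} x xᵀ e^{-β_n a·x} / (1 - e^{-β_n a·x})²`. -/
def GammaN {d : ℕ} (a : EuclideanSpace ℝ (Fin d)) (S : Set (EuclideanSpace ℝ (Fin d))) (n : ℕ) :
    Matrix (Fin d) (Fin d) ℝ :=
  Matrix.of fun i j => ∑' x : ↥(primSet d ∩ S),
    (x : EuclideanSpace ℝ (Fin d)) i * (x : EuclideanSpace ℝ (Fin d)) j *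
      (Real.exp (-(betaSeq d n * dotR a x)) / (1 - Real.exp (-(betaSeq d n * dotR a x))) ^ 2)

/-- `Γ(C_1) = (ζ(d)/ζ(d+1))^{1/(d+1)} (d+1)! ∫_{C(a ≤ 1) ∩ C_1} x xᵀ dx`. -/
def GammaLim {d : ℕ} (a : EuclideanSpace ℝ (Fin d)) (C S : Set (EuclideanSpace ℝ (Fin d))) :
    Matrix (Fin d) (Fin d) ℝ :=
  Matrix.of fun i j =>
    (zetaR d / zetaR (d + 1)) ^ ((1 : ℝ) / (d + 1)) * (Nat.factorial (d + 1) : ℝ) *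
      ∫ x in ({x ∈ C | dotR a x ≤ 1} ∩ S), x i * x j

/-- Reinterpret a plain vector of `Fin d → ℝ` as a point of Euclidean space. -/
def toE {d : ℕ} (v : Fin d → ℝ) : EuclideanSpace ℝ (Fin d) :=
  (EuclideanSpace.equiv (Fin d) ℝ).symm v

/-- Apply a matrix to a vector of Euclidean space. -/
def mulVecE {d : ℕ} (M : Matrix (Fin d) (Fin d) ℝ) (v : EuclideanSpace ℝ (Fin d)) :
    EuclideanSpace ℝ (Fin d) :=
  toE (M.mulVec fun i => v i)

/-- The standard Gaussian measure on `ℝ^d`. -/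
def stdGaussian (d : ℕ) : Measure (EuclideanSpace ℝ (Fin d)) :=
  volume.withDensity fun x =>
    ENNReal.ofReal ((2 * π) ^ (-(d : ℝ) / 2) * Real.exp (-‖x‖ ^ 2 / 2))

/-- `X^n(C_1) = Σ_{x ∈ P_d ∩ C_1} ω(x) x`, where the multiplicities are indexed by the
primitive vectors of the ambient cone `C`. -/
def Xpart {d : ℕ} {Ω : Type} (C C1 : Set (EuclideanSpace ℝ (Fin d)))
    (ωm : ↥(primSet d ∩ C) → Ω → ℕ) (ω' : Ω) : EuclideanSpace ℝ (Fin d) :=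
  ∑' x : ↥(primSet d ∩ C),
    Set.indicator C1 (fun _ => (ωm x ω' : ℝ) • (x : EuclideanSpace ℝ (Fin d)))
      (x : EuclideanSpace ℝ (Fin d))



lemma aux_moebius_sum (n : ℕ) :
    |∑ m ∈ Finset.Ioc 0 n, ((ArithmeticFunction.moebius m : ℤ) : ℝ) / (m : ℝ)| ≤ 1 := by
  rcases Nat.eq_zero_or_pos n with rfl | hn
  · simp
  have h := ArithmeticFunction.sum_Ioc_mul_zeta_eq_sum
    (R := ℝ) (ArithmeticFunction.moebius : ArithmeticFunction ℝ) n
  rw [ArithmeticFunction.coe_moebius_mul_coe_zeta] at h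
  have h1 : ∑ m ∈ Finset.Ioc 0 n, (1 : ArithmeticFunction ℝ) m = 1 := by
    rw [Finset.sum_eq_single 1]
    · simp
    · intro b _ hb; simp [hb]
    · intro h; exact absurd (Finset.mem_Ioc.2 ⟨by norm_num, hn⟩) h
  rw [h1] at h
  have hn' : (0 : ℝ) < n := by exact_mod_cast hn
  have key : (n : ℝ) * ∑ m ∈ Finset.Ioc 0 n, ((ArithmeticFunction.moebius m : ℤ) : ℝ) / (m : ℝ)
      = 1 + ∑ m ∈ Finset.Ioc 0 n, ((ArithmeticFunction.moebius m : ℤ) : ℝ) *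
        ((n : ℝ) / m - (n / m : ℕ)) := by
    rw [h, Finset.mul_sum, ← Finset.sum_add_distrib]
    apply Finset.sum_congr rfl
    intro m _
    simp only [ArithmeticFunction.intCoe_apply]
    ring
  have hmu : ∀ m : ℕ, |((ArithmeticFunction.moebius m : ℤ) : ℝ)| ≤ 1 := by
    intro m
    have := ArithmeticFunction.abs_moebius_le_one (n := m)
    exact_mod_cast this
  have hb : |∑ m ∈ Finset.Ioc 0 n, ((ArithmeticFunction.moebius m : ℤ) : ℝ) *
        ((n : ℝ) / m - (n / m : ℕ))| ≤ n - 1 := by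
    have hsplit : Finset.Ioc 0 n = insert 1 (Finset.Ioc 1 n) := by
      ext x; simp only [Finset.mem_Ioc, Finset.mem_insert]; omega
    rw [hsplit, Finset.sum_insert (by simp)]
    simp only [Nat.cast_one, div_one, Nat.div_one, sub_self, mul_zero, zero_add]
    refine (Finset.abs_sum_le_sum_abs _ _).trans ?_
    have : (n : ℝ) - 1 = ∑ m ∈ Finset.Ioc 1 n, (1 : ℝ) := by
      simp [Nat.cast_sub hn]
    rw [this]
    apply Finset.sum_le_sum
    intro m hm
    have hm0 : 0 < m := by have := (Finset.mem_Ioc.1 hm).1; omega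
    rw [abs_mul]
    have h1 : |(n : ℝ) / m - (n / m : ℕ)| ≤ 1 := by
      rw [← Nat.floor_div_eq_div (K := ℝ)]
      have h0 : (0 : ℝ) ≤ (n : ℝ) / m := by positivity
      have := Nat.floor_le h0
      have := Nat.lt_floor_add_one ((n : ℝ) / m)
      rw [abs_le]; constructor <;> linarith
    calc _ ≤ (1 : ℝ) * 1 := mul_le_mul (hmu m) h1 (abs_nonneg _) zero_le_one
      _ = 1 := by norm_num
  have : |(n : ℝ) * ∑ m ∈ Finset.Ioc 0 n, ((ArithmeticFunction.moebius m : ℤ) : ℝ) / (m : ℝ)| ≤ n := by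
    rw [key]
    refine (abs_add_le _ _).trans ?_
    simp only [abs_one]; linarith
  rw [abs_mul, abs_of_pos hn'] at this
  by_contra hc
  push Not at hc
  nlinarith

lemma aux_moebius_range (n : ℕ) :
    |∑ m ∈ Finset.range n, ((ArithmeticFunction.moebius (m+1) : ℤ) : ℝ) / ((m+1 : ℕ) : ℝ)| ≤ 1 := by
  have := aux_moebius_sum n
  rw [← Finset.sum_image (s := Finset.range n) (g := fun m => m + 1)
    (f := fun m : ℕ => ((ArithmeticFunction.moebius m : ℤ) : ℝ) / (m : ℝ)) (by simp)]
  convert this using 3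
  ext x; simp only [Finset.mem_image, Finset.mem_range, Finset.mem_Ioc]
  constructor
  · rintro ⟨y, hy, rfl⟩; omega
  · rintro ⟨h1, h2⟩; exact ⟨x - 1, by omega, by omega⟩

lemma abel_bound (f g : ℕ → ℝ) (hf : Antitone f) (hf0 : ∀ n, 0 ≤ f n)
    (hg : ∀ n, |∑ i ∈ Finset.range n, g i| ≤ 1) (n : ℕ) :
    |∑ i ∈ Finset.range n, g i * f i| ≤ f 0 := by
  have key : ∀ n, |∑ i ∈ Finset.range n, g i * f i - (∑ i ∈ Finset.range n, g i) * f n|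
      ≤ f 0 - f n := by
    intro n
    induction n with
    | zero => simp
    | succ k ih =>
      rw [Finset.sum_range_succ, Finset.sum_range_succ]
      have h1 : ∑ i ∈ Finset.range k, g i * f i + g k * f k
          - (∑ i ∈ Finset.range k, g i + g k) * f (k+1) =
          (∑ i ∈ Finset.range k, g i * f i - (∑ i ∈ Finset.range k, g i) * f k)
          + (∑ i ∈ Finset.range (k+1), g i) * (f k - f (k+1)) := by
        rw [Finset.sum_range_succ]; ring
      rw [h1]
      refine (abs_add_le _ _).trans ?_
      have h2 : 0 ≤ f k - f (k+1) := sub_nonneg.2 (hf (Nat.le_succ k))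
      rw [abs_mul, abs_of_nonneg h2]
      nlinarith [hg (k+1)]
  have h1 := key n
  have h2 : |(∑ i ∈ Finset.range n, g i) * f n| ≤ f n := by
    rw [abs_mul, abs_of_nonneg (hf0 n)]
    nlinarith [hg n, hf0 n]
  rw [abs_le] at *
  constructor <;> linarith [h1.1, h1.2, h2.1, h2.2]

def Qf (s : ℝ) : ℝ := exp (-s) / (1 - exp (-s))
def Pf (s : ℝ) : ℝ := exp (-s) / (1 - exp (-s)) ^ 2

lemma one_sub_exp_pos {s : ℝ} (hs : 0 < s) : 0 < 1 - exp (-s) := by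
  have : exp (-s) < 1 := by rw [Real.exp_lt_one_iff]; linarith
  linarith

lemma Qf_nonneg {s : ℝ} (hs : 0 < s) : 0 ≤ Qf s := by
  have := one_sub_exp_pos hs
  unfold Qf; positivity

lemma Pf_nonneg {s : ℝ} (_hs : 0 < s) : 0 ≤ Pf s := by
  unfold Pf; positivity

lemma Qf_le {s : ℝ} (hs : 0 < s) : Qf s ≤ 1 / s := by
  have h := one_sub_exp_pos hs
  unfold Qf
  rw [div_le_div_iff₀ h hs]
  have h1 : exp (-s) * exp s = 1 := by rw [← exp_add]; simp
  have h2 := add_one_le_exp s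
  have h3 := exp_pos (-s)
  nlinarith

lemma Qf_le_sq {s : ℝ} (hs : 0 < s) : Qf s ≤ 2 / s ^ 2 := by
  have h := one_sub_exp_pos hs
  unfold Qf
  rw [div_le_div_iff₀ h (by positivity)]
  have h1 : exp (-s) * exp s = 1 := by rw [← exp_add]; simp
  have h2 := quadratic_le_exp_of_nonneg hs.le
  have h3 := exp_pos (-s)
  nlinarith

lemma Pf_le {s : ℝ} (hs : 0 < s) : Pf s ≤ 1 / s ^ 2 := by
  have h := one_sub_exp_pos hs
  have h4 : Pf s = 1 / (2 * Real.sinh (s/2)) ^ 2 := by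
    unfold Pf
    rw [Real.sinh_eq]
    have h5 : exp (-s) = exp (-(s/2)) ^ 2 := by rw [← Real.exp_nat_mul]; congr 1; push_cast; ring
    have h6 : exp (s/2) = 1 / exp (-(s/2)) := by rw [Real.exp_neg]; simp
    rw [h6]
    rw [h5] at h ⊢
    have := exp_pos (-(s/2))
    have h7 : (1 / exp (-(s/2)) - exp (-(s/2))) = (1 - exp (-(s/2))^2) / exp (-(s/2)) := by
      field_simp
    rw [h7]
    field_simp
  rw [h4]
  have h8 : s/2 ≤ Real.sinh (s/2) := Real.self_le_sinh_iff.2 (by positivity)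
  apply one_div_le_one_div_of_le (by positivity)
  apply pow_le_pow_left₀ hs.le; linarith

lemma sinh_le_mul_cosh {y : ℝ} (hy : 0 ≤ y) : Real.sinh y ≤ y * Real.cosh y := by
  have hd : ∀ x, HasDerivAt (fun x => x * Real.cosh x - Real.sinh x) (x * Real.sinh x) x := by
    intro x
    have := ((hasDerivAt_id x).mul (Real.hasDerivAt_cosh x)).sub (Real.hasDerivAt_sinh x)
    convert! this using 1
    simp
  have hm : MonotoneOn (fun x => x * Real.cosh x - Real.sinh x) (Set.Ici 0) := by
    apply monotoneOn_of_deriv_nonneg (convex_Ici 0)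
    · exact fun x _ => (hd x).continuousAt.continuousWithinAt
    · exact fun x _ => (hd x).differentiableAt.differentiableWithinAt
    · intro x hx
      rw [interior_Ici] at hx
      rw [(hd x).deriv]
      exact mul_nonneg (le_of_lt hx) (Real.sinh_nonneg_iff.2 (le_of_lt hx))
  have := hm (Set.mem_Ici.2 le_rfl) (Set.mem_Ici.2 hy) hy
  simp at this
  linarith

lemma Pf_ge {s : ℝ} (hs : 0 < s) : 1 / s ^ 2 - Pf s ≤ 1 := by
  have h := one_sub_exp_pos hs
  have h4 : Pf s = 1 / (2 * Real.sinh (s/2)) ^ 2 := by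
    unfold Pf
    rw [Real.sinh_eq]
    have h5 : exp (-s) = exp (-(s/2)) ^ 2 := by rw [← Real.exp_nat_mul]; congr 1; push_cast; ring
    have h6 : exp (s/2) = 1 / exp (-(s/2)) := by rw [Real.exp_neg]; simp
    rw [h6]
    rw [h5] at h ⊢
    have := exp_pos (-(s/2))
    have h7 : (1 / exp (-(s/2)) - exp (-(s/2))) = (1 - exp (-(s/2))^2) / exp (-(s/2)) := by
      field_simp
    rw [h7]
    field_simp
  rw [h4]
  set y := s/2 with hy
  have hy0 : 0 < y := by positivity
  have hs2 : s = 2 * y := by rw [hy]; ring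
  rw [hs2]
  have h1 := sinh_le_mul_cosh hy0.le
  have h2 := Real.cosh_sq y
  have h3 : 0 < Real.sinh y := Real.sinh_pos_iff.2 hy0
  have h5 : Real.sinh y ^ 2 ≤ y ^ 2 * (Real.sinh y ^ 2 + 1) := by
    rw [← h2, ← mul_pow]; exact pow_le_pow_left₀ h3.le h1 2
  have h6 : 1 / (2 * y) ^ 2 - 1 / (2 * Real.sinh y) ^ 2
      = (Real.sinh y ^ 2 - y ^ 2) / (4 * (y ^ 2 * Real.sinh y ^ 2)) := by
    field_simp; ring
  rw [h6, div_le_one (by positivity)]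
  nlinarith [sq_nonneg (y * Real.sinh y)]

/-- `1/s - Q(s)`. -/
def Rf (s : ℝ) : ℝ := 1 / s - Qf s

lemma Rf_nonneg {s : ℝ} (hs : 0 < s) : 0 ≤ Rf s := sub_nonneg.2 (Qf_le hs)

lemma Rf_le_inv {s : ℝ} (hs : 0 < s) : Rf s ≤ 1 / s := by
  unfold Rf; linarith [Qf_nonneg hs]

lemma Rf_le_one {s : ℝ} (hs : 0 < s) : Rf s ≤ 1 := by
  have h := one_sub_exp_pos hs
  unfold Rf Qf
  rw [sub_le_iff_le_add, div_le_iff₀ hs, add_mul, one_mul]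
  have h2 := add_one_le_exp (-s)
  have : exp (-s) / (1 - exp (-s)) * s ≥ exp (-s) := by
    rw [ge_iff_le, div_mul_eq_mul_div, le_div_iff₀ h]
    have := exp_pos (-s)
    nlinarith
  linarith

lemma Rf_antitone : AntitoneOn Rf (Set.Ioi 0) := by
  have hd : ∀ x : ℝ, 0 < x → HasDerivAt Rf (-(1 / x ^ 2 - Pf x)) x := by
    intro x hx
    have h := one_sub_exp_pos hx
    have h1 : HasDerivAt (fun s : ℝ => exp (-s)) (-exp (-x)) x := by
      simpa using (hasDerivAt_neg x).exp
    have h2 : HasDerivAt (fun s : ℝ => 1 - exp (-s)) (exp (-x)) x := by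
      simpa using h1.const_sub 1
    have h3 := h1.div h2 h.ne'
    have h4 := (hasDerivAt_inv hx.ne').sub h3
    have h5 : Rf = (fun s => s⁻¹) - (fun s : ℝ => exp (-s)) / (fun s : ℝ => 1 - exp (-s)) := by
      ext s; simp [Rf, Qf]
    rw [h5]
    refine h4.congr_deriv ?_
    unfold Pf
    field_simp
    ring
  apply antitoneOn_of_deriv_nonpos (convex_Ioi 0)
  · exact fun x hx => (hd x hx).continuousAt.continuousWithinAt
  · intro x hx
    rw [interior_Ioi] at hx
    exact (hd x hx).differentiableAt.differentiableWithinAt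
  · intro x hx
    rw [interior_Ioi] at hx
    rw [(hd x hx).deriv]
    linarith [Pf_le hx]

abbrev muR (m : ℕ+) : ℝ := ((ArithmeticFunction.moebius (m : ℕ) : ℤ) : ℝ)

lemma abs_muR_le (m : ℕ+) : |muR m| ≤ 1 := by
  have := ArithmeticFunction.abs_moebius_le_one (n := (m : ℕ))
  unfold muR
  exact_mod_cast this

lemma summable_pnat_inv_pow {p : ℕ} (hp : 2 ≤ p) : Summable (fun m : ℕ+ => 1 / (m : ℝ) ^ p) := by
  have h : Summable (fun m : ℕ => 1 / (m : ℝ) ^ p) := Real.summable_one_div_nat_pow.2 (by omega)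
  exact h.comp_injective PNat.coe_injective

lemma pnat_pos (m : ℕ+) : (0 : ℝ) < (m : ℝ) := by exact_mod_cast m.pos

lemma zetaR_pos {p : ℕ} (hp : 2 ≤ p) : 0 < zetaR p :=
  (summable_pnat_inv_pow hp).tsum_pos (fun m => by positivity) 1 (by simp)

lemma summable_two {p q : ℕ} (hp : 2 ≤ p) (hq : 2 ≤ q) :
    Summable (fun x : ℕ+ × ℕ+ => 1 / (x.1 : ℝ) ^ p * (1 / (x.2 : ℝ) ^ q)) :=
  (summable_pnat_inv_pow hp).mul_of_nonneg (summable_pnat_inv_pow hq)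
    (fun m => by positivity) (fun m => by positivity)

lemma tele_bound {z : ℝ} (hz : 0 < z) :
    Summable (fun m : ℕ+ => 1 / (1 + (m : ℝ) * z) ^ 2) ∧
    ∑' m : ℕ+, 1 / (1 + (m : ℝ) * z) ^ 2 ≤ 1 / z := by
  have hb : ∀ n, ∑ i ∈ Finset.range n, 1 / (1 + ((i + 1 : ℕ) : ℝ) * z) ^ 2 ≤ 1 / z := by
    intro n
    have : ∑ i ∈ Finset.range n, 1 / (1 + ((i + 1 : ℕ) : ℝ) * z) ^ 2
        ≤ 1 / z * (1 - 1 / (1 + n * z)) := by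
      induction n with
      | zero => simp
      | succ k ih =>
        rw [Finset.sum_range_succ]
        have h1 : 0 < 1 + (k : ℝ) * z := by positivity
        have h2 : 0 < 1 + ((k + 1 : ℕ) : ℝ) * z := by positivity
        have : 1 / (1 + ((k + 1 : ℕ) : ℝ) * z) ^ 2 ≤
          1 / z * (1 / (1 + k * z) - 1 / (1 + ((k + 1 : ℕ) : ℝ) * z)) := by
          have h3 : 1 / z * (1 / (1 + k * z) - 1 / (1 + ((k + 1 : ℕ) : ℝ) * z)) =
            1 / ((1 + k * z) * (1 + ((k + 1 : ℕ) : ℝ) * z)) := by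
            rw [div_sub_div _ _ h1.ne' h2.ne']
            push_cast
            field_simp
            ring
          rw [h3]
          apply one_div_le_one_div_of_le (by positivity)
          rw [sq]
          apply mul_le_mul_of_nonneg_right _ h2.le
          push_cast; nlinarith
        linarith
    refine this.trans ?_
    have h0 : (0 : ℝ) ≤ 1 / (1 + n * z) := by positivity
    have h1 : 0 < 1 / z := by positivity
    nlinarith
  have hnn : ∀ i : ℕ, 0 ≤ 1 / (1 + ((i + 1 : ℕ) : ℝ) * z) ^ 2 := fun i => by positivity
  have hs := summable_of_sum_range_le hnn hb
  constructor
  · rw [← Equiv.pnatEquivNat.symm.summable_iff]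
    exact hs
  · rw [tsum_pnat_eq_tsum_succ (f := fun n : ℕ => 1 / (1 + (n : ℝ) * z) ^ 2)]
    exact Real.tsum_le_of_sum_range_le hnn hb

lemma moebius_R_bound {z : ℝ} (hz : 0 < z)
    (hs : Summable (fun m : ℕ+ => muR m / m * Rf (m * z))) :
    |∑' m : ℕ+, muR m / m * Rf (m * z)| ≤ 1 := by
  rw [← Equiv.pnatEquivNat.symm.summable_iff] at hs
  rw [tsum_pnat_eq_tsum_succ (f := fun n : ℕ =>
    ((ArithmeticFunction.moebius n : ℤ) : ℝ) / n * Rf (n * z))]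
  have hlim := hs.hasSum.tendsto_sum_nat
  refine le_of_tendsto' hlim.abs (fun n => ?_)
  have := abel_bound (fun n => Rf (((n + 1 : ℕ) : ℝ) * z))
    (fun m => ((ArithmeticFunction.moebius (m+1) : ℤ) : ℝ) / ((m+1 : ℕ) : ℝ))
    (fun i j hij => by
      apply Rf_antitone
      · simp only [Set.mem_Ioi]; positivity
      · simp only [Set.mem_Ioi]; positivity
      · have : ((i + 1 : ℕ) : ℝ) ≤ ((j + 1 : ℕ) : ℝ) := by exact_mod_cast Nat.succ_le_succ hij
        exact mul_le_mul_of_nonneg_right this hz.le)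
    (fun n => Rf_nonneg (by positivity)) aux_moebius_range n
  refine le_trans ?_ (this.trans (Rf_le_one (by positivity)))
  rfl

lemma core_part1 {x y : ℝ} (hx : 0 < x) (hy : 0 < y) :
    Summable (fun p : ℕ+ × ℕ+ => muR p.2 * p.2 * (Rf (p.1 * p.2 * y) / (p.1 * p.2 * x) ^ 2)) ∧
    |∑' p : ℕ+ × ℕ+, muR p.2 * p.2 * (Rf (p.1 * p.2 * y) / (p.1 * p.2 * x) ^ 2)|
      ≤ zetaR 2 / x ^ 2 := by
  have hsum : Summable (fun p : ℕ+ × ℕ+ =>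
      muR p.2 * p.2 * (Rf (p.1 * p.2 * y) / (p.1 * p.2 * x) ^ 2)) := by
    apply Summable.of_norm_bounded
      ((summable_two (p := 3) (q := 2) (by norm_num) (by norm_num)).mul_left (1 / (y * x ^ 2)))
    rintro ⟨k, m⟩
    have hk := pnat_pos k
    have hm := pnat_pos m
    have h1 : 0 < (k : ℝ) * m * y := by positivity
    have h2 := Rf_nonneg h1
    have h3 := Rf_le_inv h1
    rw [norm_mul, norm_mul, norm_div]
    simp only [norm_eq_abs]
    rw [abs_of_nonneg h2, abs_of_pos hm, abs_of_pos (by positivity : 0 < ((k : ℝ) * m * x) ^ 2)]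
    calc |muR m| * m * (Rf (k * m * y) / (k * m * x) ^ 2)
        ≤ 1 * m * ((1 / (k * m * y)) / (k * m * x) ^ 2) := by
          gcongr
          exact abs_muR_le m
      _ = _ := by field_simp
  refine ⟨hsum, ?_⟩
  rw [hsum.tsum_prod]
  have hin : ∀ k : ℕ+, |∑' m : ℕ+, muR m * m * (Rf (k * m * y) / (k * m * x) ^ 2)|
      ≤ 1 / (k : ℝ) ^ 2 * (1 / x ^ 2) := by
    intro k
    have hk := pnat_pos k
    have he : ∀ m : ℕ+, muR m * m * (Rf (k * m * y) / (k * m * x) ^ 2) =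
        (1 / (k : ℝ) ^ 2 * (1 / x ^ 2)) * (muR m / m * Rf (m * (k * y))) := by
      intro m
      have hm := pnat_pos m
      rw [show (k : ℝ) * m * y = m * (k * y) by ring]
      field_simp
    have hs1 := hsum.prod_factor k
    simp only [he] at hs1 ⊢
    have hc : (1 / (k : ℝ) ^ 2 * (1 / x ^ 2)) ≠ 0 := by positivity
    rw [summable_mul_left_iff hc] at hs1
    rw [tsum_mul_left, abs_mul, abs_of_pos (by positivity)]
    have := moebius_R_bound (z := k * y) (by positivity) hs1
    calc _ ≤ (1 / (k : ℝ) ^ 2 * (1 / x ^ 2)) * 1 := by gcongr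
      _ = _ := by ring
  have hs2 : Summable (fun k : ℕ+ => 1 / (k : ℝ) ^ 2 * (1 / x ^ 2)) :=
    (summable_pnat_inv_pow le_rfl).mul_right _
  have := tsum_of_norm_bounded (f := fun k : ℕ+ =>
    ∑' m : ℕ+, muR m * m * (Rf (k * m * y) / (k * m * x) ^ 2)) hs2.hasSum hin
  rw [tsum_mul_right] at this
  simpa [zetaR, div_eq_mul_inv] using this

lemma core_part2 {x y : ℝ} (hx : 0 < x) (hy : 0 < y) :
    Summable (fun p : ℕ+ × ℕ+ => muR p.2 * p.2 *
      ((1 / (p.1 * p.2 * x) ^ 2 - Pf (p.1 * p.2 * x)) * Qf (p.1 * p.2 * y))) ∧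
    |∑' p : ℕ+ × ℕ+, muR p.2 * p.2 *
      ((1 / (p.1 * p.2 * x) ^ 2 - Pf (p.1 * p.2 * x)) * Qf (p.1 * p.2 * y))|
      ≤ 4 * zetaR 2 / (x * y) := by
  have hT : ∀ s : ℝ, 0 < s → (1 / s ^ 2 - Pf s) ≤ 4 / (1 + s) ^ 2 := by
    intro s hs
    have h1 := Pf_ge hs
    have h2 := Pf_le hs
    have h3 := Pf_nonneg hs
    set T := 1 / s ^ 2 - Pf s with hTd
    rw [le_div_iff₀ (by positivity)]
    have h4 : T * s ^ 2 ≤ 1 := by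
      have : T ≤ 1 / s ^ 2 := by linarith
      calc T * s ^ 2 ≤ 1 / s ^ 2 * s ^ 2 := by gcongr
        _ = 1 := by field_simp
    have h5 : 0 ≤ T := by linarith
    nlinarith [mul_nonneg h5 (sq_nonneg (s - 1))]
  have hbd : ∀ p : ℕ+ × ℕ+, ‖muR p.2 * p.2 *
      ((1 / (p.1 * p.2 * x) ^ 2 - Pf (p.1 * p.2 * x)) * Qf (p.1 * p.2 * y))‖ ≤
      (4 / (p.1 * y)) * (1 / (1 + p.2 * (p.1 * x)) ^ 2) := by
    rintro ⟨k, m⟩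
    have hk := pnat_pos k
    have hm := pnat_pos m
    have h1 : 0 < (k : ℝ) * m * y := by positivity
    have h2 : 0 < (k : ℝ) * m * x := by positivity
    have h3 := hT _ h2
    have h4 := Qf_le h1
    have h5 := Qf_nonneg h1
    have h6 := Pf_le h2
    rw [norm_mul, norm_mul, norm_mul]
    simp only [norm_eq_abs]
    rw [abs_of_nonneg h5, abs_of_pos hm, abs_of_nonneg (sub_nonneg.2 h6)]
    calc |muR m| * m * ((1 / (k * m * x) ^ 2 - Pf (k * m * x)) * Qf (k * m * y))
        ≤ 1 * m * ((4 / (1 + k * m * x) ^ 2) * (1 / (k * m * y))) := by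
          gcongr
          exact abs_muR_le m
      _ = _ := by
          rw [show (k : ℝ) * m * x = m * (k * x) by ring]
          field_simp
  have hsm : Summable (fun p : ℕ+ × ℕ+ => (4 / (p.1 * y)) * (1 / (1 + p.2 * (p.1 * x)) ^ 2)) := by
    rw [summable_prod_of_nonneg]
    · constructor
      · intro k
        have hk := pnat_pos k
        exact ((tele_bound (z := k * x) (by positivity)).1).mul_left (4 / (k * y))
      · apply Summable.of_nonneg_of_le (f := fun k : ℕ+ => 4 / (x * y) * (1 / (k : ℝ) ^ 2))
        · intro k; exact tsum_nonneg (fun m => by have := pnat_pos k; positivity)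
        · intro k
          have hk := pnat_pos k
          simp only
          rw [tsum_mul_left]
          calc _ ≤ 4 / (k * y) * (1 / (k * x)) := by
                gcongr
                exact (tele_bound (z := k * x) (by positivity)).2
            _ = _ := by field_simp
        · exact (summable_pnat_inv_pow le_rfl).mul_left _
    · rintro ⟨k, m⟩
      have := pnat_pos k
      simp only [Pi.zero_apply]
      positivity
  have hS := Summable.of_norm_bounded hsm hbd
  refine ⟨hS, ?_⟩
  refine (tsum_of_norm_bounded hsm.hasSum hbd).trans ?_
  rw [hsm.tsum_prod]
  have hle : ∀ k : ℕ+, ∑' m : ℕ+, (4 / (k * y)) * (1 / (1 + m * (k * x)) ^ 2)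
      ≤ 4 / (x * y) * (1 / (k : ℝ) ^ 2) := by
    intro k
    have hk := pnat_pos k
    rw [tsum_mul_left]
    calc _ ≤ 4 / (k * y) * (1 / (k * x)) := by
          gcongr
          exact (tele_bound (z := k * x) (by positivity)).2
      _ = _ := by field_simp
  have hs3 : Summable (fun k : ℕ+ => 4 / (x * y) * (1 / (k : ℝ) ^ 2)) :=
    (summable_pnat_inv_pow le_rfl).mul_left _
  refine (Summable.tsum_le_tsum hle hsm.prod hs3).trans ?_
  rw [tsum_mul_left]
  apply le_of_eq
  unfold zetaR
  ring

lemma core_sum {x y : ℝ} (hx : 0 < x) (hy : 0 < y) :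
    Summable (fun p : ℕ+ × ℕ+ => muR p.2 * p.2 *
      (Pf (p.1 * p.2 * x) * Qf (p.1 * p.2 * y) -
        1 / ((p.1 * p.2 * x) ^ 2 * (p.1 * p.2 * y)))) ∧
    |∑' p : ℕ+ × ℕ+, muR p.2 * p.2 *
      (Pf (p.1 * p.2 * x) * Qf (p.1 * p.2 * y) -
        1 / ((p.1 * p.2 * x) ^ 2 * (p.1 * p.2 * y)))|
      ≤ 4 * zetaR 2 * (1 / x ^ 2 + 1 / (x * y)) := by
  obtain ⟨s1, b1⟩ := core_part1 hx hy
  obtain ⟨s2, b2⟩ := core_part2 hx hy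
  have he : ∀ p : ℕ+ × ℕ+, muR p.2 * p.2 *
      (Pf (p.1 * p.2 * x) * Qf (p.1 * p.2 * y) -
        1 / ((p.1 * p.2 * x) ^ 2 * (p.1 * p.2 * y))) =
      -(muR p.2 * p.2 * (Rf (p.1 * p.2 * y) / (p.1 * p.2 * x) ^ 2)) -
      muR p.2 * p.2 *
      ((1 / (p.1 * p.2 * x) ^ 2 - Pf (p.1 * p.2 * x)) * Qf (p.1 * p.2 * y)) := by
    rintro ⟨k, m⟩
    have hk := pnat_pos k
    have hm := pnat_pos m
    simp only [Rf]
    field_simp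
    ring
  simp only [he]
  refine ⟨s1.neg.sub s2, ?_⟩
  rw [s1.neg.tsum_sub s2, tsum_neg]
  have hz := zetaR_pos (p := 2) le_rfl
  have h3 : 4 * zetaR 2 * (1 / x ^ 2 + 1 / (x * y)) =
      4 * (zetaR 2 / x ^ 2) + 4 * zetaR 2 / (x * y) := by field_simp
  have h4 : 0 < zetaR 2 / x ^ 2 := by positivity
  rw [h3]
  rw [abs_le] at *
  constructor <;> linarith [b1.1, b1.2, b2.1, b2.2]

lemma moebius_zeta {d : ℕ} (hd : 2 ≤ d) :
    (∑' m : ℕ+, muR m * (1 / (m : ℝ) ^ d)) * zetaR d = 1 := by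
  have hs : (1 : ℝ) < ((d : ℂ)).re := by simp; exact_mod_cast hd
  have h := ArithmeticFunction.LSeries_zeta_mul_Lseries_moebius hs
  have conv : ∀ f : ℕ → ℝ, LSeries (fun n => (f n : ℂ)) (d : ℂ) =
      ((∑' m : ℕ+, f m * (1 / (m : ℝ) ^ d) : ℝ) : ℂ) := by
    intro f
    rw [LSeries, Complex.ofReal_tsum]
    rw [← Function.Injective.tsum_eq PNat.coe_injective]
    · apply tsum_congr
      intro m
      rw [LSeries.term_of_ne_zero m.ne_zero]
      simp [div_eq_mul_inv]
    · intro n hn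
      rcases Nat.eq_zero_or_pos n with rfl | h0
      · simp at hn
      · exact ⟨⟨n, h0⟩, rfl⟩
  have h1 := conv (fun n => ((ArithmeticFunction.zeta n : ℕ) : ℝ))
  have h2 := conv (fun n => ((ArithmeticFunction.moebius n : ℤ) : ℝ))
  have e1 : (fun n : ℕ => ((((ArithmeticFunction.zeta n : ℕ) : ℝ)) : ℂ)) =
    (fun n : ℕ => ((ArithmeticFunction.zeta n : ℕ) : ℂ)) := by ext n; push_cast; rfl
  have e2 : (fun n : ℕ => ((((ArithmeticFunction.moebius n : ℤ) : ℝ)) : ℂ)) =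
    (fun n : ℕ => ((ArithmeticFunction.moebius n : ℤ) : ℂ)) := by ext n; push_cast; rfl
  rw [e1] at h1
  rw [e2] at h2
  rw [h1, h2] at h
  have h3 : (∑' m : ℕ+, ((ArithmeticFunction.zeta (m : ℕ) : ℕ) : ℝ) * (1 / (m : ℝ) ^ d)) = zetaR d := by
    unfold zetaR
    apply tsum_congr
    intro m
    rw [ArithmeticFunction.zeta_apply_ne m.ne_zero]; simp
  rw [h3, mul_comm] at h
  exact_mod_cast h

lemma main_zeta {d : ℕ} (hd : 2 ≤ d) :
    Summable (fun p : ℕ+ × ℕ+ => muR p.2 * p.2 * (1 / (p.1 * p.2 : ℝ) ^ (d + 1))) ∧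
    ∑' p : ℕ+ × ℕ+, muR p.2 * p.2 * (1 / (p.1 * p.2 : ℝ) ^ (d + 1)) = zetaR (d + 1) / zetaR d := by
  have he : ∀ p : ℕ+ × ℕ+, muR p.2 * p.2 * (1 / (p.1 * p.2 : ℝ) ^ (d + 1)) =
      (1 / (p.1 : ℝ) ^ (d + 1)) * (muR p.2 * (1 / (p.2 : ℝ) ^ d)) := by
    rintro ⟨k, m⟩
    have hk := pnat_pos k
    have hm := pnat_pos m
    simp only
    rw [mul_pow]
    field_simp
    ring
  simp only [he]
  have s1 := summable_pnat_inv_pow (p := d + 1) (by omega)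
  have s2 : Summable (fun m : ℕ+ => ‖muR m * (1 / (m : ℝ) ^ d)‖) := by
    apply Summable.of_nonneg_of_le (fun m => norm_nonneg _) _ (summable_pnat_inv_pow hd)
    intro m
    rw [norm_mul, norm_eq_abs, norm_of_nonneg (by positivity)]
    have := abs_muR_le m
    have h0 : (0 : ℝ) ≤ 1 / (m : ℝ) ^ d := by positivity
    nlinarith
  have s3 := summable_mul_of_summable_norm (f := fun k : ℕ+ => 1 / (k : ℝ) ^ (d + 1))
    (g := fun m : ℕ+ => muR m * (1 / (m : ℝ) ^ d)) s1.norm s2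
  have s4 := tsum_mul_tsum_of_summable_norm (f := fun k : ℕ+ => 1 / (k : ℝ) ^ (d + 1))
    (g := fun m : ℕ+ => muR m * (1 / (m : ℝ) ^ d)) s1.norm s2
  refine ⟨s3, ?_⟩
  rw [← s4]
  have h1 := moebius_zeta hd
  have h2 := zetaR_pos hd
  rw [eq_div_iff h2.ne', mul_assoc, h1, mul_one, zetaR]

/-- Integer vectors as real vectors. -/
def ic {d : ℕ} (v : Fin d → ℤ) : Fin d → ℝ := fun i => (v i : ℝ)

/-- Coordinatewise floor. -/
def fl {d : ℕ} (x : Fin d → ℝ) : Fin d → ℤ := fun i => ⌊x i⌋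

lemma measurable_fl {d : ℕ} : Measurable (fl : (Fin d → ℝ) → (Fin d → ℤ)) :=
  measurable_pi_lambda _ (fun i => Int.measurable_floor.comp (measurable_pi_apply i))

lemma map_fl {d : ℕ} : Measure.map (fl : (Fin d → ℝ) → (Fin d → ℤ)) volume = Measure.count := by
  apply Measure.ext_of_singleton
  intro v
  rw [Measure.map_apply measurable_fl (measurableSet_singleton _), Measure.count_singleton]
  have : fl ⁻¹' {v} = Set.univ.pi (fun i => Set.Ico (v i : ℝ) (v i + 1)) := by
    ext x
    simp only [Set.mem_preimage, Set.mem_singleton_iff, Set.mem_pi, Set.mem_univ, true_implies,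
      Set.mem_Ico, funext_iff, fl, Int.floor_eq_iff]
  rw [this, Real.volume_pi_Ico]
  simp

lemma fl_integral {d : ℕ} (φ : (Fin d → ℤ) → ℝ) (h : Integrable (fun x => φ (fl x))) :
    Summable φ ∧ ∑' v, φ v = ∫ x, φ (fl x) := by
  have h1 : Integrable φ (Measure.map fl (volume : Measure (Fin d → ℝ))) :=
    (integrable_map_measure (measurable_of_countable φ).aestronglyMeasurable
      measurable_fl.aemeasurable).2 h
  rw [map_fl] at h1
  refine ⟨(integrable_count_iff.1 h1).of_norm, ?_⟩
  have h2 := integral_map (μ := (volume : Measure (Fin d → ℝ))) (φ := fl) measurable_fl.aemeasurable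
    (f := φ) (measurable_of_countable φ).aestronglyMeasurable
  rw [← h2, map_fl, integral_countable h1]
  simp

lemma norm_sub_fl {d : ℕ} (x : Fin d → ℝ) : ‖ic (fl x) - x‖ ≤ 1 := by
  rw [pi_norm_le_iff_of_nonneg zero_le_one]
  intro i
  simp only [ic, fl, Pi.sub_apply, norm_eq_abs, abs_le]
  constructor <;> linarith [Int.floor_le (x i), Int.lt_floor_add_one (x i)]

lemma intE {d : ℕ} {c : ℝ} (hc : 0 < c) :
    Integrable (fun x : Fin d → ℝ => (1 + ‖x‖) * exp (-(c * ‖x‖))) := by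
  have h := integrable_one_add_norm (E := Fin d → ℝ) (μ := volume) (r := d + 1)
    (by simp)
  have hf : Continuous (fun x : Fin d → ℝ => (1 + ‖x‖) * exp (-(c * ‖x‖))) := by fun_prop
  refine (h.const_mul ((d + 2).factorial / c ^ (d + 2) * exp c)).mono' hf.aestronglyMeasurable ?_
  refine Filter.Eventually.of_forall (fun x => ?_)
  have h1 : 0 < 1 + ‖x‖ := by positivity
  rw [norm_of_nonneg (by positivity)]
  have h2 := Real.pow_div_factorial_le_exp (c * (1 + ‖x‖)) (by positivity) (d + 2)
  rw [div_le_iff₀ (by positivity), mul_add, mul_one, exp_add] at h2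
  have h3 : (1 + ‖x‖) ^ (-((d : ℝ) + 1)) = 1 / (1 + ‖x‖) ^ (d + 1) := by
    rw [rpow_neg h1.le, ← Nat.cast_succ, rpow_natCast]; simp
  rw [h3, exp_neg]
  have h4 : 0 < exp (c * ‖x‖) := exp_pos _
  rw [← div_eq_mul_inv, div_le_iff₀ h4]
  have h5 : (c + c * ‖x‖) ^ (d + 2) = c ^ (d + 2) * (1 + ‖x‖) ^ (d + 2) := by
    rw [← mul_pow]; ring
  rw [h5] at h2
  have h6 : (d + 2).factorial / c ^ (d + 2) * exp c * (1 / (1 + ‖x‖) ^ (d + 1)) * exp (c * ‖x‖)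
    = (exp c * exp (c * ‖x‖) * (d + 2).factorial) / (c ^ (d + 2) * (1 + ‖x‖) ^ (d + 1)) := by
    field_simp
  rw [h6, le_div_iff₀ (by positivity)]
  calc _ = c ^ (d + 2) * (1 + ‖x‖) ^ (d + 2) := by ring
    _ ≤ _ := h2

lemma latE {d : ℕ} {c : ℝ} (hc : 0 < c) :
    Summable (fun v : Fin d → ℤ => (1 + ‖ic v‖) * exp (-(c * ‖ic v‖))) := by
  refine (fl_integral (fun v : Fin d → ℤ => (1 + ‖ic v‖) * exp (-(c * ‖ic v‖))) ?_).1
  refine ((intE (d := d) hc).const_mul (2 * exp c)).mono' ?_ ?_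
  · exact ((measurable_of_countable (fun v : Fin d → ℤ =>
      (1 + ‖ic v‖) * exp (-(c * ‖ic v‖)))).comp measurable_fl).aestronglyMeasurable
  · refine Filter.Eventually.of_forall (fun x => ?_)
    rw [norm_of_nonneg (by positivity)]
    have h := norm_sub_fl x
    have h1 : ‖ic (fl x)‖ ≤ ‖x‖ + 1 := by
      have := norm_le_norm_add_norm_sub' (ic (fl x)) x
      linarith
    have h2 : ‖x‖ ≤ ‖ic (fl x)‖ + 1 := by
      have := norm_le_norm_add_norm_sub' x (ic (fl x))
      rw [norm_sub_rev] at this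
      linarith
    have h3 : exp (-(c * ‖ic (fl x)‖)) ≤ exp c * exp (-(c * ‖x‖)) := by
      rw [← exp_add]
      apply exp_le_exp.2
      nlinarith
    have h4 : 1 + ‖ic (fl x)‖ ≤ 2 * (1 + ‖x‖) := by linarith [norm_nonneg x]
    calc _ ≤ (2 * (1 + ‖x‖)) * (exp c * exp (-(c * ‖x‖))) := by gcongr
      _ = _ := by ring

/-- Measurable convex cone (without closedness), on which `α ≥ κ ‖·‖`. -/
structure GCone {d : ℕ} (S : Set (Fin d → ℝ)) (α : (Fin d → ℝ) →L[ℝ] ℝ) (κ : ℝ) : Prop where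
  meas : MeasurableSet S
  add : ∀ x ∈ S, ∀ y ∈ S, x + y ∈ S
  smul : ∀ c : ℝ, 0 < c → ∀ x ∈ S, c • x ∈ S
  pos : 0 < κ
  low : ∀ x ∈ S, κ * ‖x‖ ≤ α x

section Gc
open scoped Pointwise
variable {d : ℕ} {S : Set (Fin d → ℝ)} {α : (Fin d → ℝ) →L[ℝ] ℝ} {κ : ℝ}

lemma intOn_lin (hm : MeasurableSet S) (hκ : 0 < κ) (hl : ∀ x ∈ S, κ * ‖x‖ ≤ α x)
    (w : (Fin d → ℝ) →L[ℝ] ℝ) {t : ℝ} (ht : 0 < t) :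
    IntegrableOn (fun x => w x * exp (-(t * α x))) S := by
  have h := ((intE (d := d) (c := t * κ) (by positivity)).const_mul ‖w‖).integrableOn (s := S)
  refine Integrable.mono' h (by fun_prop) ?_
  rw [ae_restrict_iff' hm]
  refine Filter.Eventually.of_forall (fun x hx => ?_)
  rw [norm_mul, norm_of_nonneg (exp_pos _).le]
  have h1 := w.le_opNorm x
  have h2 : exp (-(t * α x)) ≤ exp (-(t * κ * ‖x‖)) := by
    apply exp_le_exp.2; have := hl x hx; nlinarith
  calc _ ≤ (‖w‖ * (1 + ‖x‖)) * exp (-(t * κ * ‖x‖)) := by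
        gcongr
        refine h1.trans ?_
        gcongr; linarith
    _ = _ := by ring

lemma intOn_one (hm : MeasurableSet S) (hκ : 0 < κ) (hl : ∀ x ∈ S, κ * ‖x‖ ≤ α x)
    {t : ℝ} (ht : 0 < t) :
    IntegrableOn (fun x => exp (-(t * α x))) S := by
  have h := ((intE (d := d) (c := t * κ) (by positivity))).integrableOn (s := S)
  refine Integrable.mono' h (by fun_prop) ?_
  rw [ae_restrict_iff' hm]
  refine Filter.Eventually.of_forall (fun x hx => ?_)
  rw [norm_of_nonneg (exp_pos _).le]
  have h2 : exp (-(t * α x)) ≤ exp (-(t * κ * ‖x‖)) := by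
    apply exp_le_exp.2; have := hl x hx; nlinarith
  have h3 := exp_pos (-(t * κ * ‖x‖))
  nlinarith [norm_nonneg x]

lemma cone_smul_eq (hc : ∀ c : ℝ, 0 < c → ∀ x ∈ S, c • x ∈ S) {t : ℝ} (ht : 0 < t) :
    t • S = S := by
  ext x
  rw [Set.mem_smul_set_iff_inv_smul_mem₀ ht.ne']
  constructor
  · intro h
    have := hc t ht _ h
    rwa [smul_smul, mul_inv_cancel₀ ht.ne', one_smul] at this
  · intro h; exact hc _ (by positivity) _ h

lemma scale_lin (hc : ∀ c : ℝ, 0 < c → ∀ x ∈ S, c • x ∈ S) (α : (Fin d → ℝ) →L[ℝ] ℝ)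
    (w : (Fin d → ℝ) →L[ℝ] ℝ) {t : ℝ} (ht : 0 < t) :
    ∫ x in S, w x * exp (-(t * α x)) = (∫ x in S, w x * exp (-(α x))) / t ^ (d + 1) := by
  have h := Measure.setIntegral_comp_smul_of_pos (volume : Measure (Fin d → ℝ))
    (fun x => w x * exp (-(α x))) S ht
  rw [cone_smul_eq hc ht] at h
  simp only [map_smul, smul_eq_mul, Module.finrank_fin_fun] at h
  have h2 : ∫ x in S, t * w x * exp (-(t * α x)) = t * ∫ x in S, w x * exp (-(t * α x)) := by
    rw [← integral_const_mul]
    congr 1; ext x; ring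
  rw [h2] at h
  rw [pow_succ]
  field_simp at h ⊢
  linarith

lemma scale_one (hc : ∀ c : ℝ, 0 < c → ∀ x ∈ S, c • x ∈ S) (α : (Fin d → ℝ) →L[ℝ] ℝ)
    {t : ℝ} (ht : 0 < t) :
    ∫ x in S, exp (-(t * α x)) = (∫ x in S, exp (-(α x))) / t ^ d := by
  have h := Measure.setIntegral_comp_smul_of_pos (volume : Measure (Fin d → ℝ))
    (fun x => exp (-(α x))) S ht
  rw [cone_smul_eq hc ht] at h
  simp only [map_smul, smul_eq_mul, Module.finrank_fin_fun] at h
  rw [h]; field_simp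

/-- `F(t)`: the lattice exponential sum over `S`. -/
def Fs (S : Set (Fin d → ℝ)) (α w : (Fin d → ℝ) →L[ℝ] ℝ) (t : ℝ) : ℝ :=
  ∑' v : Fin d → ℤ, S.indicator (fun x => w x * exp (-(t * α x))) (ic v)

def Is (S : Set (Fin d → ℝ)) (α w : (Fin d → ℝ) →L[ℝ] ℝ) : ℝ :=
  ∫ x in S, w x * exp (-(α x))

lemma summable_Fs (hκ : 0 < κ) (hl : ∀ x ∈ S, κ * ‖x‖ ≤ α x)
    (w : (Fin d → ℝ) →L[ℝ] ℝ) {t : ℝ} (ht : 0 < t) :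
    Summable (fun v : Fin d → ℤ => S.indicator (fun x => w x * exp (-(t * α x))) (ic v)) := by
  apply Summable.of_norm_bounded ((latE (d := d) (c := t * κ) (by positivity)).mul_left ‖w‖)
  intro v
  by_cases hv : ic v ∈ S
  · rw [Set.indicator_of_mem hv, norm_mul, norm_of_nonneg (exp_pos _).le]
    have h1 := w.le_opNorm (ic v)
    have h2 : exp (-(t * α (ic v))) ≤ exp (-(t * κ * ‖ic v‖)) := by
      apply exp_le_exp.2; have := hl _ hv; nlinarith
    calc _ ≤ (‖w‖ * (1 + ‖ic v‖)) * exp (-(t * κ * ‖ic v‖)) := by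
          gcongr
          refine h1.trans ?_
          gcongr; linarith
      _ = _ := by ring
  · rw [Set.indicator_of_notMem hv]; simp; positivity

end Gc


section Fest
variable {d : ℕ} {S : Set (Fin d → ℝ)} {α : (Fin d → ℝ) →L[ℝ] ℝ} {κ : ℝ}

lemma exists_thick (h : GCone S α κ) (hi : (interior S).Nonempty) :
    ∃ b, ∀ y : Fin d → ℝ, ‖y‖ ≤ 1 → b + y ∈ S := by
  obtain ⟨x0, hx0⟩ := hi
  obtain ⟨r, hr, hb⟩ := Metric.isOpen_iff.1 isOpen_interior x0 hx0
  refine ⟨(2 / r) • x0, fun y hy => ?_⟩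
  have h1 : x0 + (r / 2) • y ∈ S := by
    apply interior_subset
    apply hb
    rw [mem_ball_iff_norm, add_sub_cancel_left, norm_smul, norm_of_nonneg (by positivity)]
    nlinarith
  have h2 := h.smul (2 / r) (by positivity) _ h1
  rw [smul_add, smul_smul] at h2
  have : 2 / r * (r / 2) = 1 := by field_simp
  rwa [this, one_smul] at h2

lemma abs_exp_sub_le (u v : ℝ) {m : ℝ} (hu : m ≤ u) (hv : m ≤ v) :
    |exp (-u) - exp (-v)| ≤ |u - v| * exp (-m) := by
  wlog huv : u ≤ v generalizing u v
  · rw [abs_sub_comm, abs_sub_comm u v]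
    exact this v u hv hu (le_of_not_ge huv)
  have h1 : exp (-v) = exp (-u) * exp (-(v - u)) := by rw [← exp_add]; congr 1; ring
  have h2 := add_one_le_exp (-(v - u))
  have h3 : exp (-u) ≤ exp (-m) := exp_le_exp.2 (by linarith)
  have h4 : exp (-v) ≤ exp (-u) := exp_le_exp.2 (by linarith)
  rw [abs_of_nonneg (by linarith), abs_of_nonpos (by linarith), h1]
  have h5 := exp_pos (-u)
  nlinarith

lemma abs_lin_le (h : GCone S α κ) (w : (Fin d → ℝ) →L[ℝ] ℝ) {x : Fin d → ℝ} (hx : x ∈ S) :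
    |w x| ≤ ‖w‖ / κ * α x := by
  have h1 := w.le_opNorm x
  have h2 := h.low x hx
  have h3 := h.pos
  rw [norm_eq_abs] at h1
  refine h1.trans ?_
  rw [div_mul_eq_mul_div, le_div_iff₀ h3]
  nlinarith [norm_nonneg w]

lemma alpha_nonneg (h : GCone S α κ) {x : Fin d → ℝ} (hx : x ∈ S) : 0 ≤ α x :=
  le_trans (mul_nonneg h.pos.le (norm_nonneg _)) (h.low x hx)

/-- pointwise comparison -/
lemma D_bound (h : GCone S α κ) (w : (Fin d → ℝ) →L[ℝ] ℝ) {b : Fin d → ℝ}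
    (hb : ∀ y : Fin d → ℝ, ‖y‖ ≤ 1 → b + y ∈ S) {t : ℝ} (ht : 0 < t) (ht1 : t ≤ 1)
    (x y : Fin d → ℝ) (hxy : ‖y - x‖ ≤ 1) :
    |S.indicator (fun x => w x * exp (-(t * α x))) y -
      S.indicator (fun x => w x * exp (-(t * α x))) x| ≤
    (‖w‖ * exp (α b + ‖α‖) * (1 + ‖α‖ / κ)) *
      S.indicator (fun x => (1 + t * α x) * exp (-(t * α x))) (x + b) +
    (‖w‖ / κ * (1 + ‖α‖) * exp (α b + ‖α‖)) *
      (S.indicator (fun x => (1 + α x) * exp (-(t * α x))) (x + b) -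
        exp (-(2 * t * α b)) * S.indicator (fun x => (1 + α x) * exp (-(t * α x))) (x - b)) := by
  have hκ := h.pos
  have hbS : b ∈ S := by have := hb 0 (by simp); rwa [add_zero] at this
  have hαb := alpha_nonneg h hbS
  have hyx : |α (y - x)| ≤ ‖α‖ := by
    have := α.le_opNorm (y - x)
    rw [norm_eq_abs] at this
    nlinarith [norm_nonneg α]
  have hwyx : |w (y - x)| ≤ ‖w‖ := by
    have := w.le_opNorm (y - x)
    rw [norm_eq_abs] at this
    nlinarith [norm_nonneg w]
  have hxp : x ∈ S → x + b ∈ S := fun hx => h.add _ hx _ hbS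
  have hyp : y ∈ S → x + b ∈ S := fun hy => by
    have := h.add _ hy _ (hb (x - y) (by rwa [norm_sub_rev]))
    rwa [show y + (b + (x - y)) = x + b by abel] at this
  have hq : x - b ∈ S → x ∈ S ∧ y ∈ S := fun hq => by
    constructor
    · have := h.add _ hq _ hbS
      rwa [sub_add_cancel] at this
    · have := h.add _ hq _ (hb (y - x) hxy)
      rwa [show x - b + (b + (y - x)) = y by abel] at this
  set c1 := ‖w‖ * exp (α b + ‖α‖) * (1 + ‖α‖ / κ) with hc1
  set c2 := ‖w‖ / κ * (1 + ‖α‖) * exp (α b + ‖α‖) with hc2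
  have hc1n : 0 ≤ c1 := by positivity
  have hc2n : 0 ≤ c2 := by positivity
  have hG1 : 0 ≤ S.indicator (fun x => (1 + t * α x) * exp (-(t * α x))) (x + b) := by
    apply Set.indicator_nonneg
    intro z hz
    have := alpha_nonneg h hz
    positivity
  have hG2 : 0 ≤ S.indicator (fun x => (1 + α x) * exp (-(t * α x))) (x + b) -
        exp (-(2 * t * α b)) * S.indicator (fun x => (1 + α x) * exp (-(t * α x))) (x - b) := by
    by_cases hqS : x - b ∈ S
    · have hpS := hxp (hq hqS).1
      rw [Set.indicator_of_mem hqS, Set.indicator_of_mem hpS]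
      have e1 : α (x + b) = α (x - b) + 2 * α b := by simp only [map_add, map_sub]; ring
      have e2 : exp (-(t * α (x + b))) = exp (-(2 * t * α b)) * exp (-(t * α (x - b))) := by
        rw [← exp_add, e1]; congr 1; ring
      rw [e2, e1]
      have := exp_pos (-(2 * t * α b))
      have h3 := exp_pos (-(t * α (x - b)))
      have h4 : 0 ≤ 2 * α b * (exp (-(2 * t * α b)) * exp (-(t * α (x - b)))) := by positivity
      linarith
    · rw [Set.indicator_of_notMem hqS, mul_zero, sub_zero]
      apply Set.indicator_nonneg
      intro z hz
      have := alpha_nonneg h hz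
      positivity
  have hex : ∀ z, α z ≥ α (x + b) - (α b + ‖α‖) →
      exp (-(t * α z)) ≤ exp (α b + ‖α‖) * exp (-(t * α (x + b))) := by
    intro z hz
    rw [← exp_add]
    apply exp_le_exp.2
    have : 0 ≤ (1 - t) * (α b + ‖α‖) := by
      have := norm_nonneg α
      apply mul_nonneg <;> linarith
    nlinarith
  have hzx : α x ≥ α (x + b) - (α b + ‖α‖) := by
    simp only [map_add]; linarith [norm_nonneg α]
  have hzy : α y ≥ α (x + b) - (α b + ‖α‖) := by
    simp only [map_add]; rw [map_sub, abs_le] at hyx; linarith [hyx.1]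
  have hE := exp_pos (-(t * α (x + b)))
  have hM := exp_pos (α b + ‖α‖)
  by_cases hx : x ∈ S
  · have hp := hxp hx
    have hap := alpha_nonneg h hp
    by_cases hy : y ∈ S
    · refine le_trans ?_ (le_add_of_nonneg_right (mul_nonneg hc2n hG2))
      rw [Set.indicator_of_mem hx, Set.indicator_of_mem hy, Set.indicator_of_mem hp]
      have e1 : w y * exp (-(t * α y)) - w x * exp (-(t * α x)) =
          w (y - x) * exp (-(t * α y)) + w x * (exp (-(t * α y)) - exp (-(t * α x))) := by
        rw [map_sub]; ring
      rw [e1]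
      have e2 := abs_exp_sub_le (t * α y) (t * α x)
        (m := t * (α (x + b)) - (α b + ‖α‖)) (by
          have : 0 ≤ (1 - t) * (α b + ‖α‖) := by
            have := norm_nonneg α
            apply mul_nonneg <;> linarith
          nlinarith) (by
          have : 0 ≤ (1 - t) * (α b + ‖α‖) := by
            have := norm_nonneg α
            apply mul_nonneg <;> linarith
          nlinarith)
      have e3 : exp (-(t * (α (x + b)) - (α b + ‖α‖))) =
          exp (α b + ‖α‖) * exp (-(t * α (x + b))) := by
        rw [← exp_add]; congr 1; ring
      have e4 : |t * α y - t * α x| ≤ t * ‖α‖ := by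
        rw [← mul_sub, abs_mul, abs_of_pos ht, ← map_sub]
        gcongr
      have e5 : |w x| ≤ ‖w‖ / κ * α (x + b) := by
        refine (abs_lin_le h w hx).trans ?_
        gcongr
        rw [map_add]; linarith
      refine (abs_add_le _ _).trans ?_
      rw [abs_mul, abs_mul, abs_of_pos (exp_pos _)]
      rw [e3] at e2
      calc _ ≤ ‖w‖ * (exp (α b + ‖α‖) * exp (-(t * α (x + b)))) +
            (‖w‖ / κ * α (x + b)) * (t * ‖α‖ * (exp (α b + ‖α‖) * exp (-(t * α (x + b))))) := by
              gcongr
              · exact hex y hzy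
              · refine e2.trans ?_
                gcongr
        _ = ‖w‖ * exp (α b + ‖α‖) * exp (-(t * α (x + b))) * (1 + ‖α‖ / κ * (t * α (x + b))) := by
              field_simp
        _ ≤ ‖w‖ * exp (α b + ‖α‖) * exp (-(t * α (x + b))) *
              ((1 + ‖α‖ / κ) * (1 + (t * α (x + b)))) := by
              gcongr
              have : 0 ≤ ‖α‖ / κ := by positivity
              have : 0 ≤ t * α (x + b) := by positivity
              nlinarith
        _ = _ := by rw [hc1]; ring
    · refine le_trans ?_ (le_add_of_nonneg_left (mul_nonneg hc1n hG1))
      have hqS : x - b ∉ S := fun hh => hy (hq hh).2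
      rw [Set.indicator_of_mem hx, Set.indicator_of_notMem hy, Set.indicator_of_mem hp,
        Set.indicator_of_notMem hqS, zero_sub, abs_neg, abs_mul, abs_of_pos (exp_pos _), mul_zero,
        sub_zero]
      have e5 : |w x| ≤ ‖w‖ / κ * ((1 + ‖α‖) * (1 + α (x + b))) := by
        refine (abs_lin_le h w hx).trans ?_
        gcongr
        have : α x ≤ α (x + b) := by rw [map_add]; linarith
        nlinarith [norm_nonneg α]
      calc _ ≤ (‖w‖ / κ * ((1 + ‖α‖) * (1 + α (x + b)))) *
            (exp (α b + ‖α‖) * exp (-(t * α (x + b)))) := by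
            gcongr
            exact hex x hzx
        _ = _ := by rw [hc2]; ring
  · by_cases hy : y ∈ S
    · have hp := hyp hy
      have hap := alpha_nonneg h hp
      refine le_trans ?_ (le_add_of_nonneg_left (mul_nonneg hc1n hG1))
      have hqS : x - b ∉ S := fun hh => hx (hq hh).1
      rw [Set.indicator_of_mem hy, Set.indicator_of_notMem hx, Set.indicator_of_mem hp,
        Set.indicator_of_notMem hqS, sub_zero, abs_mul, abs_of_pos (exp_pos _), mul_zero,
        sub_zero]
      have e5 : |w y| ≤ ‖w‖ / κ * ((1 + ‖α‖) * (1 + α (x + b))) := by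
        refine (abs_lin_le h w hy).trans ?_
        gcongr
        have : α y ≤ α (x + b) + ‖α‖ := by
          rw [map_add]; rw [map_sub, abs_le] at hyx; linarith
        nlinarith [norm_nonneg α]
      calc _ ≤ (‖w‖ / κ * ((1 + ‖α‖) * (1 + α (x + b)))) *
            (exp (α b + ‖α‖) * exp (-(t * α (x + b)))) := by
            gcongr
            exact hex y hzy
        _ = _ := by rw [hc2]; ring
    · rw [Set.indicator_of_notMem hy, Set.indicator_of_notMem hx]
      simp only [sub_zero, abs_zero]
      exact add_nonneg (mul_nonneg hc1n hG1) (mul_nonneg hc2n hG2)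

lemma F_est_small (h : GCone S α κ) (hi : (interior S).Nonempty) (w : (Fin d → ℝ) →L[ℝ] ℝ) :
    ∃ K, ∀ t, 0 < t → t ≤ 1 → |Fs S α w t - Is S α w / t ^ (d + 1)| ≤ K / t ^ d := by
  obtain ⟨b, hb⟩ := exists_thick h hi
  have hκ := h.pos
  have hbS : b ∈ S := by have := hb 0 (by simp); rwa [add_zero] at this
  have hαb := alpha_nonneg h hbS
  set c1 := ‖w‖ * exp (α b + ‖α‖) * (1 + ‖α‖ / κ) with hc1
  set c2 := ‖w‖ / κ * (1 + ‖α‖) * exp (α b + ‖α‖) with hc2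
  have hc1n : 0 ≤ c1 := by positivity
  have hc2n : 0 ≤ c2 := by positivity
  set J0 := ∫ x in S, exp (-(α x)) with hJ0
  set J1 := ∫ x in S, α x * exp (-(α x)) with hJ1
  have hJ0n : 0 ≤ J0 := setIntegral_nonneg h.meas (fun x _ => (exp_pos _).le)
  have hJ1n : 0 ≤ J1 := setIntegral_nonneg h.meas (fun x hx =>
    mul_nonneg (alpha_nonneg h hx) (exp_pos _).le)
  refine ⟨(c1 + 2 * c2 * α b) * (J0 + J1), fun t ht ht1 => ?_⟩
  have i0 := intOn_one h.meas hκ h.low ht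
  have i1 := intOn_lin h.meas hκ h.low α ht
  have v0 := scale_one h.smul α ht
  have v1 := scale_lin h.smul α α ht
  have iw := intOn_lin h.meas hκ h.low w ht
  have vw := scale_lin h.smul α w ht
  -- G1
  have iG1 : Integrable (S.indicator (fun x => (1 + t * α x) * exp (-(t * α x)))) := by
    rw [integrable_indicator_iff h.meas]
    refine (Integrable.add i0 (i1.const_mul t)).congr (Filter.Eventually.of_forall fun x => ?_)
    simp only [Pi.add_apply]; ring
  have vG1 : ∫ x, S.indicator (fun x => (1 + t * α x) * exp (-(t * α x))) x =
      (J0 + J1) / t ^ d := by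
    rw [integral_indicator h.meas]
    have : ∀ x, (1 + t * α x) * exp (-(t * α x)) =
      exp (-(t * α x)) + t * (α x * exp (-(t * α x))) := fun x => by ring
    simp_rw [this]
    rw [integral_add i0 (i1.const_mul t), integral_const_mul, v0, v1, ← hJ0, ← hJ1]
    field_simp
    ring
  have iG2 : Integrable (S.indicator (fun x => (1 + α x) * exp (-(t * α x)))) := by
    rw [integrable_indicator_iff h.meas]
    refine (Integrable.add i0 i1).congr (Filter.Eventually.of_forall fun x => ?_)
    simp only [Pi.add_apply]; ring
  have vG2 : ∫ x, S.indicator (fun x => (1 + α x) * exp (-(t * α x))) x =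
      J0 / t ^ d + J1 / t ^ (d + 1) := by
    rw [integral_indicator h.meas]
    have : ∀ x, (1 + α x) * exp (-(t * α x)) =
      exp (-(t * α x)) + (α x * exp (-(t * α x))) := fun x => by ring
    simp_rw [this]
    rw [integral_add i0 i1, v0, v1]
  set f := S.indicator (fun x => w x * exp (-(t * α x))) with hf
  have if1 : Integrable f := by
    rw [integrable_indicator_iff h.meas]; exact iw
  have vf : ∫ x, f x = Is S α w / t ^ (d + 1) := by
    rw [integral_indicator h.meas, vw, Is]
  set B : (Fin d → ℝ) → ℝ := fun x => c1 *
      S.indicator (fun x => (1 + t * α x) * exp (-(t * α x))) (x + b) +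
    c2 * (S.indicator (fun x => (1 + α x) * exp (-(t * α x))) (x + b) -
        exp (-(2 * t * α b)) * S.indicator (fun x => (1 + α x) * exp (-(t * α x))) (x - b)) with hB
  have iB1 : Integrable (fun x => c1 *
      S.indicator (fun x => (1 + t * α x) * exp (-(t * α x))) (x + b)) :=
    (iG1.comp_add_right b).const_mul c1
  have iB2 : Integrable (fun x => S.indicator (fun x => (1 + α x) * exp (-(t * α x))) (x + b)) :=
    iG2.comp_add_right b
  have iB3 : Integrable (fun x => exp (-(2 * t * α b)) *
      S.indicator (fun x => (1 + α x) * exp (-(t * α x))) (x - b)) :=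
    (iG2.comp_sub_right b).const_mul _
  have iB : Integrable B := iB1.add ((iB2.sub iB3).const_mul c2)
  have vB : ∫ x, B x = c1 * ((J0 + J1) / t ^ d) +
      c2 * ((1 - exp (-(2 * t * α b))) * (J0 / t ^ d + J1 / t ^ (d + 1))) := by
    have iB4 : Integrable (fun x => c2 * (S.indicator (fun x => (1 + α x) * exp (-(t * α x))) (x + b) -
        exp (-(2 * t * α b)) * S.indicator (fun x => (1 + α x) * exp (-(t * α x))) (x - b))) :=
      (iB2.sub iB3).const_mul c2
    rw [hB, integral_add iB1 iB4, integral_const_mul, integral_const_mul,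
      integral_sub iB2 iB3, integral_const_mul,
      integral_add_right_eq_self (fun x => S.indicator (fun x => (1 + t * α x) * exp (-(t * α x))) x),
      integral_add_right_eq_self (fun x => S.indicator (fun x => (1 + α x) * exp (-(t * α x))) x),
      integral_sub_right_eq_self (fun x => S.indicator (fun x => (1 + α x) * exp (-(t * α x))) x),
      vG1, vG2]
    ring
  have hD : ∀ x, |f (ic (fl x)) - f x| ≤ B x := fun x =>
    D_bound h w hb ht ht1 x (ic (fl x)) (norm_sub_fl x)
  have mfl : Measurable (fun x => f (ic (fl x))) :=
    (measurable_of_countable (fun v : Fin d → ℤ => f (ic v))).comp measurable_fl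
  have iD : Integrable (fun x => f (ic (fl x)) - f x) :=
    iB.mono' (mfl.aestronglyMeasurable.sub if1.aestronglyMeasurable)
      (Filter.Eventually.of_forall hD)
  have ifl : Integrable (fun x => f (ic (fl x))) := by
    refine (iD.add if1).congr (Filter.Eventually.of_forall fun x => ?_)
    simp
  have hF := (fl_integral (fun v => f (ic v)) ifl).2
  have : Fs S α w t - Is S α w / t ^ (d + 1) = ∫ x, (f (ic (fl x)) - f x) := by
    rw [integral_sub ifl if1, vf, ← hF, Fs]
  rw [this]
  have hle : |∫ x, (f (ic (fl x)) - f x)| ≤ ∫ x, B x := by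
    refine (abs_integral_le_integral_abs).trans ?_
    exact integral_mono iD.abs iB hD
  refine hle.trans ?_
  rw [vB]
  have e1 : 1 - exp (-(2 * t * α b)) ≤ 2 * t * α b := by
    linarith [add_one_le_exp (-(2 * t * α b))]
  have e2 : 2 * t * α b * (J0 / t ^ d + J1 / t ^ (d + 1)) ≤ 2 * α b * ((J0 + J1) / t ^ d) := by
    have : 2 * t * α b * (J0 / t ^ d + J1 / t ^ (d + 1)) = 2 * α b * ((t * J0 + J1) / t ^ d) := by
      field_simp
      ring
    rw [this]
    gcongr
    nlinarith
  have e3 : (1 - exp (-(2 * t * α b))) * (J0 / t ^ d + J1 / t ^ (d + 1)) ≤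
      2 * α b * ((J0 + J1) / t ^ d) := by
    refine le_trans ?_ e2
    gcongr
  calc _ ≤ c1 * ((J0 + J1) / t ^ d) + c2 * (2 * α b * ((J0 + J1) / t ^ d)) := by gcongr
    _ = _ := by ring

lemma one_le_norm_ic {v : Fin d → ℤ} (hv : v ≠ 0) : 1 ≤ ‖ic v‖ := by
  obtain ⟨i, hi⟩ := Function.ne_iff.1 hv
  refine le_trans ?_ (norm_le_pi_norm (ic v) i)
  have : (1 : ℤ) ≤ |v i| := Int.one_le_abs hi
  simp only [ic, norm_eq_abs]
  exact_mod_cast this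

lemma ic_zero : ic (0 : Fin d → ℤ) = 0 := by ext i; simp [ic]

lemma F_est_large (hκ : 0 < κ) (hl : ∀ x ∈ S, κ * ‖x‖ ≤ α x) (w : (Fin d → ℝ) →L[ℝ] ℝ) :
    ∃ K, ∀ t, 1 ≤ t → |Fs S α w t| ≤ K / t ^ d := by
  have hs1 := (summable_Fs hκ hl w one_pos).norm
  set A := ∑' v : Fin d → ℤ, ‖S.indicator (fun x => w x * exp (-(1 * α x))) (ic v)‖ with hA
  have hAn : 0 ≤ A := tsum_nonneg (fun _ => norm_nonneg _)
  refine ⟨exp κ * d.factorial / κ ^ d * A, fun t ht => ?_⟩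
  have ht0 : 0 < t := by linarith
  have hb : ∀ v : Fin d → ℤ, ‖S.indicator (fun x => w x * exp (-(t * α x))) (ic v)‖ ≤
      exp (-((t - 1) * κ)) * ‖S.indicator (fun x => w x * exp (-(1 * α x))) (ic v)‖ := by
    intro v
    by_cases hv : ic v ∈ S
    · rw [Set.indicator_of_mem hv, Set.indicator_of_mem hv]
      by_cases h0 : v = 0
      · rw [h0, ic_zero]; simp
      · rw [norm_mul, norm_mul, norm_of_nonneg (exp_pos _).le, norm_of_nonneg (exp_pos _).le]
        have h1 := one_le_norm_ic h0
        have h2 := hl _ hv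
        have h3 : exp (-(t * α (ic v))) ≤ exp (-((t - 1) * κ)) * exp (-(1 * α (ic v))) := by
          rw [← exp_add]
          apply exp_le_exp.2
          have h4 : κ ≤ α (ic v) := by nlinarith
          nlinarith
        calc _ ≤ ‖w (ic v)‖ * (exp (-((t - 1) * κ)) * exp (-(1 * α (ic v)))) := by gcongr
          _ = _ := by ring
    · rw [Set.indicator_of_notMem hv, Set.indicator_of_notMem hv]; simp
  have h1 : |Fs S α w t| ≤ exp (-((t - 1) * κ)) * A := by
    have := tsum_of_norm_bounded (hs1.mul_left (exp (-((t - 1) * κ)))).hasSum hb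
    rwa [tsum_mul_left] at this
  refine h1.trans ?_
  have h2 := Real.pow_div_factorial_le_exp (κ * t) (by positivity) d
  rw [div_le_iff₀ (by positivity)] at h2
  have h3 : exp (-((t - 1) * κ)) = exp κ / exp (κ * t) := by
    rw [← exp_sub]; congr 1; ring
  rw [h3, mul_div_right_comm]
  refine mul_le_mul_of_nonneg_right ?_ hAn
  rw [div_div, div_le_div_iff₀ (exp_pos _) (by positivity)]
  have h4 := exp_pos κ
  rw [mul_pow] at h2
  nlinarith

/-- main estimate for the lattice exponential sum -/
lemma F_est (h : GCone S α κ) (hi : (interior S).Nonempty) (w : (Fin d → ℝ) →L[ℝ] ℝ) :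
    ∃ K, ∀ t, 0 < t → |Fs S α w t - Is S α w / t ^ (d + 1)| ≤ K / t ^ d := by
  obtain ⟨K1, h1⟩ := F_est_small h hi w
  obtain ⟨K2, h2⟩ := F_est_large (d := d) h.pos h.low w
  refine ⟨max K1 (K2 + |Is S α w|), fun t ht => ?_⟩
  rcases le_total t 1 with h' | h'
  · refine (h1 t ht h').trans ?_
    gcongr
    exact le_max_left _ _
  · have e1 : |Is S α w / t ^ (d + 1)| ≤ |Is S α w| / t ^ d := by
      rw [abs_div, abs_of_pos (pow_pos ht _)]
      exact div_le_div_of_nonneg_left (abs_nonneg _) (pow_pos ht _) (pow_le_pow_right₀ h' (by omega))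
    calc _ ≤ |Fs S α w t| + |Is S α w / t ^ (d + 1)| := abs_sub _ _
      _ ≤ K2 / t ^ d + |Is S α w| / t ^ d := add_le_add (h2 t h') e1
      _ = (K2 + |Is S α w|) / t ^ d := by ring
      _ ≤ _ := by gcongr; exact le_max_right _ _

end Fest


section Moeb
variable {d : ℕ} {S : Set (Fin d → ℝ)} {α : (Fin d → ℝ) →L[ℝ] ℝ} {κ : ℝ}

open Classical in
/-- the sum over primitive vectors -/
def Gs (S : Set (Fin d → ℝ)) (α w : (Fin d → ℝ) →L[ℝ] ℝ) (β : ℝ) : ℝ :=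
  ∑' v : Fin d → ℤ, if IsPrimitiveVec v then S.indicator (fun x => w x * Qf (β * α x)) (ic v) else 0

lemma hasSum_pnat_of_nat {f : ℕ → ℝ} {a : ℝ} (h0 : f 0 = 0) (h : HasSum f a) :
    HasSum (fun m : ℕ+ => f m) a := by
  refine (Function.Injective.hasSum_iff PNat.coe_injective ?_).2 h
  intro x hx
  have : x = 0 := by
    by_contra hne
    exact hx ⟨⟨x, Nat.pos_of_ne_zero hne⟩, rfl⟩
  rw [this, h0]

lemma hasSum_exp_pnat {s : ℝ} (hs : 0 < s) : HasSum (fun k : ℕ+ => exp (-(k * s))) (Qf s) := by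
  have h1 : exp (-s) < 1 := by rw [exp_lt_one_iff]; linarith
  have h2 := (hasSum_geometric_of_lt_one (exp_pos (-s)).le h1).mul_left (exp (-s))
  have h3 : HasSum (fun n : ℕ => exp (-((n + 1 : ℕ) * s))) (Qf s) := by
    convert! h2 using 1
    ext n
    rw [← exp_nat_mul, ← exp_add]
    congr 1; push_cast; ring
  exact (Equiv.hasSum_iff Equiv.pnatEquivNat.symm).1 (by
    convert! h3 using 1)

lemma hasSum_moebius_dvd {G : ℕ} (hG : G ≠ 0) :
    HasSum (fun m : ℕ+ => if (m : ℕ) ∣ G then muR m else 0) (if G = 1 then 1 else 0) := by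
  refine hasSum_pnat_of_nat
    (f := fun m : ℕ => if m ∣ G then ((ArithmeticFunction.moebius m : ℤ) : ℝ) else 0) (by simp) ?_
  have h1 := ArithmeticFunction.coe_mul_zeta_apply (R := ℤ)
    (f := ArithmeticFunction.moebius) (x := G)
  have h2 : ((if G = 1 then (1 : ℝ) else 0)) =
      ∑ m ∈ G.divisors, if m ∣ G then ((ArithmeticFunction.moebius m : ℤ) : ℝ) else 0 := by
    rw [Finset.sum_congr rfl (g := fun m => ((ArithmeticFunction.moebius m : ℤ) : ℝ))
      (fun m hm => if_pos (Nat.dvd_of_mem_divisors hm)), ← Int.cast_sum, ← h1,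
      ArithmeticFunction.moebius_mul_coe_zeta, ArithmeticFunction.one_apply]
    split_ifs <;> simp
  rw [h2]
  apply hasSum_sum_of_ne_finset_zero
  intro m hm
  rw [if_neg]
  intro h
  exact hm (Nat.mem_divisors.2 ⟨h, hG⟩)

/-- gcd of coordinates -/
def vgcd (v : Fin d → ℤ) : ℕ := (Finset.univ.gcd v).natAbs

lemma vgcd_ne_zero {v : Fin d → ℤ} (hv : v ≠ 0) : vgcd v ≠ 0 := by
  unfold vgcd
  rw [Int.natAbs_ne_zero]
  intro h
  apply hv
  ext i
  exact Finset.gcd_eq_zero_iff.1 h i (Finset.mem_univ _)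

lemma dvd_vgcd {v : Fin d → ℤ} {m : ℕ} : m ∣ vgcd v ↔ ∀ i, (m : ℤ) ∣ v i := by
  unfold vgcd
  rw [← Int.natCast_dvd, Finset.dvd_gcd_iff]
  simp

lemma vgcd_eq_one {v : Fin d → ℤ} (hv : v ≠ 0) : vgcd v = 1 ↔ IsPrimitiveVec v := by
  unfold vgcd IsPrimitiveVec
  have h : 0 ≤ Finset.univ.gcd v := by
    have := Finset.normalize_gcd (s := Finset.univ) (f := v)
    exact Int.nonneg_of_normalize_eq_self this
  constructor
  · intro h1
    refine ⟨hv, ?_⟩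
    omega
  · rintro ⟨_, h1⟩
    omega

lemma ic_smul (m : ℕ) (v : Fin d → ℤ) : ic ((m : ℤ) • v) = (m : ℝ) • ic v := by
  ext i; simp [ic]

lemma norm_ic_smul (m : ℕ) (v : Fin d → ℤ) : ‖ic ((m : ℤ) • v)‖ = m * ‖ic v‖ := by
  rw [ic_smul, norm_smul, norm_of_nonneg (by positivity)]

set_option maxHeartbeats 1000000 in
open Classical in
lemma moebius_identity (hκ : 0 < κ) (hl : ∀ x ∈ S, κ * ‖x‖ ≤ α x)
    (hc : ∀ c : ℝ, 0 < c → ∀ x ∈ S, c • x ∈ S) (w : (Fin d → ℝ) →L[ℝ] ℝ) {β : ℝ} (hβ : 0 < β) :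
    Summable (fun p : ℕ+ × ℕ+ => muR p.2 * p.2 * Fs S α w (p.1 * p.2 * β)) ∧
    Gs S α w β = ∑' p : ℕ+ × ℕ+, muR p.2 * p.2 * Fs S α w (p.1 * p.2 * β) := by
  have hsc : ∀ (m : ℕ+) (v : Fin d → ℤ), ic (((m : ℕ) : ℤ) • v) ∈ S ↔ ic v ∈ S := by
    intro m v
    have hm := pnat_pos m
    rw [ic_smul]
    constructor
    · intro h
      have := hc (m : ℝ)⁻¹ (by positivity) _ h
      rwa [smul_smul, inv_mul_cancel₀ hm.ne', one_smul] at this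
    · intro h
      exact hc _ hm _ h
  set g : ℕ+ → (Fin d → ℤ) → ℝ :=
    fun k v => S.indicator (fun x => w x * exp (-(k * β * α x))) (ic v) with hg
  set U : (ℕ+ × ℕ+) × (Fin d → ℤ) → ℝ :=
    fun q => if ∀ i, (((q.1.2 : ℕ) : ℤ)) ∣ q.2 i then muR q.1.2 * g q.1.1 q.2 else 0 with hU
  have hg0 : ∀ k, g k 0 = 0 := by
    intro k
    simp only [hg, ic_zero]
    by_cases h0 : (0 : Fin d → ℝ) ∈ S
    · rw [Set.indicator_of_mem h0]; simp
    · rw [Set.indicator_of_notMem h0]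
  have hgeo : Summable (fun k : ℕ+ => exp (-(k * (β * κ / 2)))) :=
    (hasSum_exp_pnat (by positivity)).summable
  have hUs : Summable U := by
    have hs := (summable_Fs hκ hl w (t := β / 2) (by positivity)).norm
    have hs12 : Summable (fun p : ℕ+ × ℕ+ =>
        exp (-(p.1 * (β * κ / 2))) * exp (-(p.2 * (β * κ / 2)))) :=
      Summable.mul_of_nonneg (f := fun k : ℕ+ => exp (-(k * (β * κ / 2))))
        (g := fun k : ℕ+ => exp (-(k * (β * κ / 2)))) hgeo hgeo
        (fun p => (exp_pos _).le) (fun p => (exp_pos _).le)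
    have hs2 : Summable (fun q : (ℕ+ × ℕ+) × (Fin d → ℤ) =>
        (exp (-(q.1.1 * (β * κ / 2))) * exp (-(q.1.2 * (β * κ / 2)))) *
        ‖S.indicator (fun x => w x * exp (-(β / 2 * α x))) (ic q.2)‖) :=
      Summable.mul_of_nonneg (f := fun p : ℕ+ × ℕ+ =>
        exp (-(p.1 * (β * κ / 2))) * exp (-(p.2 * (β * κ / 2))))
        (g := fun v : Fin d → ℤ => ‖S.indicator (fun x => w x * exp (-(β / 2 * α x))) (ic v)‖)
        hs12 hs (fun p => mul_nonneg (exp_pos _).le (exp_pos _).le) (fun v => norm_nonneg _)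
    refine Summable.of_norm_bounded (hs2.mul_left (exp (β * κ / 2))) ?_
    rintro ⟨⟨k, m⟩, v⟩
    have hk : (1 : ℝ) ≤ k := by exact_mod_cast k.one_le
    have hm := pnat_pos m
    simp only [hU]
    split_ifs with hd
    · by_cases hv : v = 0
      · rw [hv, hg0]; simp; positivity
      by_cases hvS : ic v ∈ S
      · simp only [hg]
        rw [Set.indicator_of_mem hvS, Set.indicator_of_mem hvS, norm_mul, norm_mul, norm_mul,
          norm_of_nonneg (exp_pos _).le, norm_of_nonneg (exp_pos _).le]
        have h1 : (m : ℝ) ≤ ‖ic v‖ := by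
          choose u hu using hd
          have e : v = ((m : ℕ) : ℤ) • u := by ext i; rw [hu i]; simp
          have hu0 : u ≠ 0 := by rintro rfl; apply hv; rw [e]; simp
          rw [e, norm_ic_smul]
          have := one_le_norm_ic hu0
          nlinarith
        have h2 := hl _ hvS
        have h2' : κ * m ≤ α (ic v) := by nlinarith
        have hm1 : (1 : ℝ) ≤ m := by exact_mod_cast m.one_le
        have h3 : exp (-(k * β * α (ic v))) ≤ exp (β * κ / 2) *
            (exp (-(k * (β * κ / 2))) * exp (-(m * (β * κ / 2)))) * exp (-(β / 2 * α (ic v))) := by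
          rw [← exp_add, ← exp_add, ← exp_add]
          apply exp_le_exp.2
          have h4 : κ ≤ α (ic v) := by nlinarith
          have h5 : 0 ≤ β * (k - 1) * (α (ic v) - κ / 2) := by
            apply mul_nonneg
            · apply mul_nonneg hβ.le; linarith
            · linarith
          have h6 : 0 ≤ β * (α (ic v) - κ * m) := mul_nonneg hβ.le (by linarith)
          nlinarith
        have h7 := abs_muR_le m
        rw [← norm_eq_abs] at h7
        calc _ ≤ 1 * (‖w (ic v)‖ * (exp (β * κ / 2) *
            (exp (-(k * (β * κ / 2))) * exp (-(m * (β * κ / 2)))) * exp (-(β / 2 * α (ic v))))) := by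
              gcongr
          _ = _ := by ring
      · simp only [hg]
        rw [Set.indicator_of_notMem hvS]; simp; positivity
    · rw [norm_zero]; positivity
  have hUs' : Summable (Function.uncurry fun p v => U (p, v)) := hUs
  have hcomm := hUs'.tsum_comm
  -- inner sum over v
  have hin1 : ∀ p : ℕ+ × ℕ+, ∑' v, U (p, v) = muR p.2 * p.2 * Fs S α w (p.1 * p.2 * β) := by
    rintro ⟨k, m⟩
    have hm := pnat_pos m
    have hinj : Function.Injective (fun v : Fin d → ℤ => ((m : ℕ) : ℤ) • v) := by
      intro u v huv
      ext i
      have := congrFun huv i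
      simp only [Pi.smul_apply, smul_eq_mul] at this
      exact mul_left_cancel₀ (by exact_mod_cast m.ne_zero) this
    rw [Fs, ← tsum_mul_left]
    rw [← hinj.tsum_eq]
    · apply tsum_congr
      intro v
      simp only [hU]
      rw [if_pos (by intro i; simp)]
      simp only [hg]
      by_cases hv : ic v ∈ S
      · rw [Set.indicator_of_mem hv, Set.indicator_of_mem ((hsc m v).2 hv), ic_smul, map_smul,
          map_smul, smul_eq_mul, smul_eq_mul]
        rw [show (k : ℝ) * β * (m * α (ic v)) = k * m * β * α (ic v) by ring]
        ring
      · rw [Set.indicator_of_notMem hv, Set.indicator_of_notMem (fun h => hv ((hsc m v).1 h))]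
        simp
    · intro v hv
      by_contra hr
      apply hv
      simp only [hU]
      rw [if_neg]
      intro hd
      choose u hu using hd
      exact hr ⟨u, by ext i; simp [hu i]⟩
  have hin2 : ∀ v, ∑' p, U (p, v) =
      if IsPrimitiveVec v then S.indicator (fun x => w x * Qf (β * α x)) (ic v) else 0 := by
    intro v
    by_cases hv : v = 0
    · rw [if_neg (fun h => h.1 hv)]
      simp [hU, hv, hg0]
    by_cases hvS : ic v ∈ S
    · have h1 := one_le_norm_ic hv
      have h2 := hl _ hvS
      have h3 : 0 < β * α (ic v) := by
        apply mul_pos hβ; nlinarith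
      have he : ∀ p : ℕ+ × ℕ+, U (p, v) = w (ic v) * (exp (-(p.1 * (β * α (ic v)))) *
          (if (p.2 : ℕ) ∣ vgcd v then muR p.2 else 0)) := by
        rintro ⟨k, m⟩
        simp only [hU, hg, dvd_vgcd]
        rw [Set.indicator_of_mem hvS, mul_assoc (k : ℝ)]
        split_ifs
        · ring
        · simp
      simp_rw [he]
      have s1 := hasSum_exp_pnat h3
      have s2 := hasSum_moebius_dvd (vgcd_ne_zero hv)
      rw [tsum_mul_left, ← tsum_mul_tsum_of_summable_norm s1.summable.norm
        s2.summable.norm, s1.tsum_eq, s2.tsum_eq, Set.indicator_of_mem hvS]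
      by_cases hp : IsPrimitiveVec v
      · rw [if_pos hp, if_pos ((vgcd_eq_one hv).2 hp), mul_one]
      · rw [if_neg hp, if_neg (fun h => hp ((vgcd_eq_one hv).1 h))]; simp
    · simp [hU, hg, Set.indicator_of_notMem hvS]
  simp_rw [hin1, hin2] at hcomm
  refine ⟨?_, ?_⟩
  · have := hUs.prod
    simpa only [hin1] using this
  · rw [Gs]; exact hcomm

end Moeb


section Err
variable {d : ℕ} {S : Set (Fin d → ℝ)} {α : (Fin d → ℝ) →L[ℝ] ℝ} {κ : ℝ}

/-- error term -/
def err (S : Set (Fin d → ℝ)) (α w : (Fin d → ℝ) →L[ℝ] ℝ) (β : ℝ) : ℝ :=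
  Gs S α w β - zetaR (d + 1) / zetaR d * (Is S α w / β ^ (d + 1))

lemma err_eq (hd : 2 ≤ d) (hκ : 0 < κ) (hl : ∀ x ∈ S, κ * ‖x‖ ≤ α x)
    (hc : ∀ c : ℝ, 0 < c → ∀ x ∈ S, c • x ∈ S) (w : (Fin d → ℝ) →L[ℝ] ℝ) {β : ℝ} (hβ : 0 < β) :
    err S α w β = ∑' p : ℕ+ × ℕ+, muR p.2 * p.2 *
      (Fs S α w (p.1 * p.2 * β) - Is S α w / (p.1 * p.2 * β) ^ (d + 1)) := by
  obtain ⟨s1, e1⟩ := moebius_identity hκ hl hc w hβ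
  obtain ⟨s2, e2⟩ := main_zeta hd
  have s3 := s2.mul_right (Is S α w / β ^ (d + 1))
  rw [err, e1, ← e2, ← tsum_mul_right, ← s1.tsum_sub s3]
  apply tsum_congr
  rintro ⟨k, m⟩
  have := pnat_pos k
  have := pnat_pos m
  simp only [mul_pow]
  field_simp

lemma err_bound_three (hd : 3 ≤ d) (h : GCone S α κ) (hi : (interior S).Nonempty)
    (w : (Fin d → ℝ) →L[ℝ] ℝ) :
    ∃ K, ∀ β, 0 < β → |err S α w β| ≤ K / β ^ d := by
  obtain ⟨K, hK⟩ := F_est h hi w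
  have s := summable_two (p := d) (q := d - 1) (by omega) (by omega)
  refine ⟨K * ∑' x : ℕ+ × ℕ+, 1 / (x.1 : ℝ) ^ d * (1 / (x.2 : ℝ) ^ (d - 1)), fun β hβ => ?_⟩
  rw [err_eq (by omega) h.pos h.low h.smul w hβ]
  have s' := (s.mul_left K).mul_right (1 / β ^ d)
  have hb := tsum_of_norm_bounded (f := fun p : ℕ+ × ℕ+ => muR p.2 * p.2 *
      (Fs S α w (p.1 * p.2 * β) - Is S α w / (p.1 * p.2 * β) ^ (d + 1))) s'.hasSum (by
    rintro ⟨k, m⟩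
    have hk := pnat_pos k
    have hm := pnat_pos m
    have h1 := abs_muR_le m
    have h2 := hK (k * m * β) (by positivity)
    simp only [norm_mul, norm_eq_abs, abs_of_pos hm]
    calc _ ≤ 1 * (m : ℝ) * (K / (k * m * β) ^ d) := by gcongr
      _ = _ := by
        obtain ⟨e, rfl⟩ : ∃ e, d = e + 1 := ⟨d - 1, by omega⟩
        simp only [Nat.add_sub_cancel, mul_pow, pow_succ]
        field_simp)
  rw [tsum_mul_right, tsum_mul_left] at hb
  rw [norm_eq_abs] at hb
  refine hb.trans (le_of_eq ?_)
  ring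

end Err


section Two
variable {α : (Fin 2 → ℝ) →L[ℝ] ℝ} {κ : ℝ}

def det2 (x y : Fin 2 → ℝ) : ℝ := x 0 * y 1 - x 1 * y 0

def idet (u v : Fin 2 → ℤ) : ℤ := u 0 * v 1 - u 1 * v 0

lemma det2_ic (u v : Fin 2 → ℤ) : det2 (ic u) (ic v) = idet u v := by
  simp [det2, idet, ic]

/-- open cone spanned by two vectors -/
def Op (u v : Fin 2 → ℝ) : Set (Fin 2 → ℝ) :=
  {x | ∃ p q : ℝ, 0 < p ∧ 0 < q ∧ x = p • u + q • v}

lemma cramer (u v x : Fin 2 → ℝ) : det2 u v • x = det2 x v • u + det2 u x • v := by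
  ext i
  fin_cases i <;> simp [det2] <;> ring

lemma mem_Op {u v x : Fin 2 → ℝ} (hD : det2 u v ≠ 0) :
    x ∈ Op u v ↔ 0 < det2 u v * det2 x v ∧ 0 < det2 u v * det2 u x := by
  constructor
  · rintro ⟨p, q, hp, hq, rfl⟩
    have h1 : det2 u v * det2 (p • u + q • v) v = det2 u v ^ 2 * p := by simp [det2]; ring
    have h2 : det2 u v * det2 u (p • u + q • v) = det2 u v ^ 2 * q := by simp [det2]; ring
    rw [h1, h2]
    constructor <;> positivity
  · rintro ⟨h1, h2⟩
    have h3 : 0 < det2 u v ^ 2 := by positivity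
    refine ⟨det2 u v * det2 x v / det2 u v ^ 2, det2 u v * det2 u x / det2 u v ^ 2,
      by positivity, by positivity, ?_⟩
    have h := cramer u v x
    have h5 : det2 u v • x = det2 u v • ((det2 u v * det2 x v / det2 u v ^ 2) • u +
        (det2 u v * det2 u x / det2 u v ^ 2) • v) := by
      rw [h, smul_add, smul_smul, smul_smul]
      congr 2 <;> field_simp
    exact smul_right_injective _ hD h5

lemma continuous_det2_left (v : Fin 2 → ℝ) : Continuous (fun x => det2 x v) := by
  unfold det2; fun_prop

lemma continuous_det2_right (v : Fin 2 → ℝ) : Continuous (fun x => det2 v x) := by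
  unfold det2; fun_prop

lemma isOpen_Op {u v : Fin 2 → ℝ} (hD : det2 u v ≠ 0) : IsOpen (Op u v) := by
  have : Op u v = {x | 0 < det2 u v * det2 x v} ∩ {x | 0 < det2 u v * det2 u x} := by
    ext x; rw [mem_Op hD]; rfl
  rw [this]
  exact (isOpen_lt continuous_const (continuous_const.mul (continuous_det2_left v))).inter
    (isOpen_lt continuous_const (continuous_const.mul (continuous_det2_right u)))

lemma Op_add {u v x y : Fin 2 → ℝ} (hx : x ∈ Op u v) (hy : y ∈ Op u v) : x + y ∈ Op u v := by
  obtain ⟨p, q, hp, hq, rfl⟩ := hx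
  obtain ⟨p', q', hp', hq', rfl⟩ := hy
  exact ⟨p + p', q + q', by positivity, by positivity, by module⟩

lemma Op_smul {u v x : Fin 2 → ℝ} {c : ℝ} (hc : 0 < c) (hx : x ∈ Op u v) : c • x ∈ Op u v := by
  obtain ⟨p, q, hp, hq, rfl⟩ := hx
  exact ⟨c * p, c * q, by positivity, by positivity, by module⟩

lemma Op_low {u v : Fin 2 → ℝ} (hκ : 0 < κ) (hu : κ * ‖u‖ ≤ α u) (hv : κ * ‖v‖ ≤ α v) :
    ∀ x ∈ Op u v, κ * ‖x‖ ≤ α x := by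
  rintro x ⟨p, q, hp, hq, rfl⟩
  have h1 : ‖p • u + q • v‖ ≤ p * ‖u‖ + q * ‖v‖ := by
    refine (norm_add_le _ _).trans ?_
    rw [norm_smul, norm_smul, norm_of_nonneg hp.le, norm_of_nonneg hq.le]
  rw [map_add, map_smul, map_smul, smul_eq_mul, smul_eq_mul]
  nlinarith

lemma gcone_Op {u v : Fin 2 → ℝ} (hκ : 0 < κ) (hD : det2 u v ≠ 0)
    (hu : κ * ‖u‖ ≤ α u) (hv : κ * ‖v‖ ≤ α v) : GCone (Op u v) α κ where
  meas := (isOpen_Op hD).measurableSet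
  add := fun x hx y hy => Op_add hx hy
  smul := fun c hc x hx => Op_smul hc hx
  pos := hκ
  low := Op_low hκ hu hv

lemma hasSum_mul_exp_pnat {s : ℝ} (hs : 0 < s) :
    HasSum (fun k : ℕ+ => (k : ℝ) * exp (-(k * s))) (Pf s) := by
  have h1 : ‖exp (-s)‖ < 1 := by
    rw [norm_of_nonneg (exp_pos _).le, exp_lt_one_iff]; linarith
  have h2 := hasSum_coe_mul_geometric_of_norm_lt_one h1
  have h3 := hasSum_pnat_of_nat (f := fun n : ℕ => (n : ℝ) * exp (-s) ^ n) (by simp) h2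
  convert! h3 using 1
  ext k
  rw [← exp_nat_mul]; congr 2; ring

/-- unimodular pairs of integer vectors in the half space cone -/
structure UP (α : (Fin 2 → ℝ) →L[ℝ] ℝ) (κ : ℝ) (u v : Fin 2 → ℤ) : Prop where
  pos : 0 < κ
  det : idet u v = 1 ∨ idet u v = -1
  hu : κ * ‖ic u‖ ≤ α (ic u)
  hv : κ * ‖ic v‖ ≤ α (ic v)

lemma UP.symm {u v : Fin 2 → ℤ} (h : UP α κ u v) : UP α κ v u where
  pos := h.pos
  det := by
    have : idet v u = - idet u v := by simp [idet]; ring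
    rcases h.det with h | h <;> rw [this, h] <;> simp
  hu := h.hv
  hv := h.hu

lemma UP.sq {u v : Fin 2 → ℤ} (h : UP α κ u v) : idet u v * idet u v = 1 := by
  rcases h.det with h | h <;> rw [h] <;> norm_num

lemma UP.ne {u v : Fin 2 → ℤ} (h : UP α κ u v) : det2 (ic u) (ic v) ≠ 0 := by
  rw [det2_ic]
  have := h.sq
  intro h0
  have : idet u v = 0 := by exact_mod_cast h0
  simp [this] at *

lemma UP.u_ne {u v : Fin 2 → ℤ} (h : UP α κ u v) : u ≠ 0 := by
  rintro rfl
  have := h.sq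
  simp [idet] at this

lemma UP.A_ge {u v : Fin 2 → ℤ} (h : UP α κ u v) : κ ≤ α (ic u) := by
  have h1 := one_le_norm_ic h.u_ne
  have := h.pos
  have := h.hu
  nlinarith

lemma UP.A_pos {u v : Fin 2 → ℤ} (h : UP α κ u v) : 0 < α (ic u) := h.pos.trans_le h.A_ge

lemma UP.gcone {u v : Fin 2 → ℤ} (h : UP α κ u v) : GCone (Op (ic u) (ic v)) α κ :=
  gcone_Op h.pos h.ne h.hu h.hv

lemma Op_inter {u v : Fin 2 → ℝ} (hD : det2 u v ≠ 0) : (interior (Op u v)).Nonempty := by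
  rw [(isOpen_Op hD).interior_eq]
  exact ⟨(1 : ℝ) • u + (1 : ℝ) • v, 1, 1, one_pos, one_pos, rfl⟩

lemma icast_add_smul (p q : ℕ) (u v : Fin 2 → ℤ) :
    ic ((p : ℤ) • u + (q : ℤ) • v) = (p : ℝ) • ic u + (q : ℝ) • ic v := by
  ext i; simp [ic]

lemma Fs_Op {u v : Fin 2 → ℤ} (h : UP α κ u v) (w : (Fin 2 → ℝ) →L[ℝ] ℝ) {t : ℝ} (ht : 0 < t) :
    Fs (Op (ic u) (ic v)) α w t =
      w (ic u) * (Pf (t * α (ic u)) * Qf (t * α (ic v))) +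
      w (ic v) * (Pf (t * α (ic v)) * Qf (t * α (ic u))) := by
  have hA := mul_pos ht h.A_pos
  have hB := mul_pos ht h.symm.A_pos
  set φ : ℕ+ × ℕ+ → (Fin 2 → ℤ) := fun p => ((p.1 : ℕ) : ℤ) • u + ((p.2 : ℕ) : ℤ) • v with hφ
  have hdet1 : ∀ p, idet (φ p) v = p.1 * idet u v := by
    intro p; simp [idet, hφ]; ring
  have hdet2 : ∀ p, idet u (φ p) = p.2 * idet u v := by
    intro p; simp [idet, hφ]; ring
  have hD0 : idet u v ≠ 0 := by
    intro h0; have := h.sq; simp [h0] at this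
  have hinj : Function.Injective φ := by
    intro p p' hpp
    have h1 := hdet1 p
    have h2 := hdet2 p
    rw [hpp, hdet1] at h1
    rw [hpp, hdet2] at h2
    have e1 := mul_right_cancel₀ hD0 h1
    have e2 := mul_right_cancel₀ hD0 h2
    ext
    · exact_mod_cast e1.symm
    · exact_mod_cast e2.symm
  have hmem : ∀ p, ic (φ p) ∈ Op (ic u) (ic v) := by
    intro p
    refine ⟨p.1, p.2, pnat_pos _, pnat_pos _, ?_⟩
    exact icast_add_smul _ _ u v
  rw [Fs, ← hinj.tsum_eq]
  · have e : ∀ p : ℕ+ × ℕ+, (Op (ic u) (ic v)).indicator (fun x => w x * exp (-(t * α x))) (ic (φ p))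
        = w (ic u) * (((p.1 : ℝ) * exp (-(p.1 * (t * α (ic u))))) * exp (-(p.2 * (t * α (ic v))))) +
          w (ic v) * (exp (-(p.1 * (t * α (ic u)))) * ((p.2 : ℝ) * exp (-(p.2 * (t * α (ic v)))))) := by
      intro p
      rw [Set.indicator_of_mem (hmem p)]
      have : ic (φ p) = (p.1 : ℝ) • ic u + (p.2 : ℝ) • ic v := icast_add_smul _ _ u v
      rw [this]
      simp only [map_add, map_smul, smul_eq_mul]
      rw [show -(t * ((p.1 : ℝ) * α (ic u) + p.2 * α (ic v))) =
        -(p.1 * (t * α (ic u))) + -(p.2 * (t * α (ic v))) by ring, exp_add]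
      ring
    simp_rw [e]
    have a1 := hasSum_mul_exp_pnat hA
    have a2 := hasSum_exp_pnat hA
    have b1 := hasSum_mul_exp_pnat hB
    have b2 := hasSum_exp_pnat hB
    have s1 := summable_mul_of_summable_norm a1.summable.norm b2.summable.norm
    have s2 := summable_mul_of_summable_norm a2.summable.norm b1.summable.norm
    rw [(s1.mul_left _).tsum_add (s2.mul_left _), tsum_mul_left, tsum_mul_left,
      ← tsum_mul_tsum_of_summable_norm a1.summable.norm b2.summable.norm,
      ← tsum_mul_tsum_of_summable_norm a2.summable.norm b1.summable.norm,
      a1.tsum_eq, a2.tsum_eq, b1.tsum_eq, b2.tsum_eq]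
    ring
  · intro z hz
    have hz' : ic z ∈ Op (ic u) (ic v) := by
      by_contra hn
      apply hz
      exact Set.indicator_of_notMem hn _
    rw [mem_Op h.ne, det2_ic, det2_ic, det2_ic] at hz'
    obtain ⟨h1, h2⟩ := hz'
    have h1' : 0 < idet u v * idet z v := by exact_mod_cast h1
    have h2' : 0 < idet u v * idet u z := by exact_mod_cast h2
    refine ⟨(⟨(idet u v * idet z v).toNat, by omega⟩, ⟨(idet u v * idet u z).toNat, by omega⟩), ?_⟩
    have hsq := h.sq
    simp only [hφ, PNat.mk_coe, Int.toNat_of_nonneg h1'.le, Int.toNat_of_nonneg h2'.le]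
    ext i
    have : z i = idet u v * idet u v * z i := by rw [hsq, one_mul]
    rw [this]
    fin_cases i <;> simp [idet] <;> ring

lemma tendsto_Pf {A : ℝ} (hA : 0 < A) :
    Tendsto (fun t => t ^ 2 * Pf (t * A)) (𝓝[>] 0) (𝓝 (1 / A ^ 2)) := by
  have l1 : Tendsto (fun t : ℝ => 1 / A ^ 2 - t ^ 2) (𝓝[>] 0) (𝓝 (1 / A ^ 2)) := by
    have : Tendsto (fun t : ℝ => 1 / A ^ 2 - t ^ 2) (𝓝 0) (𝓝 (1 / A ^ 2 - 0 ^ 2)) :=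
      Continuous.tendsto (by fun_prop) 0
    simp only [ne_eq, OfNat.ofNat_ne_zero, not_false_eq_true, zero_pow, sub_zero] at this
    exact this.mono_left nhdsWithin_le_nhds
  refine tendsto_of_tendsto_of_tendsto_of_le_of_le' l1 tendsto_const_nhds ?_ ?_
  · filter_upwards [self_mem_nhdsWithin] with t (ht : 0 < t)
    have h := Pf_ge (s := t * A) (by positivity)
    have : t ^ 2 * (1 / (t * A) ^ 2 - Pf (t * A)) ≤ t ^ 2 * 1 := by gcongr
    have e : t ^ 2 * (1 / (t * A) ^ 2) = 1 / A ^ 2 := by field_simp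
    rw [mul_sub, e] at this
    linarith
  · filter_upwards [self_mem_nhdsWithin] with t (ht : 0 < t)
    have h := Pf_le (s := t * A) (by positivity)
    have : t ^ 2 * Pf (t * A) ≤ t ^ 2 * (1 / (t * A) ^ 2) := by gcongr
    have e : t ^ 2 * (1 / (t * A) ^ 2) = 1 / A ^ 2 := by field_simp
    linarith

lemma tendsto_Qf {A : ℝ} (hA : 0 < A) :
    Tendsto (fun t => t * Qf (t * A)) (𝓝[>] 0) (𝓝 (1 / A)) := by
  have l1 : Tendsto (fun t : ℝ => 1 / A - t) (𝓝[>] 0) (𝓝 (1 / A)) := by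
    have : Tendsto (fun t : ℝ => 1 / A - t) (𝓝 0) (𝓝 (1 / A - 0)) :=
      Continuous.tendsto (by fun_prop) 0
    simp only [sub_zero] at this
    exact this.mono_left nhdsWithin_le_nhds
  refine tendsto_of_tendsto_of_tendsto_of_le_of_le' l1 tendsto_const_nhds ?_ ?_
  · filter_upwards [self_mem_nhdsWithin] with t (ht : 0 < t)
    have h := Rf_le_one (s := t * A) (by positivity)
    unfold Rf at h
    have : t * (1 / (t * A) - Qf (t * A)) ≤ t * 1 := by gcongr
    have e : t * (1 / (t * A)) = 1 / A := by field_simp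
    rw [mul_sub, e] at this
    linarith
  · filter_upwards [self_mem_nhdsWithin] with t (ht : 0 < t)
    have h := Qf_le (s := t * A) (by positivity)
    have : t * Qf (t * A) ≤ t * (1 / (t * A)) := by gcongr
    have e : t * (1 / (t * A)) = 1 / A := by field_simp
    linarith

lemma Is_Op {u v : Fin 2 → ℤ} (h : UP α κ u v) (w : (Fin 2 → ℝ) →L[ℝ] ℝ) :
    Is (Op (ic u) (ic v)) α w = w (ic u) * (1 / α (ic u) ^ 2 * (1 / α (ic v))) +
      w (ic v) * (1 / α (ic v) ^ 2 * (1 / α (ic u))) := by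
  have hA := h.A_pos
  have hB := h.symm.A_pos
  obtain ⟨K, hK⟩ := F_est h.gcone (Op_inter h.ne) w
  have t1 : Tendsto (fun t => t ^ 3 * Fs (Op (ic u) (ic v)) α w t) (𝓝[>] 0)
      (𝓝 (Is (Op (ic u) (ic v)) α w)) := by
    rw [tendsto_iff_norm_sub_tendsto_zero]
    have t0 : Tendsto (fun t : ℝ => K * t) (𝓝[>] 0) (𝓝 0) := by
      have : Tendsto (fun t : ℝ => K * t) (𝓝 0) (𝓝 (K * 0)) := Continuous.tendsto (by fun_prop) 0
      rw [mul_zero] at this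
      exact this.mono_left nhdsWithin_le_nhds
    refine squeeze_zero' (Filter.Eventually.of_forall fun _ => norm_nonneg _) ?_ t0
    filter_upwards [self_mem_nhdsWithin] with t (ht : 0 < t)
    have := hK t ht
    have e : t ^ 3 * Fs (Op (ic u) (ic v)) α w t - Is (Op (ic u) (ic v)) α w =
      t ^ 3 * (Fs (Op (ic u) (ic v)) α w t - Is (Op (ic u) (ic v)) α w / t ^ (2 + 1)) := by
      field_simp
      ring
    rw [e, norm_mul, norm_eq_abs, norm_eq_abs, abs_of_pos (by positivity)]
    calc _ ≤ t ^ 3 * (K / t ^ 2) := by gcongr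
      _ = K * t := by field_simp
  have t2 := (((tendsto_Pf hA).mul (tendsto_Qf hB)).const_mul (w (ic u))).add
    (((tendsto_Pf hB).mul (tendsto_Qf hA)).const_mul (w (ic v)))
  refine tendsto_nhds_unique t1 (t2.congr' ?_)
  filter_upwards [self_mem_nhdsWithin] with t (ht : 0 < t)
  rw [Fs_Op h w ht]
  ring

/-- the bound for unimodular cones -/
lemma err_Op {u v : Fin 2 → ℤ} (h : UP α κ u v) (w : (Fin 2 → ℝ) →L[ℝ] ℝ) {β : ℝ} (hβ : 0 < β) :
    |err (Op (ic u) (ic v)) α w β| ≤ 8 * zetaR 2 * (‖w‖ / κ) / β ^ 2 *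
      (1 / α (ic u) + 1 / α (ic v)) := by
  have hA := h.A_pos
  have hB := h.symm.A_pos
  have hg := h.gcone
  rw [err_eq le_rfl hg.pos hg.low hg.smul w hβ]
  set A := α (ic u) with hAd
  set B := α (ic v) with hBd
  have hκ := h.pos
  have wu : |w (ic u)| ≤ ‖w‖ / κ * A := by
    have h1 := w.le_opNorm (ic u)
    rw [norm_eq_abs] at h1
    have h2 := h.hu
    refine h1.trans ?_
    rw [div_mul_eq_mul_div, le_div_iff₀ hκ]
    nlinarith [norm_nonneg w]
  have wv : |w (ic v)| ≤ ‖w‖ / κ * B := by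
    have h1 := w.le_opNorm (ic v)
    rw [norm_eq_abs] at h1
    have h2 := h.hv
    refine h1.trans ?_
    rw [div_mul_eq_mul_div, le_div_iff₀ hκ]
    nlinarith [norm_nonneg w]
  obtain ⟨s1, b1⟩ := core_sum (x := β * A) (y := β * B) (by positivity) (by positivity)
  obtain ⟨s2, b2⟩ := core_sum (x := β * B) (y := β * A) (by positivity) (by positivity)
  have e : ∀ p : ℕ+ × ℕ+, muR p.2 * p.2 * (Fs (Op (ic u) (ic v)) α w (p.1 * p.2 * β) -
      Is (Op (ic u) (ic v)) α w / (p.1 * p.2 * β) ^ (2 + 1)) =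
      w (ic u) * (muR p.2 * p.2 *
      (Pf (p.1 * p.2 * (β * A)) * Qf (p.1 * p.2 * (β * B)) -
        1 / ((p.1 * p.2 * (β * A)) ^ 2 * (p.1 * p.2 * (β * B))))) +
      w (ic v) * (muR p.2 * p.2 *
      (Pf (p.1 * p.2 * (β * B)) * Qf (p.1 * p.2 * (β * A)) -
        1 / ((p.1 * p.2 * (β * B)) ^ 2 * (p.1 * p.2 * (β * A))))) := by
    rintro ⟨k, m⟩
    have hk := pnat_pos k
    have hm := pnat_pos m
    rw [Fs_Op h w (by positivity), Is_Op h w, ← hAd, ← hBd, mul_assoc _ β A, mul_assoc _ β B]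
    field_simp
    ring
  simp_rw [e]
  rw [(s1.mul_left _).tsum_add (s2.mul_left _), tsum_mul_left, tsum_mul_left]
  refine (abs_add_le _ _).trans ?_
  rw [abs_mul, abs_mul]
  have hz := zetaR_pos (p := 2) le_rfl
  calc _ ≤ (‖w‖ / κ * A) * (4 * zetaR 2 * (1 / (β * A) ^ 2 + 1 / (β * A * (β * B)))) +
      (‖w‖ / κ * B) * (4 * zetaR 2 * (1 / (β * B) ^ 2 + 1 / (β * B * (β * A)))) := by
        gcongr
    _ = _ := by field_simp; ring

end Two


section Addi
variable {d : ℕ} {S T : Set (Fin d → ℝ)} {α : (Fin d → ℝ) →L[ℝ] ℝ} {κ : ℝ}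

lemma Qf_le_exp {s s0 : ℝ} (h0 : 0 < s0) (hs : s0 ≤ s) : Qf s ≤ exp (-s) / (1 - exp (-s0)) := by
  unfold Qf
  have h1 := one_sub_exp_pos h0
  have h2 : exp (-s) ≤ exp (-s0) := exp_le_exp.2 (by linarith)
  have := exp_pos (-s)
  exact div_le_div_of_nonneg_left this.le h1 (by linarith)

open Classical in
lemma summable_Gs (hκ : 0 < κ) (hl : ∀ x ∈ S, κ * ‖x‖ ≤ α x)
    (w : (Fin d → ℝ) →L[ℝ] ℝ) {β : ℝ} (hβ : 0 < β) :
    Summable (fun v : Fin d → ℤ =>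
      if IsPrimitiveVec v then S.indicator (fun x => w x * Qf (β * α x)) (ic v) else 0) := by
  have hs := ((summable_Fs hκ hl w hβ).norm).mul_right (1 / (1 - exp (-(β * κ))))
  have hp := one_sub_exp_pos (s := β * κ) (by positivity)
  refine Summable.of_norm_bounded hs ?_
  intro v
  split_ifs with hv
  · by_cases hvS : ic v ∈ S
    · rw [Set.indicator_of_mem hvS, Set.indicator_of_mem hvS, norm_mul, norm_mul]
      have h1 := one_le_norm_ic hv.1
      have h2 := hl _ hvS
      have h3 : β * κ ≤ β * α (ic v) := by
        apply mul_le_mul_of_nonneg_left _ hβ.le; nlinarith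
      have h4 := Qf_le_exp (s0 := β * κ) (by positivity) h3
      have h5 := Qf_nonneg (s := β * α (ic v)) (lt_of_lt_of_le (by positivity) h3)
      rw [norm_of_nonneg h5, norm_of_nonneg (exp_pos _).le, mul_assoc, mul_one_div]
      gcongr
    · rw [Set.indicator_of_notMem hvS, Set.indicator_of_notMem hvS]; simp
  · rw [norm_zero]; positivity

lemma Gs_union (hκ : 0 < κ) (hS : ∀ x ∈ S, κ * ‖x‖ ≤ α x) (hT : ∀ x ∈ T, κ * ‖x‖ ≤ α x)
    (hdis : Disjoint S T) (w : (Fin d → ℝ) →L[ℝ] ℝ) {β : ℝ} (hβ : 0 < β) :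
    Gs (S ∪ T) α w β = Gs S α w β + Gs T α w β := by
  classical
  unfold Gs
  rw [← (summable_Gs hκ hS w hβ).tsum_add (summable_Gs hκ hT w hβ)]
  apply tsum_congr
  intro v
  split_ifs
  · rw [Set.indicator_union_of_disjoint hdis]
  · simp

lemma Is_union (hκ : 0 < κ) (hS : ∀ x ∈ S, κ * ‖x‖ ≤ α x) (hT : ∀ x ∈ T, κ * ‖x‖ ≤ α x)
    (mS : MeasurableSet S) (mT : MeasurableSet T)
    (hdis : Disjoint S T) (w : (Fin d → ℝ) →L[ℝ] ℝ) :
    Is (S ∪ T) α w = Is S α w + Is T α w := by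
  unfold Is
  have h1 := intOn_lin mS hκ hS w one_pos
  have h2 := intOn_lin mT hκ hT w one_pos
  simp only [one_mul] at h1 h2
  exact setIntegral_union hdis mT h1 h2

lemma err_union (hκ : 0 < κ) (hS : ∀ x ∈ S, κ * ‖x‖ ≤ α x) (hT : ∀ x ∈ T, κ * ‖x‖ ≤ α x)
    (mS : MeasurableSet S) (mT : MeasurableSet T)
    (hdis : Disjoint S T) (w : (Fin d → ℝ) →L[ℝ] ℝ) {β : ℝ} (hβ : 0 < β) :
    err (S ∪ T) α w β = err S α w β + err T α w β := by
  unfold err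
  rw [Gs_union hκ hS hT hdis w hβ, Is_union hκ hS hT mS mT hdis w]
  ring

lemma err_diff (hκ : 0 < κ) (hS : ∀ x ∈ S, κ * ‖x‖ ≤ α x) (hTS : T ⊆ S)
    (mS : MeasurableSet S) (mT : MeasurableSet T)
    (w : (Fin d → ℝ) →L[ℝ] ℝ) {β : ℝ} (hβ : 0 < β) :
    err (S \ T) α w β = err S α w β - err T α w β := by
  have h := err_union hκ (fun x (hx : x ∈ S \ T) => hS x hx.1) (fun x hx => hS x (hTS hx))
    (mS.diff mT) mT Set.disjoint_sdiff_left w hβ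
  rw [Set.diff_union_of_subset hTS] at h
  linarith

lemma err_empty (w : (Fin d → ℝ) →L[ℝ] ℝ) (β : ℝ) : err ∅ α w β = 0 := by
  unfold err Gs Is
  simp

lemma Gs_crude (hκ : 0 < κ) (hS : ∀ x ∈ S, κ * ‖x‖ ≤ α x) (hTS : T ⊆ S)
    (w : (Fin d → ℝ) →L[ℝ] ℝ) {β : ℝ} (hβ : 0 < β) :
    |Gs T α w β| ≤ ‖w‖ / κ * Gs S α α β := by
  classical
  have h := tsum_of_norm_bounded ((summable_Gs hκ hS α hβ).mul_left (‖w‖ / κ)).hasSum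
    (f := fun v : Fin d → ℤ =>
      if IsPrimitiveVec v then T.indicator (fun x => w x * Qf (β * α x)) (ic v) else 0) (by
    intro v
    split_ifs with hv
    · by_cases hT : ic v ∈ T
      · rw [Set.indicator_of_mem hT, Set.indicator_of_mem (hTS hT)]
        have h1 := one_le_norm_ic hv.1
        have h2 := hS _ (hTS hT)
        have h3 : 0 < α (ic v) := by nlinarith
        have h5 := Qf_nonneg (s := β * α (ic v)) (by positivity)
        rw [norm_mul, norm_of_nonneg h5, ← mul_assoc]
        gcongr
        have h6 := w.le_opNorm (ic v)
        refine h6.trans ?_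
        rw [div_mul_eq_mul_div, le_div_iff₀ hκ]
        nlinarith [norm_nonneg w]
      · rw [Set.indicator_of_notMem hT, norm_zero]
        apply mul_nonneg (by positivity)
        by_cases hS' : ic v ∈ S
        · rw [Set.indicator_of_mem hS']
          have h1 := one_le_norm_ic hv.1
          have h2 := hS _ hS'
          have h3 : 0 < α (ic v) := by nlinarith
          have h5 := Qf_nonneg (s := β * α (ic v)) (by positivity)
          positivity
        · rw [Set.indicator_of_notMem hS']
    · simp)
  rw [tsum_mul_left] at h
  exact h

lemma Is_crude (hκ : 0 < κ) (hS : ∀ x ∈ S, κ * ‖x‖ ≤ α x) (hTS : T ⊆ S)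
    (mS : MeasurableSet S) (mT : MeasurableSet T)
    (w : (Fin d → ℝ) →L[ℝ] ℝ) :
    |Is T α w| ≤ ‖w‖ / κ * Is S α α := by
  have hT : ∀ x ∈ T, κ * ‖x‖ ≤ α x := fun x hx => hS x (hTS hx)
  have h1 := intOn_lin mT hκ hT w one_pos
  have h2 := intOn_lin mT hκ hT α one_pos
  have h3 := intOn_lin mS hκ hS α one_pos
  simp only [one_mul] at h1 h2 h3
  unfold Is
  calc _ ≤ ∫ x in T, |w x * exp (-(α x))| := abs_integral_le_integral_abs
    _ ≤ ∫ x in T, ‖w‖ / κ * (α x * exp (-(α x))) := by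
      refine setIntegral_mono_on h1.abs (h2.const_mul _) mT (fun x hx => ?_)
      rw [abs_mul, abs_of_pos (exp_pos _), ← mul_assoc]
      gcongr
      have h6 := w.le_opNorm x
      refine h6.trans ?_
      rw [div_mul_eq_mul_div, le_div_iff₀ hκ]
      nlinarith [norm_nonneg w, hT x hx]
    _ = ‖w‖ / κ * ∫ x in T, (α x * exp (-(α x))) := integral_const_mul _ _
    _ ≤ _ := by
      refine mul_le_mul_of_nonneg_left ?_ (by positivity)
      refine setIntegral_mono_set h3 ?_ (Filter.Eventually.of_forall hTS)
      rw [Filter.EventuallyLE, ae_restrict_iff' mS]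
      refine Filter.Eventually.of_forall (fun x hx => ?_)
      have := hS x hx
      exact mul_nonneg (le_trans (by positivity) this) (exp_pos _).le

end Addi

section TwoB
variable {α : (Fin 2 → ℝ) →L[ℝ] ℝ} {κ : ℝ}

/-- constants -/
def Kc (α w : (Fin 2 → ℝ) →L[ℝ] ℝ) (κ : ℝ) : ℝ := 8 * zetaR 2 * (‖w‖ / κ) * (1 + ‖α‖ / κ)

lemma Kc_nonneg (α w : (Fin 2 → ℝ) →L[ℝ] ℝ) (hκ : 0 < κ) : 0 ≤ Kc α w κ := by
  have := zetaR_pos (p := 2) le_rfl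
  unfold Kc; positivity

def Cc (w : (Fin 2 → ℝ) →L[ℝ] ℝ) (κ : ℝ) : ℝ := 4 * (‖w‖ / κ) * (zetaR 3 / zetaR 2)

lemma Cc_nonneg (w : (Fin 2 → ℝ) →L[ℝ] ℝ) (hκ : 0 < κ) : 0 ≤ Cc w κ := by
  have := zetaR_pos (p := 2) le_rfl
  have := zetaR_pos (p := 3) (by norm_num)
  unfold Cc; positivity

lemma err_Op' {u v : Fin 2 → ℤ} (h : UP α κ u v) (w : (Fin 2 → ℝ) →L[ℝ] ℝ) {β : ℝ} (hβ : 0 < β) :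
    |err (Op (ic u) (ic v)) α w β| ≤ Kc α w κ / β ^ 2 * (1 / α (ic u) + 1 / α (ic v)) := by
  refine (err_Op h w hβ).trans ?_
  have := h.pos
  have := h.A_pos
  have := h.symm.A_pos
  have := zetaR_pos (p := 2) le_rfl
  unfold Kc
  refine mul_le_mul_of_nonneg_right (div_le_div_of_nonneg_right ?_ (by positivity)) (by positivity)
  have : 0 ≤ ‖α‖ / κ := by positivity
  have : 0 ≤ 8 * zetaR 2 * (‖w‖ / κ) := by positivity
  nlinarith

lemma err_crude {u v : Fin 2 → ℤ} (h : UP α κ u v) (w : (Fin 2 → ℝ) →L[ℝ] ℝ) {β : ℝ} (hβ : 0 < β)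
    {T : Set (Fin 2 → ℝ)} (hT : T ⊆ Op (ic u) (ic v)) (mT : MeasurableSet T) :
    |err T α w β| ≤ Cc w κ / β ^ 3 * (1 / (α (ic u) * α (ic v))) +
      Kc α w κ / β ^ 2 * (1 / α (ic u) + 1 / α (ic v)) := by
  have hκ := h.pos
  have hA := h.A_pos
  have hB := h.symm.A_pos
  have hz2 := zetaR_pos (p := 2) le_rfl
  have hz3 := zetaR_pos (p := 3) (by norm_num)
  have hg := h.gcone
  have g1 := Gs_crude hκ hg.low hT w hβ
  have g2 := Is_crude hκ hg.low hT hg.meas mT w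
  have hI := Is_Op h α
  have hE := err_Op h α hβ
  have hI' : Is (Op (ic u) (ic v)) α α = 2 / (α (ic u) * α (ic v)) := by
    rw [hI]; field_simp; ring
  have hG : Gs (Op (ic u) (ic v)) α α β = err (Op (ic u) (ic v)) α α β +
      zetaR 3 / zetaR 2 * (2 / (α (ic u) * α (ic v)) / β ^ 3) := by
    rw [err, hI']; ring
  have hG' : Gs (Op (ic u) (ic v)) α α β ≤
      8 * zetaR 2 * (‖α‖ / κ) / β ^ 2 * (1 / α (ic u) + 1 / α (ic v)) +
      zetaR 3 / zetaR 2 * (2 / (α (ic u) * α (ic v)) / β ^ 3) := by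
    rw [hG]; linarith [le_abs_self (err (Op (ic u) (ic v)) α α β)]
  have e1 : |err T α w β| ≤ |Gs T α w β| + zetaR 3 / zetaR 2 * (|Is T α w| / β ^ 3) := by
    unfold err
    refine (abs_sub _ _).trans ?_
    rw [abs_mul, abs_div (Is T α w), abs_of_pos (show 0 < zetaR (2 + 1) / zetaR 2 from div_pos hz3 hz2),
      abs_of_pos (show 0 < β ^ (2 + 1) by positivity)]
  rw [hI'] at g2
  calc _ ≤ _ := e1
    _ ≤ ‖w‖ / κ * (8 * zetaR 2 * (‖α‖ / κ) / β ^ 2 * (1 / α (ic u) + 1 / α (ic v)) +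
      zetaR 3 / zetaR 2 * (2 / (α (ic u) * α (ic v)) / β ^ 3)) +
      zetaR 3 / zetaR 2 * ((‖w‖ / κ * (2 / (α (ic u) * α (ic v)))) / β ^ 3) := by
        gcongr
        exact g1.trans (by gcongr)
    _ = Cc w κ / β ^ 3 * (1 / (α (ic u) * α (ic v))) +
      (8 * zetaR 2 * (‖w‖ / κ) * (‖α‖ / κ)) / β ^ 2 * (1 / α (ic u) + 1 / α (ic v)) := by
        unfold Cc; ring
    _ ≤ _ := by
        unfold Kc
        gcongr
        have : 0 ≤ 8 * zetaR 2 * (‖w‖ / κ) := by positivity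
        linarith

end TwoB


section TwoC
variable {α : (Fin 2 → ℝ) →L[ℝ] ℝ} {κ : ℝ}

/-- two complementary convex cones (without apex) -/
structure SepC (W V : Set (Fin 2 → ℝ)) : Prop where
  mW : MeasurableSet W
  mV : MeasurableSet V
  dis : ∀ x ∈ W, x ∉ V
  addW : ∀ x ∈ W, ∀ y ∈ W, x + y ∈ W
  addV : ∀ x ∈ V, ∀ y ∈ V, x + y ∈ V
  smulW : ∀ c : ℝ, 0 < c → ∀ x ∈ W, c • x ∈ W
  smulV : ∀ c : ℝ, 0 < c → ∀ x ∈ V, c • x ∈ V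
  mix : ∀ x ∈ W, ∀ y ∈ V, x + y ∈ W ∪ V

lemma SepC.symm {W V : Set (Fin 2 → ℝ)} (h : SepC W V) : SepC V W where
  mW := h.mV
  mV := h.mW
  dis := fun x hx hx' => h.dis x hx' hx
  addW := h.addV
  addV := h.addW
  smulW := h.smulV
  smulV := h.smulW
  mix := fun x hx y hy => by rw [add_comm, Set.union_comm]; exact h.mix y hy x hx

lemma SepC.comb {W V : Set (Fin 2 → ℝ)} (h : SepC W V) {x y : Fin 2 → ℝ} (hx : x ∈ W) (hy : y ∈ W)
    {a b : ℝ} (ha : 0 ≤ a) (hb : 0 < b) : a • x + b • y ∈ W := by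
  rcases ha.eq_or_lt with rfl | ha
  · simpa using h.smulW b hb y hy
  · exact h.addW _ (h.smulW a ha x hx) _ (h.smulW b hb y hy)

lemma SepC.mixc {W V : Set (Fin 2 → ℝ)} (h : SepC W V) {x y : Fin 2 → ℝ} (hx : x ∈ W) (hy : y ∈ V)
    {a b : ℝ} (ha : 0 ≤ a) (hb : 0 < b) : a • x + b • y ∈ W ∪ V := by
  rcases ha.eq_or_lt with rfl | ha
  · right; simpa using h.smulV b hb y hy
  · exact h.mix _ (h.smulW a ha x hx) _ (h.smulV b hb y hy)

lemma Op_split {W V : Set (Fin 2 → ℝ)} (h : SepC W V) {u v : Fin 2 → ℝ} (hu : u ∈ W) (hv : v ∈ V)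
    (j : ℕ) (hj : (j : ℝ) • u + v ∈ V) (hj1 : (j : ℝ) • u + v + u ∈ W) :
    Op u v ∩ W = Op u ((j : ℝ) • u + v) \ (Op ((j : ℝ) • u + v) ((j : ℝ) • u + v + u) ∩ V) := by
  ext x
  constructor
  · rintro ⟨⟨p, q, hp, hq, rfl⟩, hxW⟩
    refine ⟨?_, fun hx => h.dis _ hxW hx.2⟩
    by_cases hc : (j : ℝ) * q < p
    · exact ⟨p - j * q, q, by linarith, hq, by module⟩
    · exfalso
      push Not at hc
      have hj0 : (0 : ℝ) < j := by
        by_contra h0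
        have : (j : ℝ) = 0 := le_antisymm (not_lt.1 h0) (Nat.cast_nonneg j)
        rw [this] at hc; linarith
      have h1 : p • u + q • v = (q - p / j) • v + (p / j) • ((j : ℝ) • u + v) := by
        have : (p / j) * (j : ℝ) = p := by field_simp
        rw [smul_add, smul_smul, this]; module
      rw [h1] at hxW
      refine h.dis _ hxW (h.symm.comb hv hj ?_ (by positivity))
      rw [sub_nonneg, div_le_iff₀ hj0]; linarith
  · rintro ⟨⟨p, q, hp, hq, rfl⟩, hx⟩
    refine ⟨⟨p + q * j, q, by positivity, hq, by module⟩, ?_⟩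
    by_cases hc : q ≤ p
    · have h1 : p • u + q • ((j : ℝ) • u + v) = (p - q) • u + q • ((j : ℝ) • u + v + u) := by module
      rw [h1]
      exact h.comb hu hj1 (by linarith) hq
    · push Not at hc
      have h1 : p • u + q • ((j : ℝ) • u + v) =
        (q - p) • ((j : ℝ) • u + v) + p • ((j : ℝ) • u + v + u) := by module
      have h2 : p • u + q • ((j : ℝ) • u + v) ∈ V ∪ W := by
        rw [h1]; exact h.symm.mixc hj hj1 (by linarith) hp
      rcases h2 with h2 | h2
      · exact absurd ⟨⟨q - p, p, by linarith, hp, h1⟩, h2⟩ hx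
      · exact h2

lemma Op_sub {u v : Fin 2 → ℝ} (j : ℕ) :
    Op ((j : ℝ) • u + v) ((j : ℝ) • u + v + u) ⊆ Op u ((j : ℝ) • u + v) := by
  rintro x ⟨p, q, hp, hq, rfl⟩
  exact ⟨q, p + q, hq, by positivity, by module⟩

lemma low_add {x y : Fin 2 → ℝ} (hκ : 0 < κ) (hx : κ * ‖x‖ ≤ α x) (hy : κ * ‖y‖ ≤ α y) {a : ℝ}
    (ha : 0 ≤ a) : κ * ‖a • x + y‖ ≤ α (a • x + y) := by
  have h1 : ‖a • x + y‖ ≤ a * ‖x‖ + ‖y‖ := by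
    refine (norm_add_le _ _).trans ?_
    rw [norm_smul, norm_of_nonneg ha]
  rw [map_add, map_smul, smul_eq_mul]
  nlinarith

lemma ic_ju (j : ℕ) (u v : Fin 2 → ℤ) : ic ((j : ℤ) • u + v) = (j : ℝ) • ic u + ic v := by
  ext i; simp [ic]

lemma ic_ju1 (j : ℕ) (u v : Fin 2 → ℤ) :
    ic ((j : ℤ) • u + v + u) = (j : ℝ) • ic u + ic v + ic u := by
  ext i; simp [ic]

lemma UP.step1 {u v : Fin 2 → ℤ} (h : UP α κ u v) (j : ℕ) : UP α κ u ((j : ℤ) • u + v) where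
  pos := h.pos
  det := by
    have : idet u ((j : ℤ) • u + v) = idet u v := by simp [idet]; ring
    rw [this]; exact h.det
  hu := h.hu
  hv := by rw [ic_ju]; exact low_add h.pos h.hu h.hv (Nat.cast_nonneg j)

lemma UP.step2 {u v : Fin 2 → ℤ} (h : UP α κ u v) (j : ℕ) :
    UP α κ ((j : ℤ) • u + v) ((j : ℤ) • u + v + u) where
  pos := h.pos
  det := by
    have : idet ((j : ℤ) • u + v) ((j : ℤ) • u + v + u) = idet v u := by simp [idet]; ring
    rw [this]; exact h.symm.det
  hu := (h.step1 j).hv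
  hv := by
    have := low_add h.pos (h.step1 j).hv h.hu (a := 1) zero_le_one
    rw [one_smul] at this
    rw [ic_ju1]; rwa [ic_ju] at this

lemma Op_empty {W V : Set (Fin 2 → ℝ)} (h : SepC W V) {u v : Fin 2 → ℝ} (hv : v ∈ V)
    (hj : ∀ j : ℕ, ((j + 1 : ℕ) : ℝ) • u + v ∈ V) : Op u v ∩ W = ∅ := by
  rw [Set.eq_empty_iff_forall_notMem]
  rintro x ⟨⟨p, q, hp, hq, rfl⟩, hW⟩
  obtain ⟨J, hJ⟩ := exists_nat_gt (p / q)
  have hJ1 : (0 : ℝ) < ((J + 1 : ℕ) : ℝ) := by positivity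
  have h1 : p • u + q • v = (q - p / ((J + 1 : ℕ) : ℝ)) • v +
      (p / ((J + 1 : ℕ) : ℝ)) • (((J + 1 : ℕ) : ℝ) • u + v) := by
    have : (p / ((J + 1 : ℕ) : ℝ)) * ((J + 1 : ℕ) : ℝ) = p := by field_simp
    rw [smul_add, smul_smul, this]; module
  rw [h1] at hW
  refine h.dis _ hW (h.symm.comb hv (hj J) ?_ (by positivity))
  rw [sub_nonneg, div_le_iff₀ hJ1]
  rw [div_lt_iff₀ hq] at hJ
  push_cast; nlinarith

lemma W_ind (w : (Fin 2 → ℝ) →L[ℝ] ℝ) {β s : ℝ} (hβ : 0 < β) (hs : 0 < s) (N : ℕ) :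
    ∀ (W V : Set (Fin 2 → ℝ)), SepC W V → ∀ u v : Fin 2 → ℤ, UP α κ u v → ic u ∈ W → ic v ∈ V →
      s - N * κ ≤ α (ic u) + α (ic v) →
      |err (Op (ic u) (ic v) ∩ W) α w β| ≤ 2 * (Kc α w κ / β ^ 2) / α (ic u) +
        6 * (Kc α w κ / β ^ 2) / α (ic v) + 2 * (Cc w κ / β ^ 3) / (κ * s) := by
  induction N with
  | zero =>
    intro W V h u v hUP hu hv hN
    have hκ := hUP.pos
    have hA := hUP.A_ge
    have hB := hUP.symm.A_ge
    have hA0 := hUP.A_pos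
    have hB0 := hUP.symm.A_pos
    have e := err_crude hUP w hβ (Set.inter_subset_left (t := W))
      ((isOpen_Op hUP.ne).measurableSet.inter h.mW)
    refine e.trans ?_
    have hK : 0 ≤ Kc α w κ / β ^ 2 := div_nonneg (Kc_nonneg α w hκ) (by positivity)
    have hC : 0 ≤ Cc w κ / β ^ 3 := div_nonneg (Cc_nonneg w hκ) (by positivity)
    set A := α (ic u)
    set B := α (ic v)
    set K0 := Kc α w κ / β ^ 2
    set C0 := Cc w κ / β ^ 3
    have h1 : 1 / (A * B) ≤ 2 / (κ * s) := by
      rw [div_le_div_iff₀ (by positivity) (by positivity)]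
      simp only [Nat.cast_zero, zero_mul, sub_zero] at hN
      nlinarith [mul_nonneg (sub_nonneg.2 hA) (sub_nonneg.2 hB)]
    have h2 : C0 * (1 / (A * B)) ≤ 2 * C0 / (κ * s) := by
      rw [show 2 * C0 / (κ * s) = C0 * (2 / (κ * s)) by ring]
      exact mul_le_mul_of_nonneg_left h1 hC
    have h3 : 0 ≤ K0 / A := by positivity
    have h4 : 0 ≤ K0 / B := by positivity
    have h5 : K0 * (1 / A + 1 / B) = K0 / A + K0 / B := by ring
    have h6 : 2 * K0 / A = 2 * (K0 / A) := by ring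
    have h7 : 6 * K0 / B = 6 * (K0 / B) := by ring
    rw [h5, h6, h7]; linarith
  | succ N ih =>
    intro W V h u v hUP hu hv hN
    have hκ := hUP.pos
    have hA := hUP.A_ge
    have hB := hUP.symm.A_ge
    have hA0 := hUP.A_pos
    have hB0 := hUP.symm.A_pos
    have hK : 0 ≤ Kc α w κ / β ^ 2 := div_nonneg (Kc_nonneg α w hκ) (by positivity)
    have hC : 0 ≤ Cc w κ / β ^ 3 := div_nonneg (Cc_nonneg w hκ) (by positivity)
    have hmem : ∀ j : ℕ, ((j + 1 : ℕ) : ℝ) • ic u + ic v ∈ W ∪ V := by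
      intro j
      have := h.mixc hu hv (a := ((j + 1 : ℕ) : ℝ)) (b := 1) (by positivity) one_pos
      rwa [one_smul] at this
    by_cases hex : ∃ j : ℕ, ((j + 1 : ℕ) : ℝ) • ic u + ic v ∈ W
    · classical
      set j := Nat.find hex with hjdef
      have hjW : ((j + 1 : ℕ) : ℝ) • ic u + ic v ∈ W := Nat.find_spec hex
      have hjV : (j : ℝ) • ic u + ic v ∈ V := by
        rcases Nat.eq_zero_or_pos j with h0 | h0
        · rw [h0]; simpa using hv
        · have hm := Nat.find_min hex (m := j - 1) (by omega)
          have := hmem (j - 1)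
          rw [show j - 1 + 1 = j by omega] at this hm
          exact this.resolve_left hm
      have hjW' : (j : ℝ) • ic u + ic v + ic u ∈ W := by
        convert! hjW using 1; push_cast; module
      have hsp := Op_split h hu hv j hjV hjW'
      have U1 := hUP.step1 j
      have U2 := hUP.step2 j
      have hA'v : α (ic ((j : ℤ) • u + v)) = j * α (ic u) + α (ic v) := by
        rw [ic_ju, map_add, map_smul, smul_eq_mul]
      have hB'v : α (ic ((j : ℤ) • u + v + u)) = j * α (ic u) + α (ic v) + α (ic u) := by
        rw [ic_ju1, map_add, map_add, map_smul, smul_eq_mul]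
      have hjA : 0 ≤ (j : ℝ) * α (ic u) := by positivity
      have e1 := err_Op' U1 w hβ
      have e2 := ih V W h.symm _ _ U2 (by rwa [ic_ju]) (by rwa [ic_ju1]) (by
        rw [hA'v, hB'v]; push_cast at hN; linarith)
      have m1 : MeasurableSet (Op (ic u) (ic ((j : ℤ) • u + v))) :=
        (isOpen_Op U1.ne).measurableSet
      have m2 : MeasurableSet (Op (ic ((j : ℤ) • u + v)) (ic ((j : ℤ) • u + v + u)) ∩ V) :=
        (isOpen_Op U2.ne).measurableSet.inter h.mV
      rw [← ic_ju1, ← ic_ju] at hsp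
      have hsub : Op (ic ((j : ℤ) • u + v)) (ic ((j : ℤ) • u + v + u)) ∩ V ⊆
          Op (ic u) (ic ((j : ℤ) • u + v)) := by
        rw [ic_ju, ic_ju1]
        exact Set.inter_subset_left.trans (Op_sub j)
      rw [hsp, err_diff hκ U1.gcone.low hsub m1 m2 w hβ]
      rw [hA'v] at e1 e2
      rw [hB'v] at e2
      refine (abs_sub _ _).trans ((add_le_add e1 e2).trans ?_)
      set A := α (ic u)
      set B := α (ic v)
      set K0 := Kc α w κ / β ^ 2
      set C0 := Cc w κ / β ^ 3
      have i1 : 1 / (j * A + B) ≤ 1 / B := one_div_le_one_div_of_le hB0 (by linarith)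
      have i2 : 1 / (j * A + B + A) ≤ 1 / (A + B) := one_div_le_one_div_of_le (by linarith) (by linarith)
      have i3 : 6 * (1 / (A + B)) ≤ 1 / A + 3 * (1 / B) := by
        rw [mul_one_div, mul_one_div, div_add_div _ _ hA0.ne' hB0.ne',
          div_le_div_iff₀ (by positivity) (by positivity)]
        nlinarith [sq_nonneg (A - B), sq_nonneg A]
      have i4 : 1 / A + 3 * (1 / (j * A + B)) + 6 * (1 / (j * A + B + A)) ≤
          2 * (1 / A) + 6 * (1 / B) := by linarith
      have i5 := mul_le_mul_of_nonneg_left i4 hK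
      calc _ = K0 * (1 / A + 3 * (1 / (j * A + B)) + 6 * (1 / (j * A + B + A))) +
              2 * C0 / (κ * s) := by ring
        _ ≤ K0 * (2 * (1 / A) + 6 * (1 / B)) + 2 * C0 / (κ * s) := by linarith
        _ = _ := by ring
    · push Not at hex
      rw [Op_empty h hv (fun j => (hmem j).resolve_left (hex j)), err_empty, abs_zero]
      positivity

lemma W_bound (w : (Fin 2 → ℝ) →L[ℝ] ℝ) {β : ℝ} (hβ : 0 < β)
    {W V : Set (Fin 2 → ℝ)} (h : SepC W V) {u v : Fin 2 → ℤ} (hUP : UP α κ u v) (hu : ic u ∈ W)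
    (hv : ic v ∈ V) :
    |err (Op (ic u) (ic v) ∩ W) α w β| ≤ 2 * (Kc α w κ / β ^ 2) / α (ic u) +
        6 * (Kc α w κ / β ^ 2) / α (ic v) := by
  have hκ := hUP.pos
  have key : ∀ s : ℝ, 0 < s → |err (Op (ic u) (ic v) ∩ W) α w β| ≤
      2 * (Kc α w κ / β ^ 2) / α (ic u) +
        6 * (Kc α w κ / β ^ 2) / α (ic v) + 2 * (Cc w κ / β ^ 3) / (κ * s) := by
    intro s hs
    obtain ⟨N, hN⟩ := exists_nat_gt (s / κ)
    refine W_ind w hβ hs N W V h u v hUP hu hv ?_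
    rw [div_lt_iff₀ hκ] at hN
    have := hUP.A_pos
    have := hUP.symm.A_pos
    linarith
  have hlim : Tendsto (fun s : ℝ => 2 * (Kc α w κ / β ^ 2) / α (ic u) +
        6 * (Kc α w κ / β ^ 2) / α (ic v) + 2 * (Cc w κ / β ^ 3) / (κ * s)) atTop
      (𝓝 (2 * (Kc α w κ / β ^ 2) / α (ic u) + 6 * (Kc α w κ / β ^ 2) / α (ic v) + 0)) := by
    refine tendsto_const_nhds.add (Tendsto.div_atTop tendsto_const_nhds ?_)
    exact tendsto_id.const_mul_atTop hκ
  rw [add_zero] at hlim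
  refine ge_of_tendsto hlim ?_
  filter_upwards [eventually_gt_atTop 0] with s hs using key s hs

lemma Op_comm (u v : Fin 2 → ℝ) : Op u v = Op v u := by
  ext x
  constructor <;>
  · rintro ⟨p, q, hp, hq, rfl⟩
    exact ⟨q, p, hq, hp, by module⟩

lemma uni_bound (w : (Fin 2 → ℝ) →L[ℝ] ℝ)
    {W V : Set (Fin 2 → ℝ)} (h : SepC W V) {u v : Fin 2 → ℤ} (hUP : UP α κ u v)
    (hu : ic u ∈ W ∪ V) (hv : ic v ∈ W ∪ V) :
    ∃ K, ∀ β : ℝ, 0 < β → |err (Op (ic u) (ic v) ∩ W) α w β| ≤ K / β ^ 2 := by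
  have hκ := hUP.pos
  rcases hu with hu | hu <;> rcases hv with hv | hv
  · refine ⟨Kc α w κ * (1 / α (ic u) + 1 / α (ic v)), fun β hβ => ?_⟩
    have : Op (ic u) (ic v) ∩ W = Op (ic u) (ic v) := by
      rw [Set.inter_eq_left]
      rintro x ⟨p, q, hp, hq, rfl⟩
      exact h.comb hu hv hp.le hq
    rw [this]
    refine (err_Op' hUP w hβ).trans (le_of_eq (by ring))
  · refine ⟨2 * Kc α w κ / α (ic u) + 6 * Kc α w κ / α (ic v), fun β hβ => ?_⟩
    refine (W_bound w hβ h hUP hu hv).trans (le_of_eq (by ring))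
  · refine ⟨2 * Kc α w κ / α (ic v) + 6 * Kc α w κ / α (ic u), fun β hβ => ?_⟩
    rw [Op_comm]
    refine (W_bound w hβ h hUP.symm hv hu).trans (le_of_eq (by ring))
  · refine ⟨0, fun β hβ => ?_⟩
    have : Op (ic u) (ic v) ∩ W = ∅ := by
      rw [Set.eq_empty_iff_forall_notMem]
      rintro x ⟨⟨p, q, hp, hq, rfl⟩, hW⟩
      exact h.dis _ hW (h.symm.comb hu hv hp.le hq)
    rw [this, err_empty]; simp

end TwoC


section TwoD
variable {α : (Fin 2 → ℝ) →L[ℝ] ℝ} {κ : ℝ}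

lemma prim_of_idet {z t : Fin 2 → ℤ} (h : idet z t = 1 ∨ idet z t = -1) : IsPrimitiveVec z := by
  have hz : z ≠ 0 := by
    rintro rfl; simp [idet] at h
  rw [← vgcd_eq_one hz]
  have h1 := (dvd_vgcd (m := vgcd z) (v := z)).1 dvd_rfl
  have h2 : (vgcd z : ℤ) ∣ idet z t :=
    dvd_sub (Dvd.dvd.mul_right (h1 0) _) (Dvd.dvd.mul_right (h1 1) _)
  have h3 : (vgcd z : ℤ) ∣ 1 := by
    rcases h with h | h <;> rw [h] at h2
    · exact h2
    · exact (dvd_neg.1 h2)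
  have := Int.natCast_dvd_natCast.1 (by simpa using h3 : (vgcd z : ℤ) ∣ ((1 : ℕ) : ℤ))
  exact Nat.dvd_one.1 this

lemma prim_bezout {u : Fin 2 → ℤ} (hu : IsPrimitiveVec u) : ∃ t, idet u t = 1 := by
  have h1 : Int.gcd (u 0) (u 1) ∣ vgcd u := by
    rw [dvd_vgcd]
    intro i
    fin_cases i
    · exact Int.gcd_dvd_left ..
    · exact Int.gcd_dvd_right ..
  rw [(vgcd_eq_one hu.1).2 hu, Nat.dvd_one] at h1
  have h2 := Int.gcd_eq_gcd_ab (u 0) (u 1)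
  rw [h1] at h2
  refine ⟨![-(Int.gcdB (u 0) (u 1)), Int.gcdA (u 0) (u 1)], ?_⟩
  simp only [idet, Matrix.cons_val_zero, Matrix.cons_val_one]
  push_cast at h2
  linarith

lemma idet_zero {u v : Fin 2 → ℤ} (hu : IsPrimitiveVec u) (h : idet u v = 0) :
    ∃ c : ℤ, v = c • u := by
  obtain ⟨t, ht⟩ := prim_bezout hu
  refine ⟨idet v t, ?_⟩
  have : idet u t • v = idet v t • u + idet u v • t := by
    ext i; fin_cases i <;> simp [idet] <;> ring
  rw [ht, h] at this
  simpa using this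

/-- the open ray -/
def Ray (α : (Fin 2 → ℝ) →L[ℝ] ℝ) (z : Fin 2 → ℝ) : Set (Fin 2 → ℝ) :=
  {x | det2 z x = 0 ∧ 0 < α x}

lemma mem_Ray {z x : Fin 2 → ℝ} (hz : 0 < α z) :
    x ∈ Ray α z ↔ ∃ c : ℝ, 0 < c ∧ x = c • z := by
  constructor
  · rintro ⟨h1, h2⟩
    have hx : ∃ c : ℝ, x = c • z := by
      have hz0 : z ≠ 0 := by rintro rfl; simp at hz
      have : z 0 ≠ 0 ∨ z 1 ≠ 0 := by
        by_contra hcon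
        push Not at hcon
        apply hz0; ext i; fin_cases i
        · exact hcon.1
        · exact hcon.2
      unfold det2 at h1
      rcases this with h0 | h0
      · refine ⟨x 0 / z 0, ?_⟩
        ext i; fin_cases i
        · simp [h0]
        · simp; field_simp; linarith
      · refine ⟨x 1 / z 1, ?_⟩
        ext i; fin_cases i
        · simp; field_simp; linarith
        · simp [h0]
    obtain ⟨c, rfl⟩ := hx
    refine ⟨c, ?_, rfl⟩
    rw [map_smul, smul_eq_mul] at h2
    exact pos_of_mul_pos_left h2 hz.le
  · rintro ⟨c, hc, rfl⟩
    refine ⟨by simp [det2]; ring, ?_⟩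
    rw [map_smul, smul_eq_mul]; positivity

lemma meas_Ray (z : Fin 2 → ℝ) : MeasurableSet (Ray α z) :=
  (isClosed_eq (continuous_det2_right z) continuous_const).measurableSet.inter
    (isOpen_lt continuous_const α.continuous).measurableSet

lemma Ray_null {z : Fin 2 → ℝ} (hz : 0 < α z) : volume (Ray α z) = 0 := by
  let L : (Fin 2 → ℝ) →ₗ[ℝ] ℝ :=
    { toFun := fun x => det2 z x
      map_add' := by intro x y; simp [det2]; ring
      map_smul' := by intro c x; simp [det2]; ring }
  have h1 : LinearMap.ker L ≠ ⊤ := by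
    intro h
    rw [LinearMap.ker_eq_top] at h
    have h2 : L ![0, 1] = 0 := by rw [h]; rfl
    have h3 : L ![1, 0] = 0 := by rw [h]; rfl
    have h2' : z 0 = 0 := by simpa [L, det2] using h2
    have h3' : z 1 = 0 := by simpa [L, det2] using h3
    have : z = 0 := by
      ext i; fin_cases i
      · exact h2'
      · exact h3'
    rw [this] at hz; simp at hz
  refine measure_mono_null ?_ (Measure.addHaar_submodule volume (LinearMap.ker L) h1)
  intro x hx
  exact hx.1

lemma Ray_low {z : Fin 2 → ℝ} (hz0 : 0 < α z) (hz : κ * ‖z‖ ≤ α z) :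
    ∀ x ∈ Ray α z, κ * ‖x‖ ≤ α x := by
  intro x hx
  obtain ⟨c, hc, rfl⟩ := (mem_Ray hz0).1 hx
  rw [map_smul, smul_eq_mul, norm_smul, norm_of_nonneg hc.le]
  nlinarith

lemma ray_bound (w : (Fin 2 → ℝ) →L[ℝ] ℝ) {z : Fin 2 → ℤ} (hp : IsPrimitiveVec z)
    (hz : 0 < α (ic z)) {T : Set (Fin 2 → ℝ)} (hT : T ⊆ Ray α (ic z)) :
    ∃ K, ∀ β : ℝ, 0 < β → |err T α w β| ≤ K / β ^ 2 := by
  classical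
  refine ⟨|w (ic z)| * (2 / α (ic z) ^ 2), fun β hβ => ?_⟩
  have hI : Is T α w = 0 := by
    unfold Is
    exact setIntegral_measure_zero _ (measure_mono_null hT (Ray_null hz))
  unfold err
  rw [hI, zero_div, mul_zero, sub_zero]
  have hG : Gs T α w β = T.indicator (fun x => w x * Qf (β * α x)) (ic z) := by
    unfold Gs
    rw [tsum_eq_single z]
    · rw [if_pos hp]
    · intro v hv
      by_cases hvp : IsPrimitiveVec v
      · rw [if_pos hvp, Set.indicator_of_notMem]
        intro hvT
        apply hv
        have h1 := hT hvT
        have h2 : idet z v = 0 := by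
          have := h1.1
          rw [det2_ic] at this; exact_mod_cast this
        have h3 : idet v z = 0 := by
          have : idet v z = - idet z v := by simp [idet]; ring
          rw [this, h2]; rfl
        obtain ⟨m, hm⟩ := idet_zero hp h2
        obtain ⟨m', hm'⟩ := idet_zero hvp h3
        have h4 : ic v = (m : ℝ) • ic z := by
          rw [hm]; ext i; simp [ic]
        have h5 := h1.2
        rw [h4, map_smul, smul_eq_mul] at h5
        have h6 : (0 : ℝ) < m := pos_of_mul_pos_left h5 hz.le
        have h7 : 0 < m := by exact_mod_cast h6
        have h8 : (m' * m - 1) • z = 0 := by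
          rw [sub_smul, one_smul, mul_smul, ← hm, ← hm', sub_self]
        have h9 : m' * m = 1 := by
          have := (smul_eq_zero.1 h8).resolve_right hp.1
          linarith
        have h10 : m = 1 := by
          rcases Int.eq_one_or_neg_one_of_mul_eq_one' h9 with h | h
          · exact h.2
          · omega
        rw [hm, h10, one_smul]
      · rw [if_neg hvp]
  rw [hG]
  by_cases hzT : ic z ∈ T
  · rw [Set.indicator_of_mem hzT, abs_mul, mul_div_assoc]
    refine mul_le_mul_of_nonneg_left ?_ (abs_nonneg _)
    have hp : 0 < β * α (ic z) := by positivity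
    rw [abs_of_nonneg (Qf_nonneg hp)]
    refine (Qf_le_sq hp).trans (le_of_eq ?_)
    field_simp
  · rw [Set.indicator_of_notMem hzT, abs_zero]; positivity

lemma Op_three {u z y : Fin 2 → ℝ} {D k : ℝ} (hD : 0 < D) (hk : 0 < k)
    (hy : y = D • z - k • u) (hz : 0 < α z) :
    Op u y = Op u z ∪ (Ray α z ∪ Op z y) := by
  subst hy
  ext x
  constructor
  · rintro ⟨p, q, hp, hq, rfl⟩
    rcases lt_trichotomy p (q * k) with h | h | h
    · right; right
      refine ⟨p * D / k, q - p / k, by positivity, ?_, ?_⟩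
      · rw [sub_pos, div_lt_iff₀ hk]; exact h
      · ext i; simp; field_simp; ring
    · right; left
      rw [mem_Ray hz]
      exact ⟨q * D, by positivity, by rw [h]; module⟩
    · left
      exact ⟨p - q * k, q * D, by linarith, by positivity, by module⟩
  · rintro (⟨p, q, hp, hq, rfl⟩ | h | ⟨p, q, hp, hq, rfl⟩)
    · refine ⟨p + q * k / D, q / D, by positivity, by positivity, ?_⟩
      ext i; simp; field_simp; ring
    · obtain ⟨c, hc, rfl⟩ := (mem_Ray hz).1 h
      refine ⟨c * k / D, c / D, by positivity, by positivity, ?_⟩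
      ext i; simp; field_simp; ring
    · refine ⟨p * k / D, q + p / D, by positivity, by positivity, ?_⟩
      ext i; simp; field_simp; ring

lemma SepC.unionc {W V : Set (Fin 2 → ℝ)} (h : SepC W V) {x y : Fin 2 → ℝ} (hx : x ∈ W ∪ V)
    (hy : y ∈ W ∪ V) {a b : ℝ} (ha : 0 ≤ a) (hb : 0 < b) : a • x + b • y ∈ W ∪ V := by
  rcases hx with hx | hx <;> rcases hy with hy | hy
  · exact Or.inl (h.comb hx hy ha hb)
  · exact h.mixc hx hy ha hb
  · rw [Set.union_comm]; exact h.symm.mixc hx hy ha hb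
  · exact Or.inr (h.symm.comb hx hy ha hb)

lemma det2_Oz (u z y : Fin 2 → ℝ) (D k : ℝ) (hy : y = D • z - k • u) :
    det2 u y = D * det2 u z ∧ det2 z y = k * det2 u z := by
  subst hy; constructor <;> simp [det2] <;> ring

lemma disj_three {u z y : Fin 2 → ℝ} {D k : ℝ} (hD : 0 < D) (hk : 0 < k)
    (hy : y = D • z - k • u) (hd : det2 u z ≠ 0) :
    Disjoint (Op u z) (Ray α z ∪ Op z y) ∧ Disjoint (Ray α z) (Op z y) := by
  have h1 : ∀ x ∈ Op u z, 0 < det2 u z * det2 x z := fun x hx => ((mem_Op hd).1 hx).1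
  have hd2 : det2 z y ≠ 0 := by
    rw [(det2_Oz u z y D k hy).2]; positivity
  have h2 : ∀ x ∈ Op z y, 0 < k * (det2 u z * det2 z x) := by
    intro x hx
    have := ((mem_Op hd2).1 hx).2
    rw [(det2_Oz u z y D k hy).2] at this; linarith
  have h3 : ∀ x, det2 x z = - det2 z x := by intro x; simp [det2]; ring
  constructor
  · rw [Set.disjoint_left]
    rintro x hx (hx' | hx')
    · have := h1 x hx
      rw [h3 x, hx'.1] at this; simp at this
    · have := h1 x hx
      have h4 := pos_of_mul_pos_right (h2 x hx') hk.le
      rw [h3 x] at this; linarith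
  · rw [Set.disjoint_left]
    intro x hx hx'
    have h4 := h2 x hx'
    rw [hx.1] at h4; simp at h4

lemma rat_bound (w : (Fin 2 → ℝ) →L[ℝ] ℝ) {W V : Set (Fin 2 → ℝ)} (h : SepC W V) (hκ : 0 < κ)
    (D : ℕ) : ∀ u y : Fin 2 → ℤ, IsPrimitiveVec u → 0 < D → (idet u y = D ∨ idet u y = -D) →
      ic u ∈ W ∪ V → ic y ∈ W ∪ V → κ * ‖ic u‖ ≤ α (ic u) → κ * ‖ic y‖ ≤ α (ic y) →
      ∃ K, ∀ β : ℝ, 0 < β → |err (Op (ic u) (ic y) ∩ W) α w β| ≤ K / β ^ 2 := by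
  induction D using Nat.strong_induction_on with
  | _ D ih =>
  intro u y hup hD hdet hu hy lu ly
  obtain ⟨ε, hε, hdet'⟩ : ∃ ε : ℤ, (ε = 1 ∨ ε = -1) ∧ idet u y = ε * D := by
    rcases hdet with h | h
    · exact ⟨1, Or.inl rfl, by rw [h]; ring⟩
    · exact ⟨-1, Or.inr rfl, by rw [h]; ring⟩
  obtain ⟨t, ht⟩ := prim_bezout hup
  obtain ⟨c, hc⟩ := idet_zero (v := y - (D * ε : ℤ) • t) hup (by
    have : idet u (y - (D * ε : ℤ) • t) = idet u y - D * ε * idet u t := by simp [idet]; ring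
    rw [this, ht, hdet']; ring)
  have hDz : (0 : ℤ) < D := by exact_mod_cast hD
  obtain ⟨k, hk⟩ := Int.eq_ofNat_of_zero_le (Int.emod_nonneg (-c) hDz.ne')
  have hkD : (k : ℤ) < D := by rw [← hk]; exact Int.emod_lt_of_pos _ hDz
  have hm := Int.emod_add_mul_ediv (-c) D
  rw [hk] at hm
  set m : ℤ := -((-c) / D) with hmdef
  have hm' : c + k = D * m := by rw [hmdef]; linarith
  set z : Fin 2 → ℤ := ε • t + m • u with hzdef
  have hyz : y = (D : ℤ) • z - (k : ℤ) • u := by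
    have h1 : y = (D * ε : ℤ) • t + c • u := by rw [← hc]; abel
    have h2 : c = D * m - k := by linarith
    rw [h1, h2, hzdef]; module
  have hyz' : ic y = (D : ℝ) • ic z - (k : ℝ) • ic u := by
    rw [hyz]; ext i; simp [ic]
  have hDr : (0 : ℝ) < D := by exact_mod_cast hD
  have hzu : ic z = ((k : ℝ) / D) • ic u + ((1 : ℝ) / D) • ic y := by
    rw [hyz']; ext i; simp; field_simp; ring
  have hzmem : ic z ∈ W ∪ V := by
    rw [hzu]; exact h.unionc hu hy (by positivity) (by positivity)
  have lz : κ * ‖ic z‖ ≤ α (ic z) := by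
    have ly' : κ * ‖((1 : ℝ) / D) • ic y‖ ≤ α (((1 : ℝ) / D) • ic y) := by
      rw [map_smul, smul_eq_mul, norm_smul, norm_of_nonneg (by positivity : (0 : ℝ) ≤ 1 / D)]
      have : (0 : ℝ) < 1 / D := by positivity
      nlinarith
    rw [hzu]
    exact low_add hκ lu ly' (by positivity)
  have huz : idet u z = ε := by
    have : idet u z = ε * idet u t := by simp [idet, hzdef]; ring
    rw [this, ht, mul_one]
  have hzy : idet z y = k * ε := by
    rw [← huz, hyz]; simp [idet]; ring
  have hUP : UP α κ u z := ⟨hκ, by rw [huz]; exact hε, lu, lz⟩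
  have hz0 : 0 < α (ic z) := hUP.symm.A_pos
  have hzp : IsPrimitiveVec z := prim_of_idet (t := u) hUP.symm.det
  obtain ⟨K1, hK1⟩ := uni_bound w h hUP hu hzmem
  rcases Nat.eq_zero_or_pos k with hk0 | hk0
  · refine ⟨K1, fun β hβ => ?_⟩
    have : Op (ic u) (ic y) = Op (ic u) (ic z) := by
      rw [hyz', hk0]
      ext x
      constructor
      · rintro ⟨p, q, hp, hq, rfl⟩
        exact ⟨p, q * D, hp, by positivity, by simp; module⟩
      · rintro ⟨p, q, hp, hq, rfl⟩
        refine ⟨p, q / D, hp, by positivity, ?_⟩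
        ext i; simp; field_simp
    rw [this]; exact hK1 β hβ
  · have hkr : (0 : ℝ) < k := by exact_mod_cast hk0
    have hset := Op_three hDr hkr hyz' hz0
    obtain ⟨hd1, hd2⟩ := disj_three (α := α) hDr hkr hyz' hUP.ne
    obtain ⟨K2, hK2⟩ := ray_bound w hzp hz0 (Set.inter_subset_left (s := Ray α (ic z)) (t := W))
    obtain ⟨K3, hK3⟩ := ih k (by omega) z y hzp hk0 (by
      rcases hε with rfl | rfl
      · left; rw [hzy]; ring
      · right; rw [hzy]; ring) hzmem hy lz ly
    refine ⟨K1 + (K2 + K3), fun β hβ => ?_⟩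
    have hne : det2 (ic z) (ic y) ≠ 0 := by
      rw [(det2_Oz _ _ _ _ _ hyz').2]; exact mul_ne_zero hkr.ne' hUP.ne
    have low1 := hUP.gcone.low
    have low2 := Ray_low hz0 lz
    have low3 := (gcone_Op hκ hne lz ly).low
    have m1 := (isOpen_Op hUP.ne).measurableSet.inter h.mW
    have m2 := (meas_Ray (α := α) (ic z)).inter h.mW
    have m3 := (isOpen_Op hne).measurableSet.inter h.mW
    rw [hset, Set.union_inter_distrib_right, Set.union_inter_distrib_right,
      err_union hκ (fun x hx => low1 x hx.1) (by
        rintro x (hx | hx)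
        · exact low2 x hx.1
        · exact low3 x hx.1) m1 (m2.union m3) ?_ w hβ,
      err_union hκ (fun x hx => low2 x hx.1) (fun x hx => low3 x hx.1) m2 m3 ?_ w hβ]
    · have e1 := hK1 β hβ
      have e2 := hK2 β hβ
      have e3 := hK3 β hβ
      rw [add_div, add_div]
      exact (abs_add_le _ _).trans (add_le_add e1 ((abs_add_le _ _).trans (add_le_add e2 e3)))
    · exact hd2.mono Set.inter_subset_left Set.inter_subset_left
    · rw [← Set.union_inter_distrib_right]
      exact hd1.mono Set.inter_subset_left Set.inter_subset_left

end TwoD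


section TwoE
variable {α : (Fin 2 → ℝ) →L[ℝ] ℝ} {κ : ℝ}

lemma det2_zero_imp {z x : Fin 2 → ℝ} (hz0 : z ≠ 0) (h1 : det2 z x = 0) : ∃ c : ℝ, x = c • z := by
  have : z 0 ≠ 0 ∨ z 1 ≠ 0 := by
    by_contra hcon
    push Not at hcon
    apply hz0; ext i; fin_cases i
    · exact hcon.1
    · exact hcon.2
  unfold det2 at h1
  rcases this with h0 | h0
  · refine ⟨x 0 / z 0, ?_⟩
    ext i; fin_cases i
    · simp [h0]
    · simp; field_simp; linarith
  · refine ⟨x 1 / z 1, ?_⟩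
    ext i; fin_cases i
    · simp; field_simp; linarith
    · simp [h0]

lemma abs_det2_le (x y : Fin 2 → ℝ) : |det2 x y| ≤ 2 * ‖x‖ * ‖y‖ := by
  have a0 := norm_le_pi_norm x 0
  have a1 := norm_le_pi_norm x 1
  have b0 := norm_le_pi_norm y 0
  have b1 := norm_le_pi_norm y 1
  unfold det2
  refine (abs_sub _ _).trans ?_
  rw [abs_mul, abs_mul]
  simp only [Real.norm_eq_abs] at *
  have := mul_le_mul a0 b1 (abs_nonneg _) (norm_nonneg _)
  have := mul_le_mul a1 b0 (abs_nonneg _) (norm_nonneg _)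
  linarith

lemma det2_add (z x y : Fin 2 → ℝ) : det2 z (x + y) = det2 z x + det2 z y := by
  simp [det2]; ring

lemma det2_smul (z x : Fin 2 → ℝ) (c : ℝ) : det2 z (c • x) = c * det2 z x := by
  simp [det2]; ring

lemma sepC_half {S : Set (Fin 2 → ℝ)} (h : GCone S α κ) {u : Fin 2 → ℝ} (hu : u ∈ S)
    (hA : 0 < α u) (ε : ℝ) :
    SepC (S ∩ ({x | 0 < ε * det2 u x} ∪ Ray α u)) (({x | 0 < ε * det2 u x} ∪ Ray α u) \ S) := by
  have hu0 : u ≠ 0 := by rintro rfl; simp at hA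
  have mH : MeasurableSet ({x | 0 < ε * det2 u x} ∪ Ray α u) :=
    (isOpen_lt continuous_const (continuous_const.mul
      (continuous_det2_right u))).measurableSet.union (meas_Ray u)
  have rayS : Ray α u ⊆ S := by
    intro x hx
    obtain ⟨c, hc, rfl⟩ := (mem_Ray hA).1 hx
    exact h.smul c hc u hu
  have addH : ∀ x ∈ ({x | 0 < ε * det2 u x} ∪ Ray α u), ∀ y ∈ ({x | 0 < ε * det2 u x} ∪ Ray α u),
      x + y ∈ ({x | 0 < ε * det2 u x} ∪ Ray α u) := by
    rintro x (hx | hx) y (hy | hy)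
    · left; simp only [Set.mem_setOf_eq] at *; rw [det2_add]; linarith
    · left; simp only [Set.mem_setOf_eq] at *; rw [det2_add, hy.1]; linarith
    · left; simp only [Set.mem_setOf_eq] at *; rw [det2_add, hx.1]; linarith
    · right; exact ⟨by rw [det2_add, hx.1, hy.1, add_zero], by
        have := hx.2; have := hy.2; rw [map_add]; linarith⟩
  have smulH : ∀ c : ℝ, 0 < c → ∀ x ∈ ({x | 0 < ε * det2 u x} ∪ Ray α u),
      c • x ∈ ({x | 0 < ε * det2 u x} ∪ Ray α u) := by
    rintro c hc x (hx | hx)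
    · left; simp only [Set.mem_setOf_eq] at *; rw [det2_smul]
      have := mul_pos hc hx; linarith
    · right; exact ⟨by rw [det2_smul, hx.1, mul_zero], by
        have := hx.2; rw [map_smul, smul_eq_mul]; positivity⟩
  have comb : ∀ x ∈ S, ∀ y ∈ S, ∀ a b : ℝ, 0 ≤ a → 0 < b → a • x + b • y ∈ S := by
    intro x hx y hy a b ha hb
    rcases ha.eq_or_lt with rfl | ha
    · simpa using h.smul b hb y hy
    · exact h.add _ (h.smul a ha x hx) _ (h.smul b hb y hy)
  refine ⟨h.meas.inter mH, mH.diff h.meas, fun x hx hx' => hx'.2 hx.1, ?_, ?_, ?_, ?_, ?_⟩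
  · exact fun x hx y hy => ⟨h.add x hx.1 y hy.1, addH x hx.2 y hy.2⟩
  · intro x hx y hy
    refine ⟨addH x hx.1 y hy.1, fun hz => ?_⟩
    have dx : 0 < ε * det2 u x := hx.1.resolve_right (fun hr => hx.2 (rayS hr))
    have dy : 0 < ε * det2 u y := hy.1.resolve_right (fun hr => hy.2 (rayS hr))
    set γ := (ε * det2 u x) / (ε * det2 u x + ε * det2 u y) with hγ
    have hs : ε * det2 u x + ε * det2 u y ≠ 0 := by linarith
    have hγ0 : 0 < γ := by positivity
    have hγ1 : 0 < 1 - γ := by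
      have : 1 - γ = (ε * det2 u y) / (ε * det2 u x + ε * det2 u y) := by
        rw [hγ, eq_div_iff hs, sub_mul, div_mul_cancel₀ _ hs]; ring
      rw [this]; positivity
    have hε : ε ≠ 0 := by rintro rfl; simp at dx
    have h0 : det2 u (x + (-γ) • (x + y)) = 0 := by
      rw [det2_add, det2_smul, det2_add]
      have : ε * (det2 u x + -γ * (det2 u x + det2 u y)) = 0 := by
        have : γ * (ε * det2 u x + ε * det2 u y) = ε * det2 u x := by
          rw [hγ, div_mul_cancel₀ _ hs]
        linarith
      exact (mul_eq_zero.1 this).resolve_left hε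
    obtain ⟨a, ha⟩ := det2_zero_imp hu0 h0
    have hxe : x = a • u + γ • (x + y) := by rw [← ha]; module
    have hye : y = (-a) • u + (1 - γ) • (x + y) := by rw [neg_smul, ← ha]; module
    rcases le_total 0 a with h1 | h1
    · exact hx.2 (by rw [hxe]; exact comb u hu _ hz a γ h1 hγ0)
    · exact hy.2 (by rw [hye]; exact comb u hu _ hz (-a) (1 - γ) (by linarith) hγ1)
  · exact fun c hc x hx => ⟨h.smul c hc x hx.1, smulH c hc x hx.2⟩
  · intro c hc x hx
    refine ⟨smulH c hc x hx.1, fun hz => hx.2 ?_⟩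
    have := h.smul c⁻¹ (by positivity) _ hz
    rwa [smul_smul, inv_mul_cancel₀ hc.ne', one_smul] at this
  · intro x hx y hy
    have := addH x hx.2 y hy.1
    by_cases hS : x + y ∈ S
    · exact Or.inl ⟨hS, this⟩
    · exact Or.inr ⟨this, hS⟩

lemma half_bound (w : (Fin 2 → ℝ) →L[ℝ] ℝ) {S : Set (Fin 2 → ℝ)} (h : GCone S α κ)
    {u : Fin 2 → ℤ} (hp : IsPrimitiveVec u) (hu : ic u ∈ S) {ε : ℤ} (hε : ε = 1 ∨ ε = -1) :
    ∃ K, ∀ β : ℝ, 0 < β →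
      |err (S ∩ {x | 0 < (ε : ℝ) * det2 (ic u) x}) α w β| ≤ K / β ^ 2 := by
  have hκ := h.pos
  have hun := one_le_norm_ic hp.1
  have hA : 0 < α (ic u) := by have := h.low _ hu; nlinarith
  set A := α (ic u) with hAdef
  set σ : ℝ := 2 * ‖ic u‖ / κ with hσ
  have hσ0 : 0 < σ := by positivity
  have hdetS : ∀ x ∈ S, |det2 (ic u) x| ≤ σ * α x := by
    intro x hx
    refine (abs_det2_le _ _).trans ?_
    rw [hσ, div_mul_eq_mul_div, le_div_iff₀ hκ]
    have := h.low x hx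
    nlinarith
  obtain ⟨t, ht⟩ := prim_bezout hp
  obtain ⟨q, hq⟩ := exists_nat_gt (σ * A)
  have hqr : (0 : ℝ) < q := lt_of_le_of_lt (by positivity) hq
  have hq0 : 0 < q := by exact_mod_cast hqr
  set τ := α (ic (ε • t)) with hτ
  set p : ℤ := ⌊-(q * τ) / A⌋ + 1 with hpdef
  set y : Fin 2 → ℤ := (q : ℤ) • (ε • t) + p • u with hydef
  have hεsq : (ε : ℝ) * ε = 1 := by rcases hε with rfl | rfl <;> norm_num
  have hdy : idet u y = ε * q := by
    have : idet u y = q * ε * idet u t := by simp [idet, hydef]; ring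
    rw [this, ht]; ring
  have hdyr : det2 (ic u) (ic y) = ε * q := by rw [det2_ic, hdy]; push_cast; rfl
  have hαy : α (ic y) = q * τ + p * A := by
    have : ic y = (q : ℝ) • ic (ε • t) + (p : ℝ) • ic u := by
      rw [hydef]; ext i; simp [ic]
    rw [this, map_add, map_smul, map_smul, smul_eq_mul, smul_eq_mul]
  have hαy0 : 0 < α (ic y) := by
    have := Int.lt_floor_add_one (-(q * τ) / A)
    rw [div_lt_iff₀ hA] at this
    rw [hαy, hpdef]; push_cast; linarith
  have hαy1 : α (ic y) ≤ A := by
    have := Int.floor_le (-(q * τ) / A)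
    rw [le_div_iff₀ hA] at this
    rw [hαy, hpdef]; push_cast; linarith
  have hne : det2 (ic u) (ic y) ≠ 0 := by
    rw [hdyr]; rcases hε with rfl | rfl <;> simp [hqr.ne']
  have hset : Op (ic u) (ic y) ∩ (S ∩ ({x | 0 < (ε : ℝ) * det2 (ic u) x} ∪ Ray α (ic u))) =
      S ∩ {x | 0 < (ε : ℝ) * det2 (ic u) x} := by
    ext x
    constructor
    · rintro ⟨h1, h2, -⟩
      refine ⟨h2, ?_⟩
      have := ((mem_Op hne).1 h1).2
      rw [hdyr] at this
      have h3 : 0 < (q : ℝ) * (ε * det2 (ic u) x) := by linarith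
      exact pos_of_mul_pos_right h3 hqr.le
    · rintro ⟨h1, h2⟩
      refine ⟨(mem_Op hne).2 ⟨?_, ?_⟩, h1, Or.inl h2⟩
      · simp only [Set.mem_setOf_eq] at h2
        have hc := congrArg α (cramer (ic u) (ic y) x)
        rw [map_add, map_smul, map_smul, map_smul, smul_eq_mul, smul_eq_mul, smul_eq_mul] at hc
        have hd := hdetS x h1
        have hd' : ε * det2 (ic u) x ≤ σ * α x := by
          refine le_trans (le_abs_self _) ?_
          rw [abs_mul]
          have : |(ε : ℝ)| = 1 := by rcases hε with rfl | rfl <;> simp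
          rw [this, one_mul]; exact hd
        have hx0 : 0 < α x := by
          have := h2.trans_le hd'
          exact pos_of_mul_pos_right this hσ0.le
        have key : 0 < det2 (ic u) (ic y) * det2 x (ic y) * A := by
          have e1 : det2 (ic u) (ic y) * det2 x (ic y) * A =
              q * (q * α x - (ε * det2 (ic u) x) * α (ic y)) := by
            have : det2 x (ic y) * A = det2 (ic u) (ic y) * α x - det2 (ic u) x * α (ic y) := by
              linarith
            rw [mul_assoc, this, hdyr]
            have : (ε : ℝ) * q * (ε * q * α x - det2 (ic u) x * α (ic y)) =
              q * ((ε * ε) * q * α x - (ε * det2 (ic u) x) * α (ic y)) := by ring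
            rw [this, hεsq, one_mul]
          rw [e1]
          apply mul_pos hqr
          have s1 : (ε * det2 (ic u) x) * α (ic y) ≤ σ * α x * A :=
            mul_le_mul hd' hαy1 hαy0.le (by positivity)
          have s2 : σ * A * α x < q * α x := mul_lt_mul_of_pos_right hq hx0
          linarith
        exact pos_of_mul_pos_left key hA.le
      · simp only [Set.mem_setOf_eq] at h2
        rw [hdyr]
        have := mul_pos hqr h2
        linarith
  set κ' := min κ (α (ic y) / (‖ic y‖ + 1)) with hκ'
  have hκ'0 : 0 < κ' := lt_min hκ (by positivity)
  have lu : κ' * ‖ic u‖ ≤ α (ic u) :=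
    (mul_le_mul_of_nonneg_right (min_le_left _ _) (norm_nonneg _)).trans (h.low _ hu)
  have ly : κ' * ‖ic y‖ ≤ α (ic y) := by
    refine (mul_le_mul_of_nonneg_right (min_le_right _ _) (norm_nonneg _)).trans ?_
    rw [div_mul_eq_mul_div, div_le_iff₀ (by positivity)]
    nlinarith
  have hSep := sepC_half h hu hA (ε : ℝ)
  have hunion : S ∩ ({x | 0 < (ε : ℝ) * det2 (ic u) x} ∪ Ray α (ic u)) ∪
      ({x | 0 < (ε : ℝ) * det2 (ic u) x} ∪ Ray α (ic u)) \ S =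
      {x | 0 < (ε : ℝ) * det2 (ic u) x} ∪ Ray α (ic u) := by
    rw [Set.inter_comm, Set.inter_union_diff]
  have := rat_bound w hSep hκ'0 q u y hp hq0 (by
    rcases hε with rfl | rfl
    · left; rw [hdy]; ring
    · right; rw [hdy]; ring) (by
      rw [hunion]; right; exact ⟨by simp [det2]; ring, hA⟩) (by
      rw [hunion]; left; simp only [Set.mem_setOf_eq]; rw [hdyr, ← mul_assoc, hεsq, one_mul]
      exact hqr) lu ly
  rwa [hset] at this

lemma err_sub_zero (w : (Fin 2 → ℝ) →L[ℝ] ℝ) {T : Set (Fin 2 → ℝ)} (hT : T ⊆ {0}) (β : ℝ) :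
    err T α w β = 0 := by
  classical
  have hI : Is T α w = 0 := by
    unfold Is
    exact setIntegral_measure_zero _ (measure_mono_null hT (by simp))
  have hG : Gs T α w β = 0 := by
    unfold Gs
    rw [show (0 : ℝ) = ∑' v : Fin 2 → ℤ, (0 : ℝ) by simp]
    apply tsum_congr
    intro v
    split_ifs with hv
    · rw [Set.indicator_of_notMem]
      intro hvT
      have h1 : ic v = 0 := hT hvT
      have := one_le_norm_ic hv.1
      rw [h1, norm_zero] at this; linarith
    · simp
  unfold err
  rw [hI, hG]; simp

lemma exists_prim {S : Set (Fin 2 → ℝ)} (h : GCone S α κ) (hi : (interior S).Nonempty) :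
    ∃ u : Fin 2 → ℤ, IsPrimitiveVec u ∧ ic u ∈ S := by
  have hex : ∃ v : Fin 2 → ℤ, v ≠ 0 ∧ ic v ∈ S := by
    obtain ⟨x, hx⟩ := hi
    rw [mem_interior_iff_mem_nhds, Metric.mem_nhds_iff] at hx
    obtain ⟨r, hr, hb⟩ := hx
    obtain ⟨N, hN⟩ := exists_nat_gt (2 / r)
    have hN0 : (0 : ℝ) < N := lt_trans (by positivity) hN
    rw [div_lt_iff₀ hr] at hN
    have key : ∀ v : Fin 2 → ℤ, ‖ic v - (N : ℝ) • x‖ ≤ 3 / 2 → ic v ∈ S := by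
      intro v hv
      have h1 : (1 / (N : ℝ)) • ic v ∈ S := by
        apply hb
        rw [Metric.mem_ball, dist_eq_norm]
        have : (1 / (N : ℝ)) • ic v - x = (1 / (N : ℝ)) • (ic v - (N : ℝ) • x) := by
          rw [smul_sub, smul_smul, one_div_mul_cancel hN0.ne', one_smul]
        rw [this, norm_smul, norm_of_nonneg (by positivity), one_div_mul_eq_div,
          div_lt_iff₀ hN0]
        linarith
      have := h.smul N hN0 _ h1
      rwa [smul_smul, mul_one_div_cancel hN0.ne', one_smul] at this
    have hround : ∃ v : Fin 2 → ℤ, ‖ic v - (N : ℝ) • x‖ ≤ 1 / 2 := by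
      refine ⟨fun i => round (N * x i), ?_⟩
      rw [pi_norm_le_iff_of_nonneg (by norm_num)]
      intro i
      have := abs_sub_round (N * x i)
      rw [abs_sub_comm] at this
      simpa [ic] using this
    obtain ⟨v, hv⟩ := hround
    by_cases hv0 : v = 0
    · refine ⟨fun _ => 1, ?_, key _ ?_⟩
      · intro h0; simpa using congrFun h0 0
      · have h1 : ic (fun _ : Fin 2 => (1 : ℤ)) - (N : ℝ) • x =
            ic (fun _ : Fin 2 => (1 : ℤ)) + (ic v - (N : ℝ) • x) := by
          rw [hv0]; ext i; simp [ic]; ring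
        rw [h1]
        have h2 : ‖ic (fun _ : Fin 2 => (1 : ℤ))‖ ≤ 1 := by
          rw [pi_norm_le_iff_of_nonneg (by norm_num)]
          intro i; simp [ic]
        refine (norm_add_le _ _).trans (by linarith)
    · exact ⟨v, hv0, key v (by linarith)⟩
  obtain ⟨v, hv0, hvS⟩ := hex
  have hg := vgcd_ne_zero hv0
  have hdv := (dvd_vgcd (m := vgcd v) (v := v)).1 dvd_rfl
  choose u hu using hdv
  have hvu : v = (vgcd v : ℤ) • u := by ext i; simpa using hu i
  have hu0 : u ≠ 0 := by
    rintro rfl; apply hv0; rw [hvu]; simp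
  refine ⟨u, ?_, ?_⟩
  · rw [← vgcd_eq_one hu0]
    have h1 : vgcd v * vgcd u ∣ vgcd v := by
      rw [dvd_vgcd]
      intro i
      rw [hu i]; push_cast
      exact mul_dvd_mul_left _ ((dvd_vgcd (m := vgcd u) (v := u)).1 dvd_rfl i)
    have h2 : vgcd v * vgcd u ∣ vgcd v * 1 := by rwa [mul_one]
    exact Nat.dvd_one.1 (Nat.dvd_of_mul_dvd_mul_left (Nat.pos_of_ne_zero hg) h2)
  · have hgr : (0 : ℝ) < vgcd v := by exact_mod_cast Nat.pos_of_ne_zero hg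
    have h1 : ic u = (1 / (vgcd v : ℝ)) • ic v := by
      have : ic v = (vgcd v : ℝ) • ic u := by
        ext i; have := hu i; simp only [ic, Pi.smul_apply, smul_eq_mul]
        exact_mod_cast this
      rw [this, smul_smul, one_div_mul_cancel hgr.ne', one_smul]
    rw [h1]; exact h.smul _ (by positivity) _ hvS

lemma two_bound (w : (Fin 2 → ℝ) →L[ℝ] ℝ) {S : Set (Fin 2 → ℝ)} (h : GCone S α κ)
    (hi : (interior S).Nonempty) : ∃ K, ∀ β : ℝ, 0 < β → |err S α w β| ≤ K / β ^ 2 := by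
  have hκ := h.pos
  obtain ⟨u, hp, hu⟩ := exists_prim h hi
  have hun := one_le_norm_ic hp.1
  have hA : 0 < α (ic u) := by have := h.low _ hu; nlinarith
  obtain ⟨K1, hK1⟩ := half_bound w h hp hu (ε := 1) (Or.inl rfl)
  obtain ⟨K2, hK2⟩ := half_bound w h hp hu (ε := -1) (Or.inr rfl)
  obtain ⟨K3, hK3⟩ := ray_bound w hp hA (Set.inter_subset_right (s := S) (t := Ray α (ic u)))
  have mH : ∀ ε : ℤ, MeasurableSet {x | 0 < (ε : ℝ) * det2 (ic u) x} := fun ε =>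
    (isOpen_lt continuous_const (continuous_const.mul
      (continuous_det2_right (ic u)))).measurableSet
  have m1 := h.meas.inter (mH 1)
  have m2 := h.meas.inter (mH (-1))
  have m3 := h.meas.inter (meas_Ray (α := α) (ic u))
  have m4 : MeasurableSet (S ∩ {0}) := h.meas.inter (measurableSet_singleton _)
  have hS : S = (S ∩ {x | 0 < ((1 : ℤ) : ℝ) * det2 (ic u) x}) ∪
      ((S ∩ {x | 0 < ((-1 : ℤ) : ℝ) * det2 (ic u) x}) ∪ ((S ∩ Ray α (ic u)) ∪ (S ∩ {0}))) := by
    rw [← Set.inter_union_distrib_left, ← Set.inter_union_distrib_left,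
      ← Set.inter_union_distrib_left, eq_comm, Set.inter_eq_left]
    intro x hx
    rcases lt_trichotomy (det2 (ic u) x) 0 with h1 | h1 | h1
    · right; left; simpa using h1
    · right; right
      by_cases hx0 : x = 0
      · right; exact hx0
      · left
        refine ⟨h1, ?_⟩
        have := h.low x hx
        have := norm_pos_iff.2 hx0
        nlinarith
    · left; simpa using h1
  have d34 : Disjoint (S ∩ Ray α (ic u)) (S ∩ {0}) := by
    rw [Set.disjoint_left]
    rintro x ⟨-, -, hx⟩ ⟨-, hx'⟩
    rw [Set.mem_singleton_iff.1 hx'] at hx; simp at hx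
  have d2 : Disjoint (S ∩ {x | 0 < ((-1 : ℤ) : ℝ) * det2 (ic u) x})
      ((S ∩ Ray α (ic u)) ∪ (S ∩ {0})) := by
    rw [Set.disjoint_left]
    rintro x ⟨-, hx⟩ (⟨-, hx', -⟩ | ⟨-, hx'⟩)
    · simp [hx'] at hx
    · rw [Set.mem_singleton_iff.1 hx'] at hx; simp [det2] at hx
  have d1 : Disjoint (S ∩ {x | 0 < ((1 : ℤ) : ℝ) * det2 (ic u) x})
      ((S ∩ {x | 0 < ((-1 : ℤ) : ℝ) * det2 (ic u) x}) ∪ ((S ∩ Ray α (ic u)) ∪ (S ∩ {0}))) := by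
    rw [Set.disjoint_left]
    rintro x ⟨-, hx⟩ (⟨-, hx'⟩ | ⟨-, hx', -⟩ | ⟨-, hx'⟩)
    · simp at hx hx'; linarith
    · simp [hx'] at hx
    · rw [Set.mem_singleton_iff.1 hx'] at hx; simp [det2] at hx
  refine ⟨K1 + (K2 + K3), fun β hβ => ?_⟩
  have low : ∀ x ∈ S, κ * ‖x‖ ≤ α x := h.low
  rw [hS, err_union hκ (fun x hx => low x hx.1) (fun x hx => low x (by
        rcases hx with hx | hx | hx <;> exact hx.1)) m1 (m2.union (m3.union m4)) d1 w hβ,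
    err_union hκ (fun x hx => low x hx.1) (fun x hx => low x (by
        rcases hx with hx | hx <;> exact hx.1)) m2 (m3.union m4) d2 w hβ,
    err_union hκ (fun x hx => low x hx.1) (fun x hx => low x hx.1) m3 m4 d34 w hβ,
    err_sub_zero w Set.inter_subset_right, add_zero, add_div, add_div]
  exact (abs_add_le _ _).trans (add_le_add (hK1 β hβ)
    ((abs_add_le _ _).trans (add_le_add (hK2 β hβ) (hK3 β hβ))))

end TwoE


section Gam
variable {d : ℕ} {S : Set (Fin d → ℝ)} {α : (Fin d → ℝ) →L[ℝ] ℝ} {κ : ℝ}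

/-- the level integral -/
def Js (S : Set (Fin d → ℝ)) (α w : (Fin d → ℝ) →L[ℝ] ℝ) (r : ℝ) : ℝ :=
  ∫ x in S ∩ {x | α x ≤ r}, w x

lemma smul_mem_iff' (h : GCone S α κ) {c : ℝ} (hc : 0 < c) (x : Fin d → ℝ) : c • x ∈ S ↔ x ∈ S := by
  constructor
  · intro hx
    have := h.smul c⁻¹ (by positivity) _ hx
    rwa [smul_smul, inv_mul_cancel₀ hc.ne', one_smul] at this
  · exact h.smul c hc x

lemma meas_lev (h : GCone S α κ) (r : ℝ) : MeasurableSet (S ∩ {x | α x ≤ r}) :=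
  h.meas.inter (isClosed_le α.continuous continuous_const).measurableSet

lemma Js_pos (h : GCone S α κ) (w : (Fin d → ℝ) →L[ℝ] ℝ) {r : ℝ} (hr : 0 < r) :
    Js S α w r = r ^ (d + 1) * Js S α w 1 := by
  unfold Js
  rw [← integral_indicator (meas_lev h r), ← integral_indicator (meas_lev h 1)]
  have h1 := Measure.integral_comp_smul (volume : Measure (Fin d → ℝ))
    ((S ∩ {x | α x ≤ r}).indicator (fun x => w x)) r
  have h2 : (fun x => (S ∩ {x | α x ≤ r}).indicator (fun x => w x) (r • x)) =
      fun x => r * (S ∩ {x | α x ≤ 1}).indicator (fun x => w x) x := by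
    ext x
    have h3 : r • x ∈ S ∩ {x | α x ≤ r} ↔ x ∈ S ∩ {x | α x ≤ 1} := by
      refine and_congr (smul_mem_iff' h hr x) ?_
      change α (r • x) ≤ r ↔ α x ≤ 1
      rw [map_smul, smul_eq_mul]
      constructor
      · intro h4; nlinarith
      · intro h4; nlinarith
    by_cases hx : x ∈ S ∩ {x | α x ≤ 1}
    · rw [Set.indicator_of_mem hx, Set.indicator_of_mem (h3.2 hx), map_smul, smul_eq_mul]
    · rw [Set.indicator_of_notMem hx, Set.indicator_of_notMem (fun h5 => hx (h3.1 h5)), mul_zero]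
  rw [h2, integral_const_mul, Module.finrank_fin_fun, smul_eq_mul,
    abs_of_pos (by positivity : (0 : ℝ) < (r ^ d)⁻¹)] at h1
  rw [pow_succ, mul_assoc, h1, ← mul_assoc, mul_inv_cancel₀ (by positivity), one_mul]

lemma Js_nonpos (h : GCone S α κ) (w : (Fin d → ℝ) →L[ℝ] ℝ) {r : ℝ} (hr : r ≤ 0) :
    Js S α w r = 0 := by
  unfold Js
  refine setIntegral_eq_zero_of_forall_eq_zero ?_
  rintro x ⟨hx, hx'⟩
  have h1 := h.low x hx
  have h2 : α x ≤ r := hx'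
  have h3 : ‖x‖ ≤ 0 := by
    have := h.pos; by_contra h4; push Not at h4; nlinarith
  rw [norm_le_zero_iff.1 h3, map_zero]

lemma Is_eq_Js (h : GCone S α κ) (w : (Fin d → ℝ) →L[ℝ] ℝ) :
    Is S α w = (Nat.factorial (d + 1) : ℝ) * Js S α w 1 := by
  classical
  have hIntg := intOn_lin h.meas h.pos h.low w one_pos
  simp only [one_mul] at hIntg
  set E : Set ((Fin d → ℝ) × ℝ) := {p | p.1 ∈ S ∧ α p.1 ≤ p.2} with hE
  have mE : MeasurableSet E :=
    (measurable_fst h.meas).inter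
      (isClosed_le (α.continuous.comp continuous_fst) continuous_snd).measurableSet
  set f : (Fin d → ℝ) × ℝ → ℝ := E.indicator (fun p => w p.1 * exp (-p.2)) with hf
  have mf : Measurable f := by
    refine Measurable.indicator ?_ mE
    exact (Continuous.measurable (by fun_prop))
  have hfx : ∀ x, (fun r => f (x, r)) =
      if x ∈ S then (Set.Ici (α x)).indicator (fun r => w x * exp (-r)) else fun _ => 0 := by
    intro x
    ext r
    split_ifs with hx
    · by_cases hr : α x ≤ r
      · rw [hf, Set.indicator_of_mem (show (x, r) ∈ E from ⟨hx, hr⟩),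
          Set.indicator_of_mem (show r ∈ Set.Ici (α x) from hr)]
      · rw [hf, Set.indicator_of_notMem (fun h' : (x, r) ∈ E => hr h'.2),
          Set.indicator_of_notMem (fun h' : r ∈ Set.Ici (α x) => hr h')]
    · rw [hf, Set.indicator_of_notMem (fun h' : (x, r) ∈ E => hx h'.1)]
  have hexp : ∀ s : ℝ, IntegrableOn (fun r => exp (-r)) (Set.Ici s) := by
    intro s
    rw [integrableOn_Ici_iff_integrableOn_Ioi]
    exact integrableOn_exp_neg_Ioi s
  have hexpI : ∀ s : ℝ, ∫ r in Set.Ici s, exp (-r) = exp (-s) := by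
    intro s
    rw [integral_Ici_eq_integral_Ioi, integral_exp_neg_Ioi]
  have hfi : Integrable f (volume.prod volume) := by
    rw [integrable_prod_iff mf.aestronglyMeasurable]
    constructor
    · refine Filter.Eventually.of_forall (fun x => ?_)
      rw [hfx]
      split_ifs with hx
      · rw [integrable_indicator_iff measurableSet_Ici]
        exact (hexp _).const_mul _
      · exact integrable_zero _ _ _
    · have : (fun x => ∫ r, ‖f (x, r)‖) = S.indicator (fun x => ‖w x * exp (-(α x))‖) := by
        ext x
        have e1 : (fun r => ‖f (x, r)‖) = fun r => ‖(fun r => f (x, r)) r‖ := rfl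
        rw [e1, hfx]
        by_cases hx : x ∈ S
        · rw [if_pos hx, Set.indicator_of_mem hx]
          simp_rw [norm_indicator_eq_indicator_norm]
          rw [integral_indicator measurableSet_Ici]
          simp_rw [norm_mul, Real.norm_of_nonneg (exp_pos _).le]
          rw [integral_const_mul, hexpI]
        · rw [if_neg hx, Set.indicator_of_notMem hx]; simp
      rw [this, integrable_indicator_iff h.meas]
      exact hIntg.norm
  have L : ∫ x, ∫ r, f (x, r) = Is S α w := by
    unfold Is
    rw [← integral_indicator h.meas]
    congr 1
    ext x
    rw [hfx]
    by_cases hx : x ∈ S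
    · rw [if_pos hx, Set.indicator_of_mem hx, integral_indicator measurableSet_Ici,
        integral_const_mul, hexpI]
    · rw [if_neg hx, Set.indicator_of_notMem hx]; simp
  have R : ∫ r, ∫ x, f (x, r) = (Nat.factorial (d + 1) : ℝ) * Js S α w 1 := by
    have e1 : ∀ r, ∫ x, f (x, r) = exp (-r) * Js S α w r := by
      intro r
      unfold Js
      rw [← integral_indicator (meas_lev h r), ← integral_const_mul]
      congr 1
      ext x
      by_cases hx : x ∈ S ∩ {x | α x ≤ r}
      · rw [Set.indicator_of_mem hx, hf, Set.indicator_of_mem (show (x, r) ∈ E from hx), mul_comm]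
      · rw [Set.indicator_of_notMem hx, hf, Set.indicator_of_notMem (fun h' : (x, r) ∈ E => hx h'),
          mul_zero]
    have e2 : (fun r => ∫ x, f (x, r)) =
        (Set.Ioi (0 : ℝ)).indicator (fun r => (exp (-r) * r ^ (d + 1)) * Js S α w 1) := by
      ext r
      rw [e1]
      by_cases hr : 0 < r
      · rw [Set.indicator_of_mem (show r ∈ Set.Ioi (0 : ℝ) from hr), Js_pos h w hr, mul_assoc]
      · rw [Set.indicator_of_notMem (show r ∉ Set.Ioi (0 : ℝ) from hr),
          Js_nonpos h w (not_lt.1 hr), mul_zero]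
    rw [e2, integral_indicator measurableSet_Ioi, integral_mul_const]
    congr 1
    have := Real.Gamma_eq_integral (s := ((d + 1 : ℕ) : ℝ) + 1) (by positivity)
    rw [Real.Gamma_nat_eq_factorial] at this
    rw [this]
    refine setIntegral_congr_fun measurableSet_Ioi (fun r _ => ?_)
    simp
    norm_cast
  rw [← L, ← R]
  exact integral_integral_swap hfi

end Gam


section Fin
variable {d : ℕ}

lemma all_bound (hd : 2 ≤ d) {S : Set (Fin d → ℝ)} {α : (Fin d → ℝ) →L[ℝ] ℝ} {κ : ℝ}
    (h : GCone S α κ) (hi : (interior S).Nonempty) (w : (Fin d → ℝ) →L[ℝ] ℝ) :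
    ∃ K, ∀ β, 0 < β → |err S α w β| ≤ K / β ^ d := by
  rcases hd.eq_or_lt with h2 | h3
  · subst h2; exact two_bound w h hi
  · exact err_bound_three h3 h hi w

/-- the linear functional given by a vector -/
def alphaL (a : EuclideanSpace ℝ (Fin d)) : (Fin d → ℝ) →L[ℝ] ℝ :=
  ∑ i, a i • ContinuousLinearMap.proj (R := ℝ) (φ := fun _ : Fin d => ℝ) i

lemma alphaL_apply (a : EuclideanSpace ℝ (Fin d)) (x : EuclideanSpace ℝ (Fin d)) :
    alphaL a (EuclideanSpace.equiv (Fin d) ℝ x) = dotR a x := by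
  simp [alphaL, dotR, ContinuousLinearMap.sum_apply]

lemma alphaL_apply' (a : EuclideanSpace ℝ (Fin d)) (x : Fin d → ℝ) :
    alphaL a x = dotR a ((EuclideanSpace.equiv (Fin d) ℝ).symm x) := by
  rw [← alphaL_apply, ContinuousLinearEquiv.apply_symm_apply]

/-- cone in plain coordinates -/
def coneP (C1 : Set (EuclideanSpace ℝ (Fin d))) : Set (Fin d → ℝ) :=
  (EuclideanSpace.equiv (Fin d) ℝ).symm ⁻¹' C1

lemma gcone_coneP {C1 : Set (EuclideanSpace ℝ (Fin d))} (hC1 : IsGoodCone C1)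
    (a : EuclideanSpace ℝ (Fin d)) (ha : ∀ x ∈ C1, x ≠ 0 → 0 < dotR a x) :
    ∃ κ, GCone (coneP C1) (alphaL a) κ := by
  have hcl : IsClosed (coneP C1) :=
    hC1.closed.preimage (EuclideanSpace.equiv (Fin d) ℝ).symm.continuous
  have hsm : ∀ c : ℝ, 0 < c → ∀ x ∈ coneP C1, c • x ∈ coneP C1 := by
    intro c hc x hx
    change (EuclideanSpace.equiv (Fin d) ℝ).symm (c • x) ∈ C1
    rw [map_smul]
    exact hC1.smul_mem c hc.le _ hx
  have hadd : ∀ x ∈ coneP C1, ∀ y ∈ coneP C1, x + y ∈ coneP C1 := by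
    intro x hx y hy
    change (EuclideanSpace.equiv (Fin d) ℝ).symm (x + y) ∈ C1
    rw [map_add]
    have h1 := hC1.convex hx hy (a := 1 / 2) (b := 1 / 2) (by norm_num) (by norm_num) (by norm_num)
    have h2 := hC1.smul_mem 2 (by norm_num) _ h1
    rw [smul_add, smul_smul, smul_smul] at h2
    norm_num at h2
    exact h2
  have hpos : ∀ x ∈ coneP C1, x ≠ 0 → 0 < alphaL a x := by
    intro x hx hx0
    rw [alphaL_apply']
    refine ha _ hx ?_
    intro h0
    apply hx0
    have := congrArg (EuclideanSpace.equiv (Fin d) ℝ) h0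
    simpa using this
  have hcomp : IsCompact (coneP C1 ∩ Metric.sphere 0 1) :=
    (isCompact_sphere _ _).inter_left hcl
  have hκ : ∃ κ : ℝ, 0 < κ ∧ ∀ x ∈ coneP C1 ∩ Metric.sphere 0 1, κ ≤ alphaL a x := by
    rcases (coneP C1 ∩ Metric.sphere (0 : Fin d → ℝ) 1).eq_empty_or_nonempty with he | hne
    · exact ⟨1, one_pos, by rw [he]; simp⟩
    · obtain ⟨x0, hx0, hmin⟩ := hcomp.exists_isMinOn hne (alphaL a).continuous.continuousOn
      refine ⟨alphaL a x0, hpos x0 hx0.1 ?_, fun x hx => hmin hx⟩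
      rintro rfl
      have := hx0.2
      simp at this
  obtain ⟨κ, hκ0, hκ1⟩ := hκ
  refine ⟨κ, hcl.measurableSet, hadd, hsm, hκ0, fun x hx => ?_⟩
  by_cases hx0 : x = 0
  · subst hx0; simp
  · have hn : 0 < ‖x‖ := norm_pos_iff.2 hx0
    have h1 := hκ1 (‖x‖⁻¹ • x) ⟨hsm _ (by positivity) x hx, by
      rw [mem_sphere_zero_iff_norm, norm_smul, norm_inv, norm_norm, inv_mul_cancel₀ hn.ne']⟩
    rw [map_smul, smul_eq_mul, inv_mul_eq_div, le_div_iff₀ hn] at h1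
    exact h1

lemma interior_coneP {C1 : Set (EuclideanSpace ℝ (Fin d))} (hC1 : IsGoodCone C1) :
    (interior (coneP C1)).Nonempty := by
  obtain ⟨x, hx⟩ := hC1.fullDim
  refine ⟨EuclideanSpace.equiv (Fin d) ℝ x, ?_⟩
  have h1 : IsOpen ((EuclideanSpace.equiv (Fin d) ℝ).symm ⁻¹' (interior C1)) :=
    isOpen_interior.preimage (EuclideanSpace.equiv (Fin d) ℝ).symm.continuous
  refine interior_maximal (Set.preimage_mono interior_subset) h1 ?_
  simpa using hx

/-- coordinate functional -/
def prj (i : Fin d) : (Fin d → ℝ) →L[ℝ] ℝ :=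
  ContinuousLinearMap.proj (R := ℝ) (φ := fun _ : Fin d => ℝ) i

lemma prj_apply (i : Fin d) (x : Fin d → ℝ) : prj i x = x i := rfl

lemma muN_eq {C1 : Set (EuclideanSpace ℝ (Fin d))} {a : EuclideanSpace ℝ (Fin d)} {κ : ℝ}
    (h : GCone (coneP C1) (alphaL a) κ) (n : ℕ) (hβ : 0 < betaSeq d n) :
    muN a C1 n = (EuclideanSpace.equiv (Fin d) ℝ).symm
      (fun i => Gs (coneP C1) (alphaL a) (prj i) (betaSeq d n)) := by
  classical
  set S := coneP C1 with hS
  set α := alphaL a with hα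
  set β := betaSeq d n with hβd
  set e := EuclideanSpace.equiv (Fin d) ℝ with he
  set g : (Fin d → ℤ) → (Fin d → ℝ) := fun v =>
    if IsPrimitiveVec v ∧ ic v ∈ S then Qf (β * α (ic v)) • ic v else 0 with hg
  have h1 : HasSum g (fun i => Gs S α (prj i) β) := by
    rw [Pi.hasSum]
    intro i
    have h2 := (summable_Gs h.pos h.low (prj i) hβ).hasSum
    convert! h2 using 1
    ext v
    simp only [hg]
    by_cases hv : IsPrimitiveVec v
    · by_cases hvS : ic v ∈ S
      · rw [if_pos ⟨hv, hvS⟩, if_pos hv, Set.indicator_of_mem hvS, prj_apply, Pi.smul_apply,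
          smul_eq_mul, mul_comm]
      · rw [if_neg (fun hh => hvS hh.2), if_pos hv, Set.indicator_of_notMem hvS]; rfl
    · rw [if_neg (fun hh => hv hh.1), if_neg hv]; rfl
  have h2 : HasSum (fun v => e.symm (g v)) (e.symm (fun i => Gs S α (prj i) β)) :=
    h1.mapL (e.symm : (Fin d → ℝ) →L[ℝ] EuclideanSpace ℝ (Fin d))
  set A : Set (Fin d → ℤ) := {v | IsPrimitiveVec v ∧ ic v ∈ S} with hA
  have h3 := (hasSum_subtype_iff_of_support_subset (s := A) (f := fun v => e.symm (g v)) (by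
    intro v hv
    by_contra hvA
    apply hv
    have : ¬ (IsPrimitiveVec v ∧ ic v ∈ S) := hvA
    simp only [hg]
    rw [if_neg this, map_zero])).2 h2
  let φ : A → ↥(primSet d ∩ C1) := fun v =>
    ⟨e.symm (ic v.1), ⟨v.1, v.2.1, fun i => rfl⟩, v.2.2⟩
  have hφ : Function.Bijective φ := by
    constructor
    · intro v v' hvv
      have h4 : e.symm (ic v.1) = e.symm (ic v'.1) := congrArg Subtype.val hvv
      have h5 := e.symm.injective h4
      apply Subtype.ext
      ext i
      have := congrFun h5 i
      simp only [ic] at this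
      exact_mod_cast this
    · rintro ⟨x, ⟨v, hv, hx⟩, hxC⟩
      have h4 : e.symm (ic v) = x := by
        ext i; exact (hx i).symm
      refine ⟨⟨v, hv, ?_⟩, ?_⟩
      · change e.symm (ic v) ∈ C1
        rw [h4]; exact hxC
      · exact Subtype.ext h4
  have h6 := (Equiv.hasSum_iff (Equiv.ofBijective φ hφ)
    (f := fun x : ↥(primSet d ∩ C1) =>
    (Real.exp (-(betaSeq d n * dotR a x)) / (1 - Real.exp (-(betaSeq d n * dotR a x)))) •
      (x : EuclideanSpace ℝ (Fin d))) (a := e.symm (fun i => Gs S α (prj i) β))).1 (by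
      convert! h3 using 1
      ext1 v
      have hv : IsPrimitiveVec v.1 ∧ ic v.1 ∈ S := v.2
      simp only [Function.comp_apply, hg]
      rw [if_pos hv, map_smul, hα, alphaL_apply']
      rfl)
  exact h6.tsum_eq

lemma muLim_eq {C C1 : Set (EuclideanSpace ℝ (Fin d))} (hsub : C1 ⊆ C)
    {a : EuclideanSpace ℝ (Fin d)} {κ : ℝ}
    (h : GCone (coneP C1) (alphaL a) κ) :
    muLim a C C1 = (EuclideanSpace.equiv (Fin d) ℝ).symm
      (fun i => Is (coneP C1) (alphaL a) (prj i)) := by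
  set e := EuclideanSpace.equiv (Fin d) ℝ with he
  have hset : (WithLp.toLp 2 : (Fin d → ℝ) → EuclideanSpace ℝ (Fin d)) ⁻¹'
      ({x ∈ C | dotR a x ≤ 1} ∩ C1) = coneP C1 ∩ {x | alphaL a x ≤ 1} := by
    ext x
    constructor
    · rintro ⟨⟨-, h1⟩, h2⟩
      refine ⟨h2, ?_⟩
      change alphaL a x ≤ 1
      rw [alphaL_apply']; exact h1
    · rintro ⟨h1, h2⟩
      have h2' : alphaL a x ≤ 1 := h2
      rw [alphaL_apply'] at h2'
      exact ⟨⟨hsub h1, h2'⟩, h1⟩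
  have h1 := (PiLp.volume_preserving_toLp (Fin d)).setIntegral_preimage_emb
    (MeasurableEquiv.toLp 2 (Fin d → ℝ)).measurableEmbedding
    (fun x : EuclideanSpace ℝ (Fin d) => x) ({x ∈ C | dotR a x ≤ 1} ∩ C1)
  unfold muLim
  rw [← h1, hset]
  have h2 := e.symm.integral_comp_comm (μ := volume.restrict (coneP C1 ∩ {x | alphaL a x ≤ 1}))
    (fun x => x)
  have h3 : ∫ x in coneP C1 ∩ {x | alphaL a x ≤ 1}, (WithLp.toLp 2 x : EuclideanSpace ℝ (Fin d)) =
      e.symm (∫ x in coneP C1 ∩ {x | alphaL a x ≤ 1}, x) := h2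
  rw [h3, ← map_smul]
  congr 1
  ext i
  have hIntg : IntegrableOn (fun x : Fin d → ℝ => x) (coneP C1 ∩ {x | alphaL a x ≤ 1}) := by
    have hb : coneP C1 ∩ {x | alphaL a x ≤ 1} ⊆ Metric.closedBall 0 (1 / κ) := by
      rintro x ⟨hx, hx'⟩
      have hx'' : alphaL a x ≤ 1 := hx'
      have := h.low x hx
      rw [mem_closedBall_zero_iff, le_div_iff₀ h.pos]; linarith
    exact (continuous_id.continuousOn.integrableOn_compact
      (isCompact_closedBall (0 : Fin d → ℝ) (1 / κ))).mono_set hb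
  have h4 := (prj i).integral_comp_comm hIntg
  rw [Is_eq_Js h]
  unfold Js
  rw [h4]
  rfl

lemma betaSeq_pos (hd : 2 ≤ d) {n : ℕ} (hn : 0 < n) : 0 < betaSeq d n := by
  have h1 := zetaR_pos hd
  have h2 := zetaR_pos (p := d + 1) (by omega)
  unfold betaSeq
  have : (0 : ℝ) < n := by exact_mod_cast hn
  positivity

lemma betaSeq_pow (hd : 2 ≤ d) {n : ℕ} (hn : 0 < n) :
    betaSeq d n ^ (d + 1) = zetaR (d + 1) / (zetaR d * n) := by
  have h1 := zetaR_pos hd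
  have h2 := zetaR_pos (p := d + 1) (by omega)
  have : (0 : ℝ) < n := by exact_mod_cast hn
  unfold betaSeq
  rw [← Real.rpow_natCast, ← Real.rpow_mul (by positivity)]
  push_cast
  rw [one_div_mul_cancel (by positivity), Real.rpow_one]

lemma betaSeq_eq (hd : 2 ≤ d) {n : ℕ} (hn : 0 < n) :
    betaSeq d n = (zetaR (d + 1) / zetaR d) ^ ((1 : ℝ) / (d + 1)) *
      (n : ℝ) ^ (-(1 : ℝ) / ((d : ℝ) + 1)) := by
  have h1 := zetaR_pos hd
  have h2 := zetaR_pos (p := d + 1) (by omega)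
  have : (0 : ℝ) < n := by exact_mod_cast hn
  unfold betaSeq
  rw [← div_div, Real.div_rpow (by positivity) (by positivity), neg_div,
    Real.rpow_neg (by positivity)]
  rfl

lemma coord_bound (hd : 2 ≤ d) {S : Set (Fin d → ℝ)} {α : (Fin d → ℝ) →L[ℝ] ℝ} {κ : ℝ}
    (h : GCone S α κ) (hi : (interior S).Nonempty) (w : (Fin d → ℝ) →L[ℝ] ℝ) :
    (fun n : ℕ => (n : ℝ)⁻¹ * Gs S α w (betaSeq d n) - Is S α w)
      =O[atTop] (fun n : ℕ => (n : ℝ) ^ (-(1 : ℝ) / ((d : ℝ) + 1))) := by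
  obtain ⟨K, hK⟩ := all_bound hd h hi w
  have h1 := zetaR_pos hd
  have h2 := zetaR_pos (p := d + 1) (by omega)
  refine IsBigO.of_bound (K * (zetaR d / zetaR (d + 1)) *
    (zetaR (d + 1) / zetaR d) ^ ((1 : ℝ) / (d + 1))) ?_
  filter_upwards [eventually_gt_atTop 0] with n hn
  have hnr : (0 : ℝ) < n := by exact_mod_cast hn
  have hβ := betaSeq_pos hd hn
  have hp := betaSeq_pow hd hn
  have he := betaSeq_eq hd hn
  have hb := hK _ hβ
  unfold err at hb
  have e1 : zetaR (d + 1) / zetaR d * (Is S α w / betaSeq d n ^ (d + 1)) = n * Is S α w := by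
    rw [hp]; field_simp
  rw [e1] at hb
  have e2 : (n : ℝ)⁻¹ * Gs S α w (betaSeq d n) - Is S α w =
      (n : ℝ)⁻¹ * (Gs S α w (betaSeq d n) - n * Is S α w) := by field_simp
  rw [e2, norm_mul, Real.norm_of_nonneg (inv_nonneg.2 hnr.le), Real.norm_eq_abs,
    Real.norm_of_nonneg (by positivity)]
  refine (mul_le_mul_of_nonneg_left hb (inv_nonneg.2 hnr.le)).trans (le_of_eq ?_)
  rw [mul_assoc, ← he]
  have e3 : K / betaSeq d n ^ d = K * betaSeq d n / betaSeq d n ^ (d + 1) := by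
    rw [pow_succ]; field_simp
  rw [e3, hp]
  field_simp

end Fin

/-- As `n → ∞`, `(1/n) μ^n(C_1) = μ(C_1) + O(n^{-1/(d+1)})`; in particular
`(1/n) μ^n(C_1) → μ(C_1)`. -/
theorem mean_asymptotics {d : ℕ} (hd : 2 ≤ d)
    (C C1 : Set (EuclideanSpace ℝ (Fin d)))
    (hC : IsGoodCone C) (hC1 : IsGoodCone C1) (hC1sub : C1 ⊆ C)
    (a : EuclideanSpace ℝ (Fin d)) (ha : ∀ x ∈ C, x ≠ 0 → 0 < dotR a x) :
    (fun n : ℕ => (n : ℝ)⁻¹ • muN a C1 n - muLim a C C1)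
        =O[atTop] (fun n : ℕ => (n : ℝ) ^ (-(1 : ℝ) / ((d : ℝ) + 1))) ∧
    Tendsto (fun n : ℕ => (n : ℝ)⁻¹ • muN a C1 n) atTop (𝓝 (muLim a C C1)) := by
  obtain ⟨κ, h⟩ := gcone_coneP hC1 a (fun x hx => ha x (hC1sub hx))
  have hi := interior_coneP hC1
  have hO : (fun n : ℕ => (n : ℝ)⁻¹ • muN a C1 n - muLim a C C1)
        =O[atTop] (fun n : ℕ => (n : ℝ) ^ (-(1 : ℝ) / ((d : ℝ) + 1))) := by
    have h1 : (fun (n : ℕ) (i : Fin d) => (n : ℝ)⁻¹ * Gs (coneP C1) (alphaL a) (prj i) (betaSeq d n)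
        - Is (coneP C1) (alphaL a) (prj i))
        =O[atTop] (fun n : ℕ => (n : ℝ) ^ (-(1 : ℝ) / ((d : ℝ) + 1))) :=
      isBigO_pi.2 (fun i => coord_bound hd h hi (prj i))
    have h2 := (ContinuousLinearMap.isBigO_comp
      ((EuclideanSpace.equiv (Fin d) ℝ).symm : (Fin d → ℝ) →L[ℝ] EuclideanSpace ℝ (Fin d))
      (fun (n : ℕ) (i : Fin d) => (n : ℝ)⁻¹ * Gs (coneP C1) (alphaL a) (prj i) (betaSeq d n)
        - Is (coneP C1) (alphaL a) (prj i)) atTop).trans h1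
    refine h2.congr' ?_ EventuallyEq.rfl
    filter_upwards [eventually_gt_atTop 0] with n hn
    rw [muN_eq h n (betaSeq_pos hd hn), muLim_eq hC1sub h, ← map_smul, ← map_sub]
    rfl
  refine ⟨hO, ?_⟩
  have ht : Tendsto (fun n : ℕ => (n : ℝ) ^ (-(1 : ℝ) / ((d : ℝ) + 1))) atTop (𝓝 0) := by
    have hp : (0 : ℝ) < 1 / ((d : ℝ) + 1) := by positivity
    have := (tendsto_rpow_neg_atTop hp).comp tendsto_natCast_atTop_atTop
    simpa only [neg_div, Function.comp_def] using this
  exact tendsto_sub_nhds_zero_iff.1 (hO.trans_tendsto ht)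

end
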